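/- Suppose (V₁, L₁) and (V₂, L₂) are quantized metric spaces. If there exists a complete isometry from (V₁, L₁) onto (V₂, L₂), then dist_NC(V₁, V₂) = 0. -/

import Mathlib

open scoped ComplexOrder

noncomputable section

/-- The operator (ℓ² → ℓ²) norm of a complex scalar matrix. -/
noncomputable def scalarOpNorm {m n : Type*} [Fintype m] [Fintype n] [DecidableEq n]
    (γ : Matrix m n ℂ) : ℝ :=
  ‖LinearMap.toContinuousLinearMap (Matrix.toEuclideanLin γ)‖

/-- A matrix order unit space `(V, 1)`: a complex *-vector space with a distinguished
matrix ordering (given by the graded family of positive cones) and an Archimedean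
matrix order unit. -/
structure MOUS : Type 1 where
  carrier : Type
  [acg : AddCommGroup carrier]
  [mod : Module ℂ carrier]
  [sam : StarAddMonoid carrier]
  [sm : StarModule ℂ carrier]
  one : carrier
  pos : ∀ n : ℕ, Set (Matrix (Fin n) (Fin n) carrier)
  pos_add : ∀ n, ∀ v ∈ pos n, ∀ w ∈ pos n, v + w ∈ pos n
  pos_smul : ∀ n (t : ℝ), 0 ≤ t → ∀ v ∈ pos n, (t : ℂ) • v ∈ pos n
  pos_star : ∀ n, ∀ v ∈ pos n, v.conjTranspose = v
  pos_congr : ∀ n m (γ : Matrix (Fin n) (Fin m) ℂ), ∀ v ∈ pos n,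
    (Matrix.of fun i j => ∑ k, ∑ l, (star (γ k i) * γ l j) • v k l) ∈ pos m
  proper : ∀ v : Matrix (Fin 1) (Fin 1) carrier, v ∈ pos 1 → -v ∈ pos 1 → v = 0
  unit_pos : ∀ n, Matrix.diagonal (fun _ => one) ∈ pos n
  orderUnit : ∀ v : carrier, star v = v →
    ∃ t : ℝ, 0 < t ∧
      (Matrix.of fun _ _ => (t : ℂ) • one - v : Matrix (Fin 1) (Fin 1) carrier) ∈ pos 1
  archimedean : ∀ n (v : Matrix (Fin n) (Fin n) carrier),
    (∀ t : ℝ, 0 < t → v + (t : ℂ) • Matrix.diagonal (fun _ => one) ∈ pos n) → v ∈ pos n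

attribute [instance] MOUS.acg MOUS.mod MOUS.sam MOUS.sm

/-- Entrywise application of a linear map to a matrix. -/
def mapMat {V W : Type} [AddCommGroup V] [AddCommGroup W] [Module ℂ V] [Module ℂ W]
    (φ : V →ₗ[ℂ] W) {n : ℕ} (a : Matrix (Fin n) (Fin n) V) : Matrix (Fin n) (Fin n) W :=
  Matrix.of fun i j => φ (a i j)

/-- The direct sum (block diagonal) of two matrices over a vector space. -/
def dsumMat {V : Type} [AddCommGroup V] {m n : ℕ}
    (v : Matrix (Fin m) (Fin m) V) (w : Matrix (Fin n) (Fin n) V) :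
    Matrix (Fin (m + n)) (Fin (m + n)) V :=
  Matrix.reindex finSumFinEquiv finSumFinEquiv (Matrix.fromBlocks v 0 0 w)

/-- The two-sided scalar matrix product `α v β`. -/
def mmulMat {V : Type} [AddCommGroup V] [Module ℂ V] {m n : ℕ}
    (α : Matrix (Fin n) (Fin m) ℂ) (v : Matrix (Fin m) (Fin m) V)
    (β : Matrix (Fin m) (Fin n) ℂ) : Matrix (Fin n) (Fin n) V :=
  Matrix.of fun i j => ∑ k, ∑ l, (α i k * β l j) • v k l

/-- The unit matrix `1ₙ` in `Mₙ(V)`. -/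
def MOUS.unitMat (A : MOUS) (n : ℕ) : Matrix (Fin n) (Fin n) A.carrier :=
  Matrix.diagonal fun _ => A.one

/-- The matrix norm determined by the matrix order:
`‖v‖ = inf { t : [[t1, v], [v*, t1]] ≥ 0 }`. -/
def MOUS.matNorm (A : MOUS) {n : ℕ} (v : Matrix (Fin n) (Fin n) A.carrier) : ℝ :=
  sInf {t : ℝ | (Matrix.reindex finSumFinEquiv finSumFinEquiv
    (Matrix.fromBlocks ((t : ℂ) • A.unitMat n) v v.conjTranspose ((t : ℂ) • A.unitMat n)))
      ∈ A.pos (n + n)}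

/-- A matrix Lipschitz seminorm on a matrix order unit space. -/
structure IsMatrixLipschitzSeminorm (A : MOUS)
    (L : ∀ n : ℕ, Matrix (Fin n) (Fin n) A.carrier → ℝ) : Prop where
  nonneg : ∀ n v, 0 ≤ L n v
  add_le : ∀ n v w, L n (v + w) ≤ L n v + L n w
  smul_eq : ∀ n (c : ℂ) v, L n (c • v) = ‖c‖ * L n v
  null_iff : ∀ n v, L n v = 0 ↔
    ∃ lam : Matrix (Fin n) (Fin n) ℂ, v = Matrix.of fun i j => lam i j • A.one
  dsum_eq : ∀ m n v w, L (m + n) (dsumMat v w) = max (L m v) (L n w)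
  mmul_le : ∀ m n (α : Matrix (Fin n) (Fin m) ℂ) v (β : Matrix (Fin m) (Fin n) ℂ),
    L n (mmulMat α v β) ≤ scalarOpNorm α * L m v * scalarOpNorm β
  star_eq : ∀ n v, L n (Matrix.conjTranspose v) = L n v

/-- A matrix seminorm (finite matrix gauge). -/
structure IsMatrixSeminorm (A : MOUS)
    (N : ∀ n : ℕ, Matrix (Fin n) (Fin n) A.carrier → ℝ) : Prop where
  nonneg : ∀ n v, 0 ≤ N n v
  add_le : ∀ n v w, N n (v + w) ≤ N n v + N n w
  smul_le : ∀ n (c : ℂ) v, N n (c • v) ≤ ‖c‖ * N n v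
  dsum_eq : ∀ m n v w, N (m + n) (dsumMat v w) = max (N m v) (N n w)
  mmul_le : ∀ m n (α : Matrix (Fin n) (Fin m) ℂ) v (β : Matrix (Fin m) (Fin n) ℂ),
    N n (mmulMat α v β) ≤ scalarOpNorm α * N m v * scalarOpNorm β

/-- Linear maps from `V` to `Mₙ(ℂ)`; matrix states live here. -/
abbrev MState (A : MOUS) (n : ℕ) := A.carrier →ₗ[ℂ] Matrix (Fin n) (Fin n) ℂ

/-- The matrix pairing `⟨⟨φ, a⟩⟩ = [φ(a_{ij})] ∈ M_{rn}(ℂ)`. -/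
def mpair {A : MOUS} {n r : ℕ} (φ : MState A n) (a : Matrix (Fin r) (Fin r) A.carrier) :
    Matrix (Fin r × Fin n) (Fin r × Fin n) ℂ :=
  Matrix.of fun p q => φ (a p.1 q.1) p.2 q.2

/-- The `n`-th matrix state space: unital completely positive maps `V → Mₙ(ℂ)`. -/
def CS (A : MOUS) (n : ℕ) : Set (MState A n) :=
  {φ | φ A.one = 1 ∧ ∀ r, ∀ v ∈ A.pos r, (mpair φ v).PosSemidef}

/-- The matrix metric `D_{Lₙ}` on matrix states coming from a matrix Lipschitz seminorm. -/
def Dmet (A : MOUS) (L : ∀ n : ℕ, Matrix (Fin n) (Fin n) A.carrier → ℝ) (n : ℕ)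
    (φ ψ : MState A n) : ℝ :=
  sSup {x | ∃ (r : ℕ) (a : Matrix (Fin r) (Fin r) A.carrier), L r a ≤ 1 ∧
    x = scalarOpNorm (mpair φ a - mpair ψ a)}

/-- The BW (pointwise, weak-*) topology on the space of linear maps `V → Mₙ(ℂ)`. -/
def lmTop (A : MOUS) (n : ℕ) : TopologicalSpace (MState A n) :=
  TopologicalSpace.induced (fun φ => (φ : A.carrier → Matrix (Fin n) (Fin n) ℂ)) inferInstance

/-- The BW topology on the matrix state space. -/
def BWtop (A : MOUS) (n : ℕ) : TopologicalSpace {φ : MState A n // φ ∈ CS A n} :=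
  TopologicalSpace.induced Subtype.val (lmTop A n)

/-- The topology on the matrix state space defined by the matrix metric `D_L`. -/
def Dtop (A : MOUS) (L : ∀ n : ℕ, Matrix (Fin n) (Fin n) A.carrier → ℝ) (n : ℕ) :
    TopologicalSpace {φ : MState A n // φ ∈ CS A n} :=
  TopologicalSpace.generateFrom
    {U | ∃ (φ₀ : {φ : MState A n // φ ∈ CS A n}) (ε : ℝ), 0 < ε ∧
      U = {ψ | Dmet A L n φ₀.1 ψ.1 < ε}}

/-- A matrix Lip-norm: a matrix Lipschitz seminorm for which the `D_L`-topology on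
each matrix state space agrees with the BW-topology. -/
structure IsMatrixLipNorm (A : MOUS)
    (L : ∀ n : ℕ, Matrix (Fin n) (Fin n) A.carrier → ℝ)
    extends IsMatrixLipschitzSeminorm A L : Prop where
  top_eq : ∀ n, Dtop A L n = BWtop A n

/-- A unital completely positive linear map between matrix order unit spaces. -/
structure IsUCP (A B : MOUS) (φ : A.carrier →ₗ[ℂ] B.carrier) : Prop where
  unital : φ A.one = B.one
  cp : ∀ n, ∀ v ∈ A.pos n, mapMat φ v ∈ B.pos n

/-- `L` induces `LB` via the (surjective, UCP) map `φ`: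
`LB` is the corresponding family of quotient seminorms. -/
def Induces (A B : MOUS) (φ : A.carrier →ₗ[ℂ] B.carrier)
    (L : ∀ n : ℕ, Matrix (Fin n) (Fin n) A.carrier → ℝ)
    (LB : ∀ n : ℕ, Matrix (Fin n) (Fin n) B.carrier → ℝ) : Prop :=
  ∀ n (b : Matrix (Fin n) (Fin n) B.carrier),
    LB n b = sInf {x | ∃ a, mapMat φ a = b ∧ x = L n a}

/-- The quotient seminorm of `L` via `φ`. -/
def quotSeminorm (A B : MOUS) (φ : A.carrier →ₗ[ℂ] B.carrier)
    (L : ∀ n : ℕ, Matrix (Fin n) (Fin n) A.carrier → ℝ) (n : ℕ)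
    (b : Matrix (Fin n) (Fin n) B.carrier) : ℝ :=
  sInf {x | ∃ a, mapMat φ a = b ∧ x = L n a}

/-- The operator space (matrix order unit space) direct sum `V₁ ⊕ V₂`. -/
def MOUS.prod (A B : MOUS) : MOUS where
  carrier := A.carrier × B.carrier
  one := (A.one, B.one)
  pos n := {v | (Matrix.of fun i j => (v i j).1) ∈ A.pos n ∧
    (Matrix.of fun i j => (v i j).2) ∈ B.pos n}
  pos_add := by
    rintro n v ⟨hv1, hv2⟩ w ⟨hw1, hw2⟩
    exact ⟨A.pos_add n _ hv1 _ hw1, B.pos_add n _ hv2 _ hw2⟩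
  pos_smul := by
    rintro n t ht v ⟨hv1, hv2⟩
    exact ⟨A.pos_smul n t ht _ hv1, B.pos_smul n t ht _ hv2⟩
  pos_star := by
    rintro n v ⟨hv1, hv2⟩
    have h1 := A.pos_star n _ hv1
    have h2 := B.pos_star n _ hv2
    funext i j
    exact Prod.ext (congrFun (congrFun h1 i) j) (congrFun (congrFun h2 i) j)
  pos_congr := by
    rintro n m γ v ⟨hv1, hv2⟩
    constructor
    · have h1 := A.pos_congr n m γ _ hv1
      convert h1 using 2
      funext i j
      simp [Prod.fst_sum]
    · have h2 := B.pos_congr n m γ _ hv2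
      convert h2 using 2
      funext i j
      simp [Prod.snd_sum]
  proper := by
    rintro v ⟨h1, h2⟩ ⟨h3, h4⟩
    have e1 := A.proper _ h1 h3
    have e2 := B.proper _ h2 h4
    funext i j
    exact Prod.ext (congrFun (congrFun e1 i) j) (congrFun (congrFun e2 i) j)
  unit_pos := by
    intro n
    constructor
    · convert A.unit_pos n using 2
      funext i j
      by_cases hij : i = j <;> simp [Matrix.diagonal_apply, hij]
    · convert B.unit_pos n using 2
      funext i j
      by_cases hij : i = j <;> simp [Matrix.diagonal_apply, hij]
  orderUnit := by
    rintro ⟨a, b⟩ hstar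
    have ha : star a = a := congrArg Prod.fst hstar
    have hb : star b = b := congrArg Prod.snd hstar
    obtain ⟨t₁, ht₁, hp₁⟩ := A.orderUnit a ha
    obtain ⟨t₂, ht₂, hp₂⟩ := B.orderUnit b hb
    have huA : (Matrix.of fun _ _ => A.one : Matrix (Fin 1) (Fin 1) A.carrier) ∈ A.pos 1 := by
      convert A.unit_pos 1 using 2
      funext i j
      simp [Matrix.diagonal_apply, Subsingleton.elim i j]
    have huB : (Matrix.of fun _ _ => B.one : Matrix (Fin 1) (Fin 1) B.carrier) ∈ B.pos 1 := by
      convert B.unit_pos 1 using 2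
      funext i j
      simp [Matrix.diagonal_apply, Subsingleton.elim i j]
    refine ⟨t₁ + t₂, add_pos ht₁ ht₂, ?_, ?_⟩
    · have e : (Matrix.of fun _ _ => ((t₁ + t₂ : ℝ) : ℂ) • A.one - a :
          Matrix (Fin 1) (Fin 1) A.carrier)
          = (Matrix.of fun _ _ => (t₁ : ℂ) • A.one - a) +
            (t₂ : ℂ) • (Matrix.of fun _ _ => A.one) := by
        funext i j
        show ((t₁ + t₂ : ℝ) : ℂ) • A.one - a
          = ((t₁ : ℂ) • A.one - a) + (t₂ : ℂ) • A.one
        push_cast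
        rw [add_smul]
        abel
      exact e ▸ A.pos_add 1 _ hp₁ _ (A.pos_smul 1 t₂ ht₂.le _ huA)
    · have e : (Matrix.of fun _ _ => ((t₁ + t₂ : ℝ) : ℂ) • B.one - b :
          Matrix (Fin 1) (Fin 1) B.carrier)
          = (Matrix.of fun _ _ => (t₂ : ℂ) • B.one - b) +
            (t₁ : ℂ) • (Matrix.of fun _ _ => B.one) := by
        funext i j
        show ((t₁ + t₂ : ℝ) : ℂ) • B.one - b
          = ((t₂ : ℂ) • B.one - b) + (t₁ : ℂ) • B.one
        push_cast
        rw [add_smul]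
        abel
      exact e ▸ B.pos_add 1 _ hp₂ _ (B.pos_smul 1 t₁ ht₁.le _ huB)
  archimedean := by
    rintro n v h
    constructor
    · apply A.archimedean
      intro t ht
      have h1 := (h t ht).1
      have e : (Matrix.of fun i j =>
            (((v + (t : ℂ) • Matrix.diagonal fun _ =>
              ((A.one, B.one) : A.carrier × B.carrier) :
                Matrix (Fin n) (Fin n) (A.carrier × B.carrier))) i j).1)
          = (Matrix.of fun i j => (v i j).1) +
            (t : ℂ) • Matrix.diagonal fun _ => A.one := by
        funext i j
        by_cases hij : i = j <;>
          simp [Matrix.add_apply, Matrix.smul_apply, Matrix.diagonal_apply, hij]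
      rw [e] at h1
      exact h1
    · apply B.archimedean
      intro t ht
      have h2 := (h t ht).2
      have e : (Matrix.of fun i j =>
            (((v + (t : ℂ) • Matrix.diagonal fun _ =>
              ((A.one, B.one) : A.carrier × B.carrier) :
                Matrix (Fin n) (Fin n) (A.carrier × B.carrier))) i j).2)
          = (Matrix.of fun i j => (v i j).2) +
            (t : ℂ) • Matrix.diagonal fun _ => B.one := by
        funext i j
        by_cases hij : i = j <;>
          simp [Matrix.add_apply, Matrix.smul_apply, Matrix.diagonal_apply, hij]
      rw [e] at h2
      exact h2

/-- First coordinate projection `V₁ ⊕ V₂ → V₁`. -/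
def fstL (A B : MOUS) : (A.prod B).carrier →ₗ[ℂ] A.carrier :=
  LinearMap.fst ℂ A.carrier B.carrier

/-- Second coordinate projection `V₁ ⊕ V₂ → V₂`. -/
def sndL (A B : MOUS) : (A.prod B).carrier →ₗ[ℂ] B.carrier :=
  LinearMap.snd ℂ A.carrier B.carrier

/-- `M(L₁, L₂)`: the set of matrix Lip-norms on `V₁ ⊕ V₂` inducing `L₁` and `L₂`
via the coordinate projections. -/
def MSet (A : MOUS) (LA : ∀ n : ℕ, Matrix (Fin n) (Fin n) A.carrier → ℝ)
    (B : MOUS) (LB : ∀ n : ℕ, Matrix (Fin n) (Fin n) B.carrier → ℝ) :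
    Set (∀ n : ℕ, Matrix (Fin n) (Fin n) (A.prod B).carrier → ℝ) :=
  {L | IsMatrixLipNorm (A.prod B) L ∧ Induces (A.prod B) A (fstL A B) L LA ∧
    Induces (A.prod B) B (sndL A B) L LB}

/-- Hausdorff distance between two sets with respect to a distance function. -/
def hDist {X : Type} (d : X → X → ℝ) (s t : Set X) : ℝ :=
  max (sSup ((fun x => sInf ((fun y => d x y) '' t)) '' s))
      (sSup ((fun y => sInf ((fun x => d x y) '' s)) '' t))

/-- The quantized Gromov–Hausdorff distance between two quantized metric spaces. -/
def distNC (A : MOUS) (LA : ∀ n : ℕ, Matrix (Fin n) (Fin n) A.carrier → ℝ)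
    (B : MOUS) (LB : ∀ n : ℕ, Matrix (Fin n) (Fin n) B.carrier → ℝ) : ℝ :=
  sInf {x | ∃ L ∈ MSet A LA B LB, x = ⨆ n : ℕ, ((n : ℝ) ^ 2)⁻¹ *
    hDist (Dmet (A.prod B) L n)
      ((fun φ : MState A n => φ.comp (fstL A B)) '' CS A n)
      ((fun φ : MState B n => φ.comp (sndL A B)) '' CS B n)}

/-- The diameter of a quantized metric space: the diameter of `CS₁(V)` for `D_{L₁}`. -/
def qDiam (A : MOUS) (LA : ∀ n : ℕ, Matrix (Fin n) (Fin n) A.carrier → ℝ) : ℝ :=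
  sSup {x | ∃ φ ∈ CS A 1, ∃ ψ ∈ CS A 1, x = Dmet A LA 1 φ ψ}

/-- Lower semicontinuity of a family of matrix seminorms for the order-unit matrix norms. -/
def IsLSCsem (A : MOUS) (L : ∀ n : ℕ, Matrix (Fin n) (Fin n) A.carrier → ℝ) : Prop :=
  ∀ n (a : Matrix (Fin n) (Fin n) A.carrier) (c : ℝ), c < L n a →
    ∃ δ : ℝ, 0 < δ ∧ ∀ b, A.matNorm (b - a) < δ → c < L n b


/-- The matrix Lip-norm `L_{D_L}` recovered from the matrix metric `D_L`:
`L_{D_{L_n}}(a) = sup ‖⟨⟨φ,a⟩⟩ − ⟨⟨ψ,a⟩⟩‖ / D_{L_r}(φ,ψ)` over distinct matrix states. -/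
def LfromD (A : MOUS) (L : ∀ n : ℕ, Matrix (Fin n) (Fin n) A.carrier → ℝ)
    (n : ℕ) (a : Matrix (Fin n) (Fin n) A.carrier) : ℝ :=
  sSup {x | ∃ (r : ℕ) (φ ψ : MState A r), φ ∈ CS A r ∧ ψ ∈ CS A r ∧ φ ≠ ψ ∧
    x = scalarOpNorm (mpair φ a - mpair ψ a) / Dmet A L r φ ψ}

/-- A family of matrix seminorms is closed if each of its unit balls is closed for the
order-unit matrix norm. -/
def IsClosedLip (A : MOUS) (L : ∀ n : ℕ, Matrix (Fin n) (Fin n) A.carrier → ℝ) : Prop :=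
  ∀ (n : ℕ) (w : Matrix (Fin n) (Fin n) A.carrier),
    (∀ ε : ℝ, 0 < ε → ∃ v, L n v ≤ 1 ∧ A.matNorm (w - v) ≤ ε) → L n w ≤ 1

/-- `(W, Lc, j)` is the closed quantized metric space `(Vᶜ, Lᶜ)` associated to `(V, L)`:
`j` embeds `V` into `W` as a unital complete order embedding with `Lᶜ ∘ j = L_{D_L}`,
`Lᶜ` is a closed matrix Lip-norm, and every element of `M_n(W)` is a norm-limit of
elements of `M_n(j(V))` with controlled Lip-norm. -/
structure IsClosureOf (A : MOUS) (L : ∀ n : ℕ, Matrix (Fin n) (Fin n) A.carrier → ℝ)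
    (W : MOUS) (Lc : ∀ n : ℕ, Matrix (Fin n) (Fin n) W.carrier → ℝ)
    (j : A.carrier →ₗ[ℂ] W.carrier) : Prop where
  ucp : IsUCP A W j
  inj : Function.Injective j
  ordEmb : ∀ (n : ℕ) (a : Matrix (Fin n) (Fin n) A.carrier),
    mapMat j a ∈ W.pos n ↔ a ∈ A.pos n
  lip : IsMatrixLipNorm W Lc
  closed : IsClosedLip W Lc
  extends_eq : ∀ (n : ℕ) (a : Matrix (Fin n) (Fin n) A.carrier),
    Lc n (mapMat j a) = LfromD A L n a
  dense : ∀ (n : ℕ) (w : Matrix (Fin n) (Fin n) W.carrier) (ε : ℝ), 0 < ε →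
    ∃ a, Lc n (mapMat j a) ≤ Lc n w ∧ W.matNorm (w - mapMat j a) < ε

/-- A unital complete order isomorphism between matrix order unit spaces. -/
structure IsCompleteOrderIso (A B : MOUS) (Φ : A.carrier →ₗ[ℂ] B.carrier) : Prop where
  unital : Φ A.one = B.one
  bij : Function.Bijective Φ
  ordIso : ∀ (n : ℕ) (a : Matrix (Fin n) (Fin n) A.carrier),
    mapMat Φ a ∈ B.pos n ↔ a ∈ A.pos n

/-- The squared `ℓ²`-norm of a scalar vector. -/
def vecNormSq {m : Type*} [Fintype m] (x : m → ℂ) : ℝ := ∑ i, ‖x i‖ ^ 2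

theorem vecNormSq_nonneg {m : Type*} [Fintype m] (x : m → ℂ) : 0 ≤ vecNormSq x :=
  Finset.sum_nonneg fun _ _ => sq_nonneg _

theorem vecNormSq_eq_norm_sq {m : Type*} [Fintype m] (x : m → ℂ) :
    vecNormSq x = ‖WithLp.toLp 2 x‖ ^ 2 := by
  rw [EuclideanSpace.norm_sq_eq]
  rfl

theorem star_dotProduct_self {m : Type*} [Fintype m] (x : m → ℂ) :
    star x ⬝ᵥ x = (vecNormSq x : ℂ) := by
  simp only [dotProduct, vecNormSq, Pi.star_apply, RCLike.star_def]
  push_cast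
  exact Finset.sum_congr rfl fun i _ => by rw [RCLike.conj_mul]; rfl

open scoped Matrix.Norms.L2Operator in
theorem scalarOpNorm_eq_norm {m n : Type*} [Fintype m] [Fintype n] [DecidableEq n]
    (γ : Matrix m n ℂ) : scalarOpNorm γ = ‖γ‖ := rfl

theorem scalarOpNorm_nonneg {m n : Type*} [Fintype m] [Fintype n] [DecidableEq n]
    (γ : Matrix m n ℂ) : 0 ≤ scalarOpNorm γ := norm_nonneg _

theorem scalarOpNorm_zero {m n : Type*} [Fintype m] [Fintype n] [DecidableEq n] :
    scalarOpNorm (0 : Matrix m n ℂ) = 0 := by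
  simp [scalarOpNorm]

theorem scalarOpNorm_add_le {m n : Type*} [Fintype m] [Fintype n] [DecidableEq n]
    (α β : Matrix m n ℂ) : scalarOpNorm (α + β) ≤ scalarOpNorm α + scalarOpNorm β := by
  simp only [scalarOpNorm_eq_norm]
  open scoped Matrix.Norms.L2Operator in exact norm_add_le _ _

theorem scalarOpNorm_sub_le {m n : Type*} [Fintype m] [Fintype n] [DecidableEq n]
    (α β : Matrix m n ℂ) : scalarOpNorm (α - β) ≤ scalarOpNorm α + scalarOpNorm β := by
  simp only [scalarOpNorm_eq_norm]
  open scoped Matrix.Norms.L2Operator in exact norm_sub_le _ _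

theorem scalarOpNorm_smul {m n : Type*} [Fintype m] [Fintype n] [DecidableEq n]
    (c : ℂ) (β : Matrix m n ℂ) : scalarOpNorm (c • β) = ‖c‖ * scalarOpNorm β := by
  simp only [scalarOpNorm_eq_norm]
  open scoped Matrix.Norms.L2Operator in exact norm_smul _ _

theorem scalarOpNorm_mul_le {m n l : Type*} [Fintype m] [Fintype n] [Fintype l] [DecidableEq n]
    [DecidableEq l] (α : Matrix m n ℂ) (β : Matrix n l ℂ) :
    scalarOpNorm (α * β) ≤ scalarOpNorm α * scalarOpNorm β := by
  simp only [scalarOpNorm_eq_norm]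
  exact Matrix.l2_opNorm_mul _ _

theorem scalarOpNorm_conjTranspose {m n : Type*} [Fintype m] [Fintype n] [DecidableEq n]
    [DecidableEq m] (α : Matrix m n ℂ) : scalarOpNorm α.conjTranspose = scalarOpNorm α := by
  simp only [scalarOpNorm_eq_norm]
  exact Matrix.l2_opNorm_conjTranspose _

theorem scalarOpNorm_conjTranspose_mul_self {m n : Type*} [Fintype m] [Fintype n] [DecidableEq n]
    (α : Matrix m n ℂ) :
    scalarOpNorm (α.conjTranspose * α) = scalarOpNorm α * scalarOpNorm α := by
  simp only [scalarOpNorm_eq_norm]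
  exact Matrix.l2_opNorm_conjTranspose_mul_self _

theorem scalarOpNorm_eq_zero_iff {m n : Type*} [Fintype m] [Fintype n] [DecidableEq n]
    (α : Matrix m n ℂ) : scalarOpNorm α = 0 ↔ α = 0 := by
  simp only [scalarOpNorm_eq_norm]
  open scoped Matrix.Norms.L2Operator in exact norm_eq_zero

theorem norm_star_dotProduct_le {m : Type*} [Fintype m] (x y : m → ℂ) :
    ‖star x ⬝ᵥ y‖ ≤ √(vecNormSq x) * √(vecNormSq y) := by
  have := norm_inner_le_norm (𝕜 := ℂ) (WithLp.toLp 2 x) (WithLp.toLp 2 y)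
  rw [vecNormSq_eq_norm_sq, vecNormSq_eq_norm_sq, Real.sqrt_sq (norm_nonneg _),
    Real.sqrt_sq (norm_nonneg _)]
  rwa [EuclideanSpace.inner_eq_star_dotProduct, dotProduct_comm] at this

theorem vecNormSq_mulVec_le {m n : Type*} [Fintype m] [Fintype n] [DecidableEq n]
    (M : Matrix m n ℂ) (y : n → ℂ) :
    vecNormSq (M.mulVec y) ≤ scalarOpNorm M ^ 2 * vecNormSq y := by
  rw [vecNormSq_eq_norm_sq, vecNormSq_eq_norm_sq, ← mul_pow, scalarOpNorm_eq_norm]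
  gcongr
  exact Matrix.l2_opNorm_mulVec M (WithLp.toLp 2 y)

theorem norm_bilin_le {m n : Type*} [Fintype m] [Fintype n] [DecidableEq n]
    (M : Matrix m n ℂ) (x : m → ℂ) (y : n → ℂ) :
    ‖star x ⬝ᵥ M.mulVec y‖ ≤ scalarOpNorm M * (√(vecNormSq x) * √(vecNormSq y)) := by
  refine (norm_star_dotProduct_le _ _).trans ?_
  have h := Real.sqrt_le_sqrt (vecNormSq_mulVec_le M y)
  rw [Real.sqrt_mul (sq_nonneg _), Real.sqrt_sq (scalarOpNorm_nonneg _)] at h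
  nlinarith [Real.sqrt_nonneg (vecNormSq x)]

theorem re_bilin_le {m n : Type*} [Fintype m] [Fintype n] [DecidableEq n]
    (M : Matrix m n ℂ) (x : m → ℂ) (y : n → ℂ) :
    (star x ⬝ᵥ M.mulVec y).re ≤ scalarOpNorm M * ((vecNormSq x + vecNormSq y) / 2) := by
  refine (Complex.re_le_norm _).trans ((norm_bilin_le M x y).trans ?_)
  refine mul_le_mul_of_nonneg_left ?_ (scalarOpNorm_nonneg _)
  nlinarith [sq_nonneg (√(vecNormSq x) - √(vecNormSq y)), Real.sq_sqrt (vecNormSq_nonneg x),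
    Real.sq_sqrt (vecNormSq_nonneg y)]

theorem scalarOpNorm_le_of_vecNormSq {m n : Type*} [Fintype m] [Fintype n] [DecidableEq n]
    {M : Matrix m n ℂ} {t : ℝ} (ht : 0 ≤ t)
    (h : ∀ y, vecNormSq (M.mulVec y) ≤ t ^ 2 * vecNormSq y) : scalarOpNorm M ≤ t := by
  refine ContinuousLinearMap.opNorm_le_bound _ ht fun y => ?_
  have h := h y.ofLp
  rw [vecNormSq_eq_norm_sq, vecNormSq_eq_norm_sq, ← mul_pow] at h
  exact le_of_sq_le_sq h (by positivity)

theorem scalarOpNorm_le_of_bilin {m n : Type*} [Fintype m] [Fintype n] [DecidableEq n]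
    {M : Matrix m n ℂ} {t : ℝ} (ht : 0 ≤ t)
    (h : ∀ x y, (star x ⬝ᵥ M.mulVec y).re ≤ t * ((vecNormSq x + vecNormSq y) / 2)) :
    scalarOpNorm M ≤ t := by
  have hs : ∀ (s : ℝ) {l : Type _} [Fintype l] (z : l → ℂ),
      vecNormSq ((s : ℂ) • z) = s ^ 2 * vecNormSq z := by
    intro s l _ z
    simp [vecNormSq, mul_pow, Finset.mul_sum]
  refine scalarOpNorm_le_of_vecNormSq ht fun y => ?_
  set z := M.mulVec y with hz
  have key : ∀ s : ℝ, s * vecNormSq z ≤ t * ((s ^ 2 * vecNormSq z + vecNormSq y) / 2) := by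
    intro s
    have := h ((s : ℂ) • z) y
    rw [← hz, hs, star_smul, smul_dotProduct, star_dotProduct_self] at this
    simpa using this
  rcases ht.eq_or_lt with rfl | ht
  · have := key 1
    nlinarith [vecNormSq_nonneg z, vecNormSq_nonneg y]
  · have := key t⁻¹
    have h2 : t * (t⁻¹ * vecNormSq z) ≤ t * (t * ((t⁻¹ ^ 2 * vecNormSq z + vecNormSq y) / 2)) :=
      mul_le_mul_of_nonneg_left this ht.le
    field_simp at h2
    nlinarith

theorem scalarOpNorm_le_of_posSemidef {m : Type*} [Fintype m] [DecidableEq m]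
    {M : Matrix m m ℂ} {t : ℝ} (ht : 0 ≤ t) (h0 : M.PosSemidef)
    (h1 : ((t : ℂ) • (1 : Matrix m m ℂ) - M).PosSemidef) : scalarOpNorm M ≤ t := by
  have hq : ∀ x, (star x ⬝ᵥ M.mulVec x).re ≤ t * vecNormSq x := by
    intro x
    have := (Complex.le_def.1 (h1.dotProduct_mulVec_nonneg x)).1
    rw [Matrix.sub_mulVec, dotProduct_sub, Matrix.smul_mulVec, Matrix.one_mulVec,
      dotProduct_smul, star_dotProduct_self] at this
    simpa using this
  have hp : ∀ x, 0 ≤ (star x ⬝ᵥ M.mulVec x).re := fun x =>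
    (Complex.le_def.1 (h0.dotProduct_mulVec_nonneg x)).1
  have hsym : ∀ x y, (star x ⬝ᵥ M.mulVec y).re = (star y ⬝ᵥ M.mulVec x).re := by
    intro x y
    have : star (star x ⬝ᵥ M.mulVec y) = star y ⬝ᵥ M.mulVec x := by
      rw [Matrix.star_dotProduct, star_star, dotProduct_comm, Matrix.star_mulVec, h0.1.eq,
        dotProduct_comm, ← Matrix.dotProduct_mulVec]
    rw [← this]; simp
  refine scalarOpNorm_le_of_bilin ht fun x y => ?_
  have h2 := hp (x - y)
  have e : (star (x - y) ⬝ᵥ M.mulVec (x - y)).re = (star x ⬝ᵥ M.mulVec x).re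
      + (star y ⬝ᵥ M.mulVec y).re - 2 * (star x ⬝ᵥ M.mulVec y).re := by
    rw [Matrix.mulVec_sub, star_sub, sub_dotProduct, dotProduct_sub, dotProduct_sub]
    simp only [Complex.sub_re]
    linarith [hsym x y]
  have := hq x
  have := hq y
  linarith

theorem posSemidef_of_re_nonneg {m : Type*} [Fintype m] {M : Matrix m m ℂ}
    (hM : M.IsHermitian) (h : ∀ x, 0 ≤ (star x ⬝ᵥ M.mulVec x).re) : M.PosSemidef := by
  refine Matrix.PosSemidef.of_dotProduct_mulVec_nonneg hM fun x => ?_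
  refine Complex.le_def.2 ⟨h x, ?_⟩
  have := hM.im_star_dotProduct_mulVec_self x
  simpa using this.symm

theorem re_quadForm_le {m : Type*} [Fintype m] [DecidableEq m] (M : Matrix m m ℂ) (x : m → ℂ) :
    (star x ⬝ᵥ M.mulVec x).re ≤ scalarOpNorm M * vecNormSq x := by
  have := re_bilin_le M x x
  linarith

theorem scalarOpNorm_one_le {m : Type*} [Fintype m] [DecidableEq m] :
    scalarOpNorm (1 : Matrix m m ℂ) ≤ 1 :=
  scalarOpNorm_le_of_vecNormSq zero_le_one fun y => by simp

theorem posSemidef_smul_one_sub {m : Type*} [Fintype m] [DecidableEq m] {M : Matrix m m ℂ}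
    (hM : M.IsHermitian) {t : ℝ} (h : ∀ x, (star x ⬝ᵥ M.mulVec x).re ≤ t * vecNormSq x) :
    ((t : ℂ) • (1 : Matrix m m ℂ) - M).PosSemidef := by
  refine posSemidef_of_re_nonneg ?_ fun x => ?_
  · refine Matrix.IsHermitian.sub ?_ hM
    simp [Matrix.IsHermitian, Matrix.conjTranspose_smul]
  · rw [Matrix.sub_mulVec, dotProduct_sub, Matrix.smul_mulVec, Matrix.one_mulVec,
      dotProduct_smul, star_dotProduct_self]
    simpa using h x

section MatrixLevel

variable {V : Type} [AddCommGroup V] [Module ℂ V]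

theorem mmulMat_apply {m n : ℕ} (α : Matrix (Fin n) (Fin m) ℂ) (v : Matrix (Fin m) (Fin m) V)
    (β : Matrix (Fin m) (Fin n) ℂ) (i j : Fin n) :
    mmulMat α v β i j = ∑ k, ∑ l, (α i k * β l j) • v k l := rfl

theorem mmulMat_add {m n : ℕ} (α : Matrix (Fin n) (Fin m) ℂ) (v w : Matrix (Fin m) (Fin m) V)
    (β : Matrix (Fin m) (Fin n) ℂ) :
    mmulMat α (v + w) β = mmulMat α v β + mmulMat α w β := by
  ext i j
  simp [mmulMat_apply, Finset.sum_add_distrib]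

theorem mmulMat_smul {m n : ℕ} (α : Matrix (Fin n) (Fin m) ℂ) (c : ℂ)
    (v : Matrix (Fin m) (Fin m) V) (β : Matrix (Fin m) (Fin n) ℂ) :
    mmulMat α (c • v) β = c • mmulMat α v β := by
  ext i j
  simp [mmulMat_apply, Finset.smul_sum, smul_comm c]

theorem smul_mmulMat {m n : ℕ} (α : Matrix (Fin n) (Fin m) ℂ) (c d : ℂ)
    (v : Matrix (Fin m) (Fin m) V) (β : Matrix (Fin m) (Fin n) ℂ) :
    mmulMat (c • α) v (d • β) = (c * d) • mmulMat α v β := by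
  ext i j
  simp only [mmulMat_apply, Matrix.smul_apply, smul_eq_mul, Finset.smul_sum, smul_smul]
  refine Finset.sum_congr rfl fun k _ => Finset.sum_congr rfl fun l _ => ?_
  congr 1
  ring

theorem mmulMat_mmulMat {m n p : ℕ} (α' : Matrix (Fin p) (Fin n) ℂ) (α : Matrix (Fin n) (Fin m) ℂ)
    (v : Matrix (Fin m) (Fin m) V) (β : Matrix (Fin m) (Fin n) ℂ)
    (β' : Matrix (Fin n) (Fin p) ℂ) :
    mmulMat α' (mmulMat α v β) β' = mmulMat (α' * α) v (β * β') := by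
  ext i j
  simp only [mmulMat_apply, Matrix.mul_apply, Finset.smul_sum, smul_smul, Finset.sum_mul_sum,
    Finset.sum_smul]
  rw [Finset.sum_congr rfl fun k _ => Finset.sum_comm]
  rw [Finset.sum_comm]
  refine Finset.sum_congr rfl fun p _ => ?_
  rw [Finset.sum_congr rfl fun k _ => Finset.sum_comm]
  rw [Finset.sum_comm]
  refine Finset.sum_congr rfl fun q _ => ?_
  refine Finset.sum_congr rfl fun k _ => Finset.sum_congr rfl fun l _ => ?_
  congr 1
  ring

theorem mmulMat_one {m : ℕ} (v : Matrix (Fin m) (Fin m) V) : mmulMat 1 v 1 = v := by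
  ext i j
  simp [mmulMat_apply, Matrix.one_apply, ite_smul, Finset.sum_ite_eq]

theorem mapMat_apply {V W : Type} [AddCommGroup V] [AddCommGroup W] [Module ℂ V] [Module ℂ W]
    (φ : V →ₗ[ℂ] W) {n : ℕ} (a : Matrix (Fin n) (Fin n) V) (i j : Fin n) :
    mapMat φ a i j = φ (a i j) := rfl

theorem mapMat_mmulMat {V W : Type} [AddCommGroup V] [AddCommGroup W] [Module ℂ V] [Module ℂ W]
    (φ : V →ₗ[ℂ] W) {n m : ℕ} (α : Matrix (Fin m) (Fin n) ℂ) (a : Matrix (Fin n) (Fin n) V)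
    (β : Matrix (Fin n) (Fin m) ℂ) :
    mapMat φ (mmulMat α a β) = mmulMat α (mapMat φ a) β := by
  ext i j
  simp [mmulMat_apply, mapMat_apply]

theorem mapMat_dsumMat {V W : Type} [AddCommGroup V] [AddCommGroup W] [Module ℂ V] [Module ℂ W]
    (φ : V →ₗ[ℂ] W) {n m : ℕ} (a : Matrix (Fin n) (Fin n) V) (b : Matrix (Fin m) (Fin m) V) :
    mapMat φ (dsumMat a b) = dsumMat (mapMat φ a) (mapMat φ b) := by
  ext i j
  simp only [mapMat_apply, dsumMat, Matrix.reindex_apply, Matrix.submatrix_apply]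
  rcases finSumFinEquiv.symm i with i | i <;> rcases finSumFinEquiv.symm j with j | j <;>
    simp [mapMat_apply]

/-- The scalar row `[α, β]` with entries matrices. -/
def rowCat {k m n : ℕ} (α : Matrix (Fin k) (Fin m) ℂ) (β : Matrix (Fin k) (Fin n) ℂ) :
    Matrix (Fin k) (Fin (m + n)) ℂ :=
  Matrix.of fun i j => Sum.elim (α i) (β i) (finSumFinEquiv.symm j)

/-- The scalar column `[α; β]` with entries matrices. -/
def colCat {k m n : ℕ} (α : Matrix (Fin m) (Fin k) ℂ) (β : Matrix (Fin n) (Fin k) ℂ) :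
    Matrix (Fin (m + n)) (Fin k) ℂ :=
  Matrix.of fun i j => Sum.elim (fun i => α i j) (fun i => β i j) (finSumFinEquiv.symm i)

theorem sum_finSum {M : Type*} [AddCommMonoid M] {m n : ℕ} (f : Fin (m + n) → M) :
    ∑ i, f i = ∑ i, f (finSumFinEquiv (Sum.inl i)) + ∑ i, f (finSumFinEquiv (Sum.inr i)) := by
  rw [← finSumFinEquiv.sum_comp, Fintype.sum_sum_type]

theorem rowCat_mul_colCat {k l m n : ℕ} (α : Matrix (Fin k) (Fin m) ℂ)
    (β : Matrix (Fin k) (Fin n) ℂ) (γ : Matrix (Fin m) (Fin l) ℂ) (δ : Matrix (Fin n) (Fin l) ℂ) :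
    rowCat α β * colCat γ δ = α * γ + β * δ := by
  ext i j
  simp [Matrix.mul_apply, rowCat, colCat, sum_finSum, -finSumFinEquiv_apply_left,
    -finSumFinEquiv_apply_right]

theorem conjTranspose_rowCat {k m n : ℕ} (α : Matrix (Fin k) (Fin m) ℂ)
    (β : Matrix (Fin k) (Fin n) ℂ) :
    (rowCat α β).conjTranspose = colCat α.conjTranspose β.conjTranspose := by
  ext i j
  simp only [Matrix.conjTranspose_apply, rowCat, colCat, Matrix.of_apply]
  rcases finSumFinEquiv.symm i with i | i <;> simp

theorem conjTranspose_colCat {k m n : ℕ} (α : Matrix (Fin m) (Fin k) ℂ)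
    (β : Matrix (Fin n) (Fin k) ℂ) :
    (colCat α β).conjTranspose = rowCat α.conjTranspose β.conjTranspose := by
  ext i j
  simp only [Matrix.conjTranspose_apply, rowCat, colCat, Matrix.of_apply]
  rcases finSumFinEquiv.symm j with i | i <;> simp

theorem mmulMat_rowCat_dsumMat_colCat {k m n : ℕ} (α : Matrix (Fin k) (Fin m) ℂ)
    (β : Matrix (Fin k) (Fin n) ℂ) (v : Matrix (Fin m) (Fin m) V) (w : Matrix (Fin n) (Fin n) V)
    (γ : Matrix (Fin m) (Fin k) ℂ) (δ : Matrix (Fin n) (Fin k) ℂ) :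
    mmulMat (rowCat α β) (dsumMat v w) (colCat γ δ) = mmulMat α v γ + mmulMat β w δ := by
  ext i j
  simp [mmulMat_apply, rowCat, colCat, dsumMat, sum_finSum, -finSumFinEquiv_apply_left,
    -finSumFinEquiv_apply_right]

end MatrixLevel

theorem conjTranspose_mmulMat {V : Type} [AddCommGroup V] [Module ℂ V] [StarAddMonoid V]
    [StarModule ℂ V] {m n : ℕ} (α : Matrix (Fin n) (Fin m) ℂ) (v : Matrix (Fin m) (Fin m) V)
    (β : Matrix (Fin m) (Fin n) ℂ) :
    (mmulMat α v β).conjTranspose =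
      mmulMat β.conjTranspose v.conjTranspose α.conjTranspose := by
  ext i j
  simp only [mmulMat_apply, Matrix.conjTranspose_apply, star_sum, star_smul, star_mul']
  rw [Finset.sum_comm]
  simp_rw [mul_comm]

namespace MOUS

variable (A : MOUS)

/-- Square matrices over a matrix order unit space. -/
abbrev Mat (n : ℕ) : Type := Matrix (Fin n) (Fin n) A.carrier

/-- The embedding `X ↦ X ⊗ 1` of the scalar matrices. -/
def scal (n : ℕ) : Matrix (Fin n) (Fin n) ℂ →ₗ[ℂ] A.Mat n where
  toFun X := Matrix.of fun i j => X i j • A.one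
  map_add' X Y := by ext i j; simp [add_smul]
  map_smul' c X := by ext i j; simp [mul_smul]

variable {A}

theorem scal_apply {n : ℕ} (X : Matrix (Fin n) (Fin n) ℂ) (i j : Fin n) :
    A.scal n X i j = X i j • A.one := rfl

theorem scal_one (n : ℕ) : A.scal n 1 = A.unitMat n := by
  ext i j
  by_cases h : i = j <;> simp [scal_apply, unitMat, h]

theorem mmulMat_scal {m n : ℕ} (α : Matrix (Fin n) (Fin m) ℂ) (X : Matrix (Fin m) (Fin m) ℂ)
    (β : Matrix (Fin m) (Fin n) ℂ) : mmulMat α (A.scal m X) β = A.scal n (α * X * β) := by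
  ext i j
  simp only [mmulMat_apply, scal_apply, Matrix.mul_apply, smul_smul, Finset.sum_mul,
    Finset.sum_smul]
  rw [Finset.sum_comm]
  refine Finset.sum_congr rfl fun p _ => Finset.sum_congr rfl fun l _ => ?_
  congr 1
  ring

theorem pos_mmulMat {m n : ℕ} (γ : Matrix (Fin n) (Fin m) ℂ) {v : A.Mat n} (hv : v ∈ A.pos n) :
    mmulMat γ.conjTranspose v γ ∈ A.pos m := A.pos_congr n m γ v hv

theorem scal_mem_pos {n : ℕ} {X : Matrix (Fin n) (Fin n) ℂ} (hX : X.PosSemidef) :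
    A.scal n X ∈ A.pos n := by
  obtain ⟨B, rfl⟩ : ∃ B : Matrix (Fin n) (Fin n) ℂ, X = B.conjTranspose * B := by
    open scoped MatrixOrder in
    exact CStarAlgebra.nonneg_iff_eq_star_mul_self.1 hX.nonneg
  have := pos_mmulMat B (A.unit_pos n)
  rw [show (Matrix.diagonal fun _ => A.one : A.Mat n) = A.scal n 1 from (scal_one n).symm,
    mmulMat_scal] at this
  simpa using this

theorem zero_mem_pos (n : ℕ) : (0 : A.Mat n) ∈ A.pos n := by
  have := scal_mem_pos (A := A) (n := n) Matrix.PosSemidef.zero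
  rwa [map_zero] at this

theorem star_one : star A.one = A.one := by
  have := A.pos_star 1 _ (A.unit_pos 1)
  simpa using congrFun (congrFun this 0) 0

theorem conjTranspose_scal {n : ℕ} (X : Matrix (Fin n) (Fin n) ℂ) :
    (A.scal n X).conjTranspose = A.scal n X.conjTranspose := by
  ext i j
  simp [scal_apply, Matrix.conjTranspose_apply, star_smul, star_one]

/-- A matrix is bounded below if it becomes positive after adding a multiple of the unit. -/
def BddBelowMat {n : ℕ} (v : A.Mat n) : Prop :=
  ∃ t : ℝ, 0 ≤ t ∧ v + A.scal n ((t : ℂ) • 1) ∈ A.pos n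

theorem BddBelowMat.add {n : ℕ} {v w : A.Mat n} (hv : BddBelowMat v) (hw : BddBelowMat w) :
    BddBelowMat (v + w) := by
  obtain ⟨s, hs, h1⟩ := hv
  obtain ⟨t, ht, h2⟩ := hw
  refine ⟨s + t, add_nonneg hs ht, ?_⟩
  convert A.pos_add n _ h1 _ h2 using 1
  push_cast
  rw [add_smul, map_add]
  abel

theorem BddBelowMat.smul {n : ℕ} {v : A.Mat n} (hv : BddBelowMat v) {c : ℝ} (hc : 0 ≤ c) :
    BddBelowMat ((c : ℂ) • v) := by
  obtain ⟨s, hs, h1⟩ := hv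
  refine ⟨c * s, mul_nonneg hc hs, ?_⟩
  convert A.pos_smul n c hc _ h1 using 1
  push_cast
  rw [mul_smul, map_smul, smul_add]

theorem BddBelowMat.sum {ι : Type*} (s : Finset ι) {n : ℕ} (f : ι → A.Mat n)
    (h : ∀ i ∈ s, BddBelowMat (f i)) : BddBelowMat (∑ i ∈ s, f i) := by
  classical
  induction s using Finset.induction_on with
  | empty => exact ⟨0, le_rfl, by simpa using zero_mem_pos n⟩
  | insert i s hi ih =>
    rw [Finset.sum_insert hi]
    exact (h i (by simp)).add (ih fun j hj => h j (by simp [hj]))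

/-- The scalar row vector with entries `x`. -/
def rowVec {n : ℕ} (x : Fin n → ℂ) : Matrix (Fin 1) (Fin n) ℂ := Matrix.of fun _ j => x j

/-- The `1 × 1` matrix with entry `h`. -/
def mat1 (h : A.carrier) : A.Mat 1 := Matrix.of fun _ _ => h

theorem bddBelowMat_rank_one {n : ℕ} (x : Fin n → ℂ) {h : A.carrier} (hh : star h = h) :
    BddBelowMat (mmulMat (rowVec x).conjTranspose (mat1 h) (rowVec x)) := by
  obtain ⟨t, ht, hp⟩ := A.orderUnit (-h) (by rw [star_neg, hh])
  have h1 := pos_mmulMat (rowVec x) hp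
  have hP : ((rowVec x).conjTranspose * rowVec x).PosSemidef :=
    Matrix.posSemidef_conjTranspose_mul_self _
  set s := scalarOpNorm ((rowVec x).conjTranspose * rowVec x) with hs
  have hQ := posSemidef_smul_one_sub hP.1 (t := s) fun y => re_quadForm_le _ y
  refine ⟨t * s, mul_nonneg ht.le (scalarOpNorm_nonneg _), ?_⟩
  convert A.pos_add n _ h1 _ (A.pos_smul n t ht.le _ (scal_mem_pos hQ)) using 1
  have : (Matrix.of fun _ _ => (t : ℂ) • A.one - -h : A.Mat 1)
      = mat1 h + A.scal 1 ((t : ℂ) • 1) := by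
    ext i j
    simp [mat1, scal_apply, Subsingleton.elim i j, add_comm]
  rw [this, mmulMat_add, mmulMat_scal]
  push_cast
  simp only [Matrix.mul_smul, Matrix.mul_one, Matrix.smul_mul, map_smul, map_sub, mul_smul,
    smul_sub]
  abel

theorem bddBelowMat_polar {n : ℕ} (x y : Fin n → ℂ) {h : A.carrier} (hh : star h = h) :
    BddBelowMat (mmulMat (rowVec x).conjTranspose (mat1 h) (rowVec y) +
      mmulMat (rowVec y).conjTranspose (mat1 h) (rowVec x)) := by
  have h1 := bddBelowMat_rank_one (x + y) hh
  have h2 := bddBelowMat_rank_one x (h := -h) (by rw [star_neg, hh])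
  have h3 := bddBelowMat_rank_one y (h := -h) (by rw [star_neg, hh])
  convert (h1.add h2).add h3 using 1
  ext i j
  simp only [Matrix.add_apply, mmulMat_apply, rowVec, mat1, Matrix.conjTranspose_apply,
    Matrix.of_apply, Finset.univ_unique, Finset.sum_const, Finset.card_singleton, one_smul,
    Pi.add_apply, star_add]
  module

/-- Real and imaginary parts of an element. -/
theorem exists_re_im (u : A.carrier) :
    ∃ h k : A.carrier, star h = h ∧ star k = k ∧ u = h + Complex.I • k := by
  refine ⟨(1 / 2 : ℂ) • (u + star u), (-Complex.I / 2) • (u - star u), ?_, ?_, ?_⟩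
  · simp [star_smul, add_comm]
  · rw [star_smul, star_sub, star_star, ← neg_sub u (star u), smul_neg, ← neg_smul]
    congr 1
    simp
    ring
  · rw [smul_smul]
    have : Complex.I * (-Complex.I / 2) = 1 / 2 := by
      rw [mul_div_assoc', mul_neg, Complex.I_mul_I]; norm_num
    rw [this]
    module

theorem mmulMat_rowVec_single {n : ℕ} (i j : Fin n) (a b : ℂ) (h : A.carrier) :
    mmulMat (rowVec (Pi.single i a)).conjTranspose (mat1 h) (rowVec (Pi.single j b)) =
      (Matrix.single i j ((star a * b) • h) : A.Mat n) := by
  ext p q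
  simp only [mmulMat_apply, rowVec, mat1, Matrix.conjTranspose_apply,
    Matrix.of_apply, Finset.univ_unique, Finset.sum_const, Finset.card_singleton, one_smul,
    Matrix.single_apply, Pi.single_apply]
  by_cases h1 : p = i <;> by_cases h2 : q = j <;> simp [h1, h2, Ne.symm]

theorem bddBelowMat_of_conjTranspose_eq {n : ℕ} {v : A.Mat n} (hv : v.conjTranspose = v) :
    BddBelowMat v := by
  have key : ∀ (i j : Fin n) (u : A.carrier),
      BddBelowMat (Matrix.single i j u + Matrix.single j i (star u) : A.Mat n) := by
    intro i j u
    obtain ⟨h, k, hh, hk, rfl⟩ := exists_re_im u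
    convert (bddBelowMat_polar (Pi.single i 1) (Pi.single j 1) hh).add
      (bddBelowMat_polar (Pi.single i 1) (Pi.single j Complex.I) hk) using 1
    simp only [mmulMat_rowVec_single, star_add, star_smul, hh, hk, Matrix.single_add]
    simp only [RCLike.star_def, map_one, one_mul, mul_one, one_smul, Complex.conj_I]
    abel
  have e : v = ((1 / 2 : ℝ) : ℂ) •
      ∑ i, ∑ j, (Matrix.single i j (v i j) + Matrix.single j i (star (v i j)) : A.Mat n) := by
    simp only [Finset.sum_add_distrib]
    rw [Finset.sum_comm (f := fun i j => (Matrix.single j i (star (v i j)) : A.Mat n))]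
    have : ∀ i j, star (v j i) = v i j := fun i j => congrFun (congrFun hv i) j
    simp only [this]
    rw [← Matrix.matrix_eq_sum_single v]
    push_cast
    module
  rw [e]
  exact (BddBelowMat.sum _ _ fun i _ => BddBelowMat.sum _ _ fun j _ => key i j _).smul (by norm_num)

end MOUS

theorem PointedCone.exists_functional_nonpos {E : Type*} [AddCommGroup E] [Module ℝ E]
    (s : PointedCone ℝ E) {u x : E} (hu : u ∈ s) (hunit : ∀ y, ∃ t : ℝ, t • u + y ∈ s)
    (hx : x ∉ s) : ∃ g : E →ₗ[ℝ] ℝ, (∀ y ∈ s, 0 ≤ g y) ∧ g u = 1 ∧ g x ≤ 0 := by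
  have hsmul : ∀ {c : ℝ} {y : E}, 0 ≤ c → y ∈ s → c • y ∈ s := fun {c y} hc hy =>
    s.smul_mem hc hy
  have hnu : -u ∉ s := by
    intro h
    obtain ⟨t, ht⟩ := hunit x
    apply hx
    rcases le_total 0 t with h0 | h0
    · have := s.add_mem ht (hsmul h0 h)
      simpa using this
    · have := s.add_mem ht (hsmul (neg_nonneg.2 h0) hu)
      simpa [add_right_comm] using this
  have hu0 : u ≠ 0 := by
    rintro rfl
    exact hnu (by simp)
  let s' : PointedCone ℝ E :=
    { carrier := {z | ∃ r : ℝ, 0 ≤ r ∧ z + r • x ∈ s}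
      add_mem' := by
        rintro a b ⟨r, hr, h⟩ ⟨r', hr', h'⟩
        refine ⟨r + r', add_nonneg hr hr', ?_⟩
        convert s.add_mem h h' using 1
        rw [add_smul]; abel
      zero_mem' := ⟨0, le_rfl, by simp⟩
      smul_mem' := by
        rintro ⟨c, hc⟩ a ⟨r, hr, h⟩
        refine ⟨c * r, mul_nonneg hc hr, ?_⟩
        convert hsmul hc h using 1
        rw [smul_add, mul_smul]; rfl }
  have hs' : ∀ y ∈ s, y ∈ s' := fun y hy => ⟨0, le_rfl, by simpa using hy⟩
  obtain ⟨g, hg1, hg2⟩ := riesz_extension s' (LinearPMap.mkSpanSingleton u (1 : ℝ) hu0) (by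
    rintro ⟨y, hy⟩ ⟨r, hr, h⟩
    obtain ⟨c, rfl⟩ := Submodule.mem_span_singleton.1 hy
    rw [LinearPMap.mkSpanSingleton'_apply]
    by_contra! hc
    simp only [smul_eq_mul, mul_one, RingHom.id_apply] at hc
    simp only at h
    rcases hr.eq_or_lt with rfl | hr
    · apply hnu
      have := hsmul (inv_nonneg.2 (neg_nonneg.2 hc.le)) h
      rwa [zero_smul, add_zero, smul_smul, ← neg_inv, neg_mul, inv_mul_cancel₀ hc.ne,
        neg_one_smul] at this
    · apply hx
      have := hsmul (inv_nonneg.2 hr.le) (s.add_mem h (hsmul (neg_nonneg.2 hc.le) hu))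
      rwa [show c • u + r • x + -c • u = r • x by rw [neg_smul]; abel, smul_smul,
        inv_mul_cancel₀ hr.ne', one_smul] at this) (by
    intro y
    obtain ⟨t, ht⟩ := hunit y
    exact ⟨⟨t • u, Submodule.mem_span_singleton.2 ⟨t, rfl⟩⟩, hs' _ ht⟩)
  refine ⟨g, fun y hy => hg2 y (hs' y hy), ?_, ?_⟩
  · have := hg1 ⟨u, Submodule.mem_span_singleton_self u⟩
    rw [this]
    exact LinearPMap.mkSpanSingleton'_apply_self _ _ _ _
  · have := hg2 (-x) ⟨1, zero_le_one, by simp⟩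
    rw [map_neg] at this
    linarith

namespace MOUS

variable {A : MOUS}

/-- The cone of matrices with positive real part. -/
def accretive (A : MOUS) (n : ℕ) : PointedCone ℝ (A.Mat n) where
  carrier := {v | v + v.conjTranspose ∈ A.pos n}
  add_mem' {v w} hv hw := by
    have := A.pos_add n _ hv _ hw
    rw [Set.mem_ofPred_eq, Matrix.conjTranspose_add]
    convert this using 1
    abel
  zero_mem' := by simpa using zero_mem_pos n
  smul_mem' := by
    rintro ⟨c, hc⟩ v hv
    have := A.pos_smul n c hc _ hv
    rw [Set.mem_ofPred_eq]
    convert this using 1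
    ext i j
    simp [Nonneg.mk_smul, smul_add, Matrix.conjTranspose_apply]

theorem mem_accretive {n : ℕ} {v : A.Mat n} :
    v ∈ A.accretive n ↔ v + v.conjTranspose ∈ A.pos n := Iff.rfl

theorem mem_accretive_of_mem_pos {n : ℕ} {v : A.Mat n} (hv : v ∈ A.pos n) :
    v ∈ A.accretive n := by
  rw [mem_accretive, A.pos_star n v hv]
  exact A.pos_add n _ hv _ hv

theorem unitMat_mem_accretive (n : ℕ) : A.unitMat n ∈ A.accretive n :=
  mem_accretive_of_mem_pos (A.unit_pos n)

theorem mem_accretive_of_conjTranspose_eq_neg {n : ℕ} {v : A.Mat n}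
    (hv : v.conjTranspose = -v) : v ∈ A.accretive n := by
  rw [mem_accretive, hv, add_neg_cancel]
  exact zero_mem_pos n

theorem mem_pos_of_mem_accretive {n : ℕ} {v : A.Mat n} (hv : v ∈ A.accretive n)
    (hs : v.conjTranspose = v) : v ∈ A.pos n := by
  rw [mem_accretive, hs] at hv
  convert A.pos_smul n (1 / 2) (by norm_num) _ hv using 1
  push_cast
  module

theorem exists_smul_unitMat_add_mem_accretive {n : ℕ} (v : A.Mat n) :
    ∃ t : ℝ, t • A.unitMat n + v ∈ A.accretive n := by
  obtain ⟨t, -, ht⟩ := bddBelowMat_of_conjTranspose_eq (v := v + v.conjTranspose)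
    (by rw [Matrix.conjTranspose_add, Matrix.conjTranspose_conjTranspose, add_comm])
  refine ⟨t / 2, ?_⟩
  rw [mem_accretive]
  convert ht using 1
  have h1 : (A.unitMat n).conjTranspose = A.unitMat n := A.pos_star n _ (A.unit_pos n)
  rw [Matrix.conjTranspose_add, map_smul, scal_one, Complex.coe_smul, Matrix.conjTranspose_smul,
    h1, star_trivial]
  module

/-- A real functional which is positive on the accretive matrices. -/
def IsPosFun {n : ℕ} (F : A.Mat n →ₗ[ℝ] ℝ) : Prop := ∀ v ∈ A.accretive n, 0 ≤ F v

theorem IsPosFun.eq_zero {n : ℕ} {F : A.Mat n →ₗ[ℝ] ℝ} (hF : IsPosFun F) {v : A.Mat n}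
    (hv : v.conjTranspose = -v) : F v = 0 := by
  have h1 := hF v (mem_accretive_of_conjTranspose_eq_neg hv)
  have h2 := hF (-v) (mem_accretive_of_conjTranspose_eq_neg (by
    rw [Matrix.conjTranspose_neg, hv]))
  rw [map_neg] at h2
  linarith

theorem IsPosFun.conjTranspose {n : ℕ} {F : A.Mat n →ₗ[ℝ] ℝ} (hF : IsPosFun F) (v : A.Mat n) :
    F v.conjTranspose = F v := by
  have := hF.eq_zero (v := v - v.conjTranspose) (by
    rw [Matrix.conjTranspose_sub, Matrix.conjTranspose_conjTranspose, neg_sub])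
  rw [map_sub] at this
  linarith

/-- The complexification of a real functional. -/
def cplx {n : ℕ} (F : A.Mat n →ₗ[ℝ] ℝ) : A.Mat n →ₗ[ℂ] ℂ :=
  Module.Dual.extendRCLike (𝕜 := ℂ) F

theorem re_cplx {n : ℕ} (F : A.Mat n →ₗ[ℝ] ℝ) (v : A.Mat n) : (cplx F v).re = F v :=
  Module.Dual.re_extendRCLike_apply (𝕜 := ℂ) F v

theorem im_cplx {n : ℕ} (F : A.Mat n →ₗ[ℝ] ℝ) (v : A.Mat n) :
    (cplx F v).im = -F (Complex.I • v) :=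
  Module.Dual.im_extendRCLike_apply (𝕜 := ℂ) F v

theorem IsPosFun.cplx_of_conjTranspose_eq {n : ℕ} {F : A.Mat n →ₗ[ℝ] ℝ} (hF : IsPosFun F)
    {v : A.Mat n} (hv : v.conjTranspose = v) : cplx F v = F v := by
  apply Complex.ext
  · rw [re_cplx]; rfl
  · rw [im_cplx, hF.eq_zero (by rw [Matrix.conjTranspose_smul, hv]; simp), neg_zero]; rfl

/-- The linear map into matrices associated with a functional on matrices. -/
def choi {n : ℕ} (F : A.Mat n →ₗ[ℂ] ℂ) : MState A n where
  toFun v := Matrix.of fun i j => F (Matrix.single i j v)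
  map_add' v w := by ext i j; simp [Matrix.single_add]
  map_smul' c v := by
    ext i j
    simp only [Matrix.of_apply, RingHom.id_apply, Matrix.smul_apply]
    rw [← map_smul, Matrix.smul_single]

/-- A vector in `ℂ^r ⊗ ℂ^n` seen as an `r × n` matrix. -/
def unvec {r n : ℕ} (x : Fin r × Fin n → ℂ) : Matrix (Fin r) (Fin n) ℂ :=
  Matrix.of fun k i => x (k, i)

theorem dotProduct_mpair_choi {n r : ℕ} (F : A.Mat n →ₗ[ℂ] ℂ) (a : A.Mat r)
    (x y : Fin r × Fin n → ℂ) :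
    star x ⬝ᵥ (mpair (choi F) a).mulVec y =
      F (mmulMat (unvec x).conjTranspose a (unvec y)) := by
  have h : mmulMat (unvec x).conjTranspose a (unvec y) =
      ∑ i, ∑ j, ∑ k, ∑ l, (star (x (k, i)) * y (l, j)) • (Matrix.single i j (a k l) : A.Mat n) := by
    rw [Matrix.matrix_eq_sum_single (mmulMat _ _ _)]
    refine Finset.sum_congr rfl fun i _ => Finset.sum_congr rfl fun j _ => ?_
    simp only [mmulMat_apply, Matrix.conjTranspose_apply, unvec, Matrix.of_apply,
      Matrix.smul_single]
    simp only [← Matrix.singleAddMonoidHom_apply, map_sum]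
  rw [h]
  simp only [map_sum, map_smul, smul_eq_mul, dotProduct, Matrix.mulVec, mpair, choi, Fintype.sum_prod_type,
    LinearMap.coe_mk, AddHom.coe_mk, Matrix.of_apply, Pi.star_apply, Finset.mul_sum]
  rw [Finset.sum_comm]
  refine Finset.sum_congr rfl fun i _ => ?_
  rw [Finset.sum_congr rfl fun k _ => Finset.sum_comm, Finset.sum_comm]
  refine Finset.sum_congr rfl fun j _ => ?_
  refine Finset.sum_congr rfl fun k _ => Finset.sum_congr rfl fun l _ => ?_
  ring

end MOUS

/-- The ampliation `α ⊗ 1`. -/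
def ampl {m r : ℕ} (n : ℕ) (α : Matrix (Fin m) (Fin r) ℂ) :
    Matrix (Fin m × Fin n) (Fin r × Fin n) ℂ :=
  Matrix.of fun p q => if p.2 = q.2 then α p.1 q.1 else 0

theorem ampl_mulVec {m r n : ℕ} (α : Matrix (Fin m) (Fin r) ℂ) (y : Fin r × Fin n → ℂ)
    (p : Fin m × Fin n) : (ampl n α).mulVec y p = α.mulVec (fun k => y (k, p.2)) p.1 := by
  simp [Matrix.mulVec, dotProduct, ampl, Fintype.sum_prod_type, ite_mul, Finset.sum_ite_eq]

theorem vecNormSq_prod {r n : ℕ} (y : Fin r × Fin n → ℂ) :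
    vecNormSq y = ∑ i, vecNormSq fun k => y (k, i) := by
  simp only [vecNormSq, Fintype.sum_prod_type]
  exact Finset.sum_comm

theorem scalarOpNorm_ampl_le {m r n : ℕ} (α : Matrix (Fin m) (Fin r) ℂ) :
    scalarOpNorm (ampl n α) ≤ scalarOpNorm α := by
  refine scalarOpNorm_le_of_vecNormSq (scalarOpNorm_nonneg _) fun y => ?_
  rw [vecNormSq_prod, vecNormSq_prod, Finset.mul_sum]
  refine Finset.sum_le_sum fun i _ => ?_
  simp only [ampl_mulVec]
  exact vecNormSq_mulVec_le α _

theorem ampl_one {m n : ℕ} : ampl n (1 : Matrix (Fin m) (Fin m) ℂ) = 1 := by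
  ext p q
  simp only [ampl, Matrix.of_apply, Matrix.one_apply, Prod.ext_iff]
  by_cases h1 : p.2 = q.2 <;> by_cases h2 : p.1 = q.1 <;> simp [h1, h2]

section Mpair

variable {A : MOUS}

theorem mpair_add {n r : ℕ} (φ : MState A n) (a b : A.Mat r) :
    mpair φ (a + b) = mpair φ a + mpair φ b := by
  ext p q
  simp [mpair]

theorem mpair_sub {n r : ℕ} (φ : MState A n) (a b : A.Mat r) :
    mpair φ (a - b) = mpair φ a - mpair φ b := by
  ext p q
  simp [mpair]

theorem mpair_smul {n r : ℕ} (φ : MState A n) (c : ℂ) (a : A.Mat r) :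
    mpair φ (c • a) = c • mpair φ a := by
  ext p q
  simp [mpair]

theorem smul_mpair {n r : ℕ} (c : ℂ) (φ : MState A n) (a : A.Mat r) :
    mpair (c • φ) a = c • mpair φ a := by
  ext p q
  simp [mpair]

theorem mpair_mmulMat {n m r : ℕ} (φ : MState A n) (α : Matrix (Fin m) (Fin r) ℂ) (a : A.Mat r)
    (β : Matrix (Fin r) (Fin m) ℂ) :
    mpair φ (mmulMat α a β) = ampl n α * mpair φ a * ampl n β := by
  ext p q
  simp only [mpair, ampl, mmulMat_apply, Matrix.mul_apply, Matrix.of_apply, Fintype.sum_prod_type,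
    map_sum, map_smul, Matrix.sum_apply, Matrix.smul_apply, smul_eq_mul, ite_mul, zero_mul,
    mul_ite, mul_zero, Finset.sum_ite_eq, Finset.sum_ite_eq', Finset.mem_univ, if_true,
    Finset.sum_mul]
  rw [Finset.sum_comm]
  refine Finset.sum_congr rfl fun p _ => Finset.sum_congr rfl fun l _ => ?_
  ring

theorem mpair_comp {B : MOUS} {n r : ℕ} (φ : MState B n) (f : A.carrier →ₗ[ℂ] B.carrier)
    (a : A.Mat r) : mpair (A := A) (φ.comp f) a = mpair φ (mapMat f a) := rfl

theorem mpair_scal {n r : ℕ} {φ : MState A n} (hφ : φ A.one = 1) (X : Matrix (Fin r) (Fin r) ℂ) :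
    mpair φ (A.scal r X) = ampl n X := by
  ext p q
  simp [mpair, ampl, MOUS.scal_apply, hφ, Matrix.one_apply]

theorem CS.isHermitian {n : ℕ} {φ : MState A n} (hφ : φ ∈ CS A n) {h : A.carrier}
    (hh : star h = h) : (φ h).conjTranspose = φ h := by
  obtain ⟨t, ht, hp⟩ := A.orderUnit h hh
  have h1 := (hφ.2 1 _ hp).1
  ext i j
  have := congrFun (congrFun h1 (0, i)) (0, j)
  simp only [mpair, Matrix.conjTranspose_apply, Matrix.of_apply, map_sub, map_smul, hφ.1,
    Matrix.sub_apply, Matrix.smul_apply, star_sub, Matrix.one_apply] at this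
  rw [Matrix.conjTranspose_apply]
  by_cases hij : i = j
  · subst hij
    simpa using this
  · simpa [hij, Ne.symm hij] using this

theorem CS.map_star {n : ℕ} {φ : MState A n} (hφ : φ ∈ CS A n) (v : A.carrier) :
    φ (star v) = (φ v).conjTranspose := by
  obtain ⟨h, k, hh, hk, rfl⟩ := MOUS.exists_re_im v
  simp only [star_add, star_smul, hh, hk, map_add, map_smul, Matrix.conjTranspose_add,
    Matrix.conjTranspose_smul, CS.isHermitian hφ hh, CS.isHermitian hφ hk]

theorem CS.mpair_conjTranspose {n r : ℕ} {φ : MState A n} (hφ : φ ∈ CS A n) (v : A.Mat r) :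
    mpair φ v.conjTranspose = (mpair φ v).conjTranspose := by
  ext p q
  simp [mpair, Matrix.conjTranspose_apply, CS.map_star hφ]

theorem CS.comp {B : MOUS} {f : A.carrier →ₗ[ℂ] B.carrier} (hf : IsUCP A B f) {n : ℕ}
    {φ : MState B n} (hφ : φ ∈ CS B n) : φ.comp f ∈ CS A n :=
  ⟨by rw [LinearMap.comp_apply, hf.unital, hφ.1], fun r v hv => hφ.2 r _ (hf.cp r v hv)⟩

/-- The block matrix `[[t1, v], [v*, t1]]`. -/
def MOUS.normBlock {n : ℕ} (t : ℝ) (v : A.Mat n) : A.Mat (n + n) :=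
  Matrix.reindex finSumFinEquiv finSumFinEquiv
    (Matrix.fromBlocks ((t : ℂ) • A.unitMat n) v v.conjTranspose ((t : ℂ) • A.unitMat n))

theorem CS.scalarOpNorm_mpair_le {n r : ℕ} {φ : MState A n} (hφ : φ ∈ CS A n) {v : A.Mat r}
    {t : ℝ} (ht : 0 ≤ t) (h : MOUS.normBlock t v ∈ A.pos (r + r)) :
    scalarOpNorm (mpair φ v) ≤ t := by
  have h1 := hφ.2 _ _ h
  let e : (Fin r × Fin n) ⊕ (Fin r × Fin n) → Fin (r + r) × Fin n :=
    Sum.elim (fun p => (finSumFinEquiv (Sum.inl p.1), p.2))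
      (fun p => (finSumFinEquiv (Sum.inr p.1), p.2))
  have h2 : ((mpair φ (MOUS.normBlock t v)).submatrix e e) =
      Matrix.fromBlocks ((t : ℂ) • 1) (mpair φ v) (mpair φ v).conjTranspose ((t : ℂ) • 1) := by
    rw [← CS.mpair_conjTranspose hφ, ← ampl_one, ← mpair_scal hφ.1 1, ← mpair_smul]
    rw [MOUS.scal_one]
    ext p q
    rcases p with p | p <;> rcases q with q | q <;>
      simp [mpair, MOUS.normBlock, e, -finSumFinEquiv_apply_left, -finSumFinEquiv_apply_right]
  refine scalarOpNorm_le_of_bilin ht fun x y => ?_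
  have h3 := (h1.submatrix e).dotProduct_mulVec_nonneg (Sum.elim (-x) y)
  rw [h2, Matrix.fromBlocks_mulVec] at h3
  have h4 : star (Sum.elim (-x) y) = Sum.elim (-star x) (star y) := by
    ext p; rcases p with p | p <;> simp
  rw [h4, sumElim_dotProduct_sumElim] at h3
  have h5 := (Complex.le_def.1 h3).1
  have h6 : star y ⬝ᵥ (mpair φ v).conjTranspose.mulVec x = star (star x ⬝ᵥ (mpair φ v).mulVec y) := by
    rw [Matrix.star_dotProduct, Matrix.star_mulVec, Matrix.dotProduct_mulVec,
      Matrix.conjTranspose_conjTranspose]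
  simp only [Sum.elim_comp_inl, Sum.elim_comp_inr, Matrix.smul_mulVec, Matrix.one_mulVec,
    dotProduct_add, neg_dotProduct, dotProduct_smul, Matrix.mulVec_neg, dotProduct_neg, h6,
    star_dotProduct_self] at h5
  simp at h5
  linarith

theorem MOUS.exists_normBlock_mem_pos {r : ℕ} (v : A.Mat r) :
    ∃ t : ℝ, 0 ≤ t ∧ MOUS.normBlock t v ∈ A.pos (r + r) := by
  have hu : (A.unitMat r).conjTranspose = A.unitMat r := A.pos_star r _ (A.unit_pos r)
  obtain ⟨t, ht, h⟩ := MOUS.bddBelowMat_of_conjTranspose_eq (v := MOUS.normBlock 0 v) (by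
    simp [MOUS.normBlock, Matrix.conjTranspose_submatrix, Matrix.fromBlocks_conjTranspose])
  refine ⟨t, ht, ?_⟩
  convert h using 1
  rw [map_smul, MOUS.scal_one]
  ext i j
  obtain ⟨i, rfl⟩ := finSumFinEquiv.surjective i
  obtain ⟨j, rfl⟩ := finSumFinEquiv.surjective j
  simp only [MOUS.normBlock, MOUS.unitMat, Matrix.add_apply, Matrix.smul_apply,
    Matrix.diagonal_apply, Matrix.reindex_apply, Matrix.submatrix_apply, Equiv.symm_apply_apply,
    EmbeddingLike.apply_eq_iff_eq]
  rcases i with i | i <;> rcases j with j | j <;> simp [Matrix.diagonal_apply]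

theorem CS.scalarOpNorm_mpair_lt {n r : ℕ} {φ : MState A n} (hφ : φ ∈ CS A n) {v : A.Mat r}
    {ε : ℝ} (hε : 0 < ε) (h : A.matNorm v < ε) : scalarOpNorm (mpair φ v) < ε := by
  obtain ⟨t₀, ht₀, hp₀⟩ := MOUS.exists_normBlock_mem_pos v
  obtain ⟨t, ht, hlt⟩ := exists_lt_of_csInf_lt ⟨t₀, hp₀⟩ h
  rcases le_or_gt 0 t with h0 | h0
  · exact (CS.scalarOpNorm_mpair_le hφ h0 ht).trans_lt hlt
  · refine (CS.scalarOpNorm_mpair_le hφ le_rfl ?_).trans_lt hε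
    convert A.pos_add _ _ ht _ (A.pos_smul _ (-t) (neg_nonneg.2 h0.le) _ (A.unit_pos (r + r))) using 1
    ext i j
    obtain ⟨i, rfl⟩ := finSumFinEquiv.surjective i
    obtain ⟨j, rfl⟩ := finSumFinEquiv.surjective j
    simp only [MOUS.normBlock, MOUS.unitMat, Matrix.add_apply, Matrix.smul_apply,
      Matrix.diagonal_apply, Matrix.reindex_apply, Matrix.submatrix_apply, Equiv.symm_apply_apply,
      EmbeddingLike.apply_eq_iff_eq]
    rcases i with i | i <;> rcases j with j | j <;> simp [Matrix.diagonal_apply]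
    all_goals split_ifs <;> simp

/-- Uniform boundedness of an element over all matrix states. -/
theorem CS.exists_bound {r : ℕ} (v : A.Mat r) :
    ∃ t : ℝ, 0 ≤ t ∧ ∀ n, ∀ φ ∈ CS A n, scalarOpNorm (mpair φ v) ≤ t := by
  obtain ⟨t, ht, h⟩ := MOUS.exists_normBlock_mem_pos v
  exact ⟨t, ht, fun n φ hφ => CS.scalarOpNorm_mpair_le hφ ht h⟩

end Mpair

namespace MOUS

variable {A : MOUS}

theorem mapMat_single {V W : Type} [AddCommGroup V] [AddCommGroup W] [Module ℂ V] [Module ℂ W]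
    (φ : V →ₗ[ℂ] W) {n : ℕ} (i j : Fin n) (v : V) :
    mapMat φ (Matrix.single i j v) = Matrix.single i j (φ v) := by
  ext k l
  simp only [mapMat_apply, Matrix.single_apply]
  split_ifs <;> simp

theorem IsPosFun.cplx_conjTranspose {n : ℕ} {F : A.Mat n →ₗ[ℝ] ℝ} (hF : IsPosFun F)
    (v : A.Mat n) : cplx F v.conjTranspose = star (cplx F v) := by
  apply Complex.ext
  · rw [re_cplx, hF.conjTranspose, Complex.star_def, Complex.conj_re, re_cplx]
  · rw [im_cplx, Complex.star_def, Complex.conj_im, im_cplx, neg_neg, ← hF.conjTranspose,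
      Matrix.conjTranspose_smul, Matrix.conjTranspose_conjTranspose, Complex.star_def,
      Complex.conj_I, neg_smul, map_neg, neg_neg]

theorem IsPosFun.posSemidef_mpair_choi {n : ℕ} {F : A.Mat n →ₗ[ℝ] ℝ} (hF : IsPosFun F) {r : ℕ}
    {v : A.Mat r} (hv : v ∈ A.pos r) : (mpair (choi (cplx F)) v).PosSemidef := by
  refine posSemidef_of_re_nonneg ?_ fun x => ?_
  · have key : ∀ x y, star (star x ⬝ᵥ (mpair (choi (cplx F)) v).mulVec y) =
        star y ⬝ᵥ (mpair (choi (cplx F)) v).mulVec x := by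
      intro x y
      rw [dotProduct_mpair_choi, dotProduct_mpair_choi, ← hF.cplx_conjTranspose,
        conjTranspose_mmulMat, Matrix.conjTranspose_conjTranspose, A.pos_star r v hv]
    ext p q
    have := key (Pi.single q 1) (Pi.single p 1)
    have hs : ∀ s, star (Pi.single s 1 : Fin r × Fin n → ℂ) = Pi.single s 1 := fun s => by
      rw [← Pi.single_star, _root_.star_one]
    simpa [hs] using this
  · rw [dotProduct_mpair_choi, re_cplx]
    exact hF _ (mem_accretive_of_mem_pos (pos_mmulMat _ hv))

/-- Matrix order unit spaces with nonzero unit have states. -/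
theorem exists_state (h1 : A.one ≠ 0) : ∃ ω, ω ∈ CS A 1 := by
  have hx : -A.unitMat 1 ∉ A.accretive 1 := by
    intro h
    have hu : (A.unitMat 1).conjTranspose = A.unitMat 1 := A.pos_star 1 _ (A.unit_pos 1)
    have := A.proper _ (show A.unitMat 1 ∈ A.pos 1 from A.unit_pos 1) (mem_pos_of_mem_accretive h (by
      rw [Matrix.conjTranspose_neg, hu]))
    exact h1 (by simpa [unitMat] using congrFun (congrFun this 0) 0)
  obtain ⟨F, hF, hF1, -⟩ := PointedCone.exists_functional_nonpos (A.accretive 1)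
    (unitMat_mem_accretive 1) exists_smul_unitMat_add_mem_accretive hx
  refine ⟨choi (cplx F), ?_, fun r v hv => IsPosFun.posSemidef_mpair_choi hF hv⟩
  ext i j
  obtain rfl : i = 0 := Subsingleton.elim _ _
  obtain rfl : j = 0 := Subsingleton.elim _ _
  have h2 : (Matrix.single 0 0 A.one : A.Mat 1) = A.unitMat 1 := by
    ext k l
    simp [unitMat, Subsingleton.elim k 0, Subsingleton.elim l 0]
  have h3 : (A.unitMat 1).conjTranspose = A.unitMat 1 := A.pos_star 1 _ (A.unit_pos 1)
  simp [choi, h2, IsPosFun.cplx_of_conjTranspose_eq hF h3, hF1]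

theorem posSemidef_of_ampl {n : ℕ} {Z : Matrix (Fin n) (Fin n) ℂ}
    (h : (ampl 1 Z).PosSemidef) : Z.PosSemidef := by
  convert h.submatrix (fun i : Fin n => (i, (0 : Fin 1))) using 1
  ext i j
  simp [ampl]

theorem posSemidef_of_scal_mem_pos (h1 : A.one ≠ 0) {n : ℕ} {Z : Matrix (Fin n) (Fin n) ℂ}
    (h : A.scal n Z ∈ A.pos n) : Z.PosSemidef := by
  obtain ⟨ω, hω⟩ := exists_state h1
  have := hω.2 n _ h
  rw [mpair_scal hω.1] at this
  exact posSemidef_of_ampl this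

/-- The functional on matrices associated with a linear map into matrices. -/
def ent {n : ℕ} (φ : MState A n) : A.Mat n →ₗ[ℂ] ℂ where
  toFun v := ∑ i, ∑ j, φ (v i j) i j
  map_add' v w := by simp [Finset.sum_add_distrib]
  map_smul' c v := by simp [Finset.mul_sum]

theorem ent_single {n : ℕ} (φ : MState A n) (i j : Fin n) (v : A.carrier) :
    ent φ (Matrix.single i j v) = φ v i j := by
  have h : ∀ k l, φ ((Matrix.single i j v : A.Mat n) k l) k l =
      if i = k then if j = l then φ v k l else 0 else 0 := by
    intro k l
    rw [Matrix.single_apply]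
    by_cases h1 : i = k <;> by_cases h2 : j = l <;> simp [h1, h2]
  simp [ent, h]

theorem ent_nonneg {n : ℕ} {φ : MState A n} (hφ : φ ∈ CS A n) {v : A.Mat n}
    (hv : v ∈ A.pos n) : 0 ≤ (ent φ v).re := by
  have h := (hφ.2 n v hv).dotProduct_mulVec_nonneg fun p => if p.1 = p.2 then 1 else 0
  have h1 := (Complex.le_def.1 h).1
  suffices e : ent φ v = _ from e ▸ h1
  simp only [ent, LinearMap.coe_mk, AddHom.coe_mk, dotProduct, Matrix.mulVec, mpair,
    Fintype.sum_prod_type, Pi.star_apply, Matrix.of_apply]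
  refine Finset.sum_congr rfl fun i _ => ?_
  symm
  rw [Finset.sum_eq_single i (by intro k _ hk; simp [Ne.symm hk]) (by simp)]
  simp

theorem ent_conjTranspose {n : ℕ} {φ : MState A n} (hφ : φ ∈ CS A n) (v : A.Mat n) :
    ent φ v.conjTranspose = star (ent φ v) := by
  simp only [ent, LinearMap.coe_mk, AddHom.coe_mk, Matrix.conjTranspose_apply, CS.map_star hφ,
    star_sum]
  exact Finset.sum_comm

end MOUS

theorem IsUCP.map_star {A B : MOUS} {f : A.carrier →ₗ[ℂ] B.carrier} (hf : IsUCP A B f)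
    (v : A.carrier) : f (star v) = star (f v) := by
  have key : ∀ h : A.carrier, star h = h → star (f h) = f h := by
    intro h hh
    obtain ⟨t, ht, hp⟩ := A.orderUnit h hh
    have h1 := B.pos_star _ _ (hf.cp 1 _ hp)
    have := congrFun (congrFun h1 0) 0
    simpa [mapMat, hf.unital, star_smul, MOUS.star_one] using this
  obtain ⟨h, k, hh, hk, rfl⟩ := MOUS.exists_re_im v
  simp only [star_add, star_smul, hh, hk, map_add, map_smul, key h hh, key k hk]

theorem IsUCP.mapMat_conjTranspose {A B : MOUS} {f : A.carrier →ₗ[ℂ] B.carrier}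
    (hf : IsUCP A B f) {n : ℕ} (v : A.Mat n) :
    mapMat f v.conjTranspose = (mapMat f v).conjTranspose := by
  ext i j
  simp [mapMat_apply, hf.map_star]

/-- Matrix states extend along unital complete order embeddings. -/
theorem CS.exists_extension {A W : MOUS} {j : A.carrier →ₗ[ℂ] W.carrier} (hj : IsUCP A W j)
    (hinj : Function.Injective j)
    (hord : ∀ (n : ℕ) (a : A.Mat n), mapMat j a ∈ W.pos n → a ∈ A.pos n) {n : ℕ}
    {φ : MState A n} (hφ : φ ∈ CS A n) : ∃ ψ ∈ CS W n, ψ.comp j = φ := by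
  let J : A.Mat n →ₗ[ℝ] W.Mat n :=
    { toFun := mapMat j
      map_add' := fun a b => by ext; simp [mapMat_apply]
      map_smul' := fun c a => by
        ext
        simp [mapMat_apply, ← Complex.coe_smul] }
  have hJ : Function.Injective J := fun a b h => by
    ext k l
    exact hinj (congrFun (congrFun h k) l)
  let G : A.Mat n →ₗ[ℝ] ℝ := Complex.reLm.comp ((MOUS.ent φ).restrictScalars ℝ)
  let e := LinearEquiv.ofInjective J hJ
  have he : ∀ v, G (e.symm ⟨J v, LinearMap.mem_range_self J v⟩) = G v := fun v => by
    congr 1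
    rw [LinearEquiv.symm_apply_eq]
    rfl
  obtain ⟨F, hF1, hF2⟩ := riesz_extension (W.accretive n)
    (⟨LinearMap.range J, G.comp e.symm.toLinearMap⟩ : W.Mat n →ₗ.[ℝ] ℝ) (by
      rintro ⟨_, ⟨v, rfl⟩⟩ h
      refine le_of_le_of_eq ?_ (he v).symm
      change J v ∈ _ at h
      rw [MOUS.mem_accretive] at h
      have h1 : mapMat j v + (mapMat j v).conjTranspose = mapMat j (v + v.conjTranspose) := by
        rw [← hj.mapMat_conjTranspose]
        exact (map_add J v v.conjTranspose).symm
      have h2 := MOUS.ent_nonneg hφ (hord _ _ (h1 ▸ h))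
      rw [map_add, MOUS.ent_conjTranspose hφ] at h2
      simp at h2
      exact h2) (by
      intro y
      obtain ⟨t, ht⟩ := MOUS.exists_smul_unitMat_add_mem_accretive y
      refine ⟨⟨J (t • A.unitMat n), LinearMap.mem_range_self J _⟩, ?_⟩
      have hu : J (A.unitMat n) = W.unitMat n := by
        ext k l
        by_cases hkl : k = l <;> simp [J, mapMat_apply, MOUS.unitMat, hkl, hj.unital]
      change J (t • A.unitMat n) + y ∈ _
      rwa [map_smul, hu])
  have hFJ : ∀ v, F (mapMat j v) = (MOUS.ent φ v).re := fun v => by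
    exact (hF1 ⟨J v, LinearMap.mem_range_self J v⟩).trans (he v)
  have hcomp : (MOUS.choi (MOUS.cplx F)).comp j = φ := by
    ext a i k
    simp only [MOUS.choi, LinearMap.comp_apply, LinearMap.coe_mk, AddHom.coe_mk, Matrix.of_apply]
    rw [← MOUS.mapMat_single, ← MOUS.ent_single φ]
    apply Complex.ext
    · rw [MOUS.re_cplx, hFJ]
    · rw [MOUS.im_cplx, show Complex.I • mapMat j (Matrix.single i k a) =
        mapMat j (Complex.I • (Matrix.single i k a : A.Mat n)) by
        ext p q
        rw [Matrix.smul_apply, mapMat_apply, mapMat_apply, Matrix.smul_apply, map_smul], hFJ,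
        map_smul]
      simp
  refine ⟨MOUS.choi (MOUS.cplx F), ⟨?_, fun r v hv => MOUS.IsPosFun.posSemidef_mpair_choi hF2 hv⟩,
    hcomp⟩
  rw [← hj.unital, ← LinearMap.comp_apply, hcomp, hφ.1]

section Dmetric

open Filter Topology

variable {A : MOUS} {L : ∀ n : ℕ, A.Mat n → ℝ}

theorem IsMatrixLipschitzSeminorm.map_zero (hL : IsMatrixLipschitzSeminorm A L) (n : ℕ) :
    L n 0 = 0 := by
  simpa using hL.smul_eq n 0 0

theorem CS.segment {n : ℕ} {φ ψ : MState A n} (hφ : φ ∈ CS A n) (hψ : ψ ∈ CS A n) {t : ℝ}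
    (h0 : 0 ≤ t) (h1 : t ≤ 1) : ((1 - t : ℝ) : ℂ) • φ + (t : ℂ) • ψ ∈ CS A n := by
  refine ⟨?_, fun r v hv => ?_⟩
  · rw [LinearMap.add_apply, LinearMap.smul_apply, LinearMap.smul_apply, hφ.1, hψ.1, ← add_smul]
    simp
  · have : mpair (((1 - t : ℝ) : ℂ) • φ + (t : ℂ) • ψ) v =
        ((1 - t : ℝ) : ℂ) • mpair φ v + (t : ℂ) • mpair ψ v := by
      ext p q
      simp [mpair]
    rw [this]
    exact ((hφ.2 r v hv).smul (by exact_mod_cast sub_nonneg.2 h1)).add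
      ((hψ.2 r v hv).smul (by exact_mod_cast h0))

/-- The set of values whose supremum is `Dmet`. -/
def dSet (A : MOUS) (L : ∀ n : ℕ, A.Mat n → ℝ) (n : ℕ) (φ ψ : MState A n) : Set ℝ :=
  {x | ∃ (r : ℕ) (a : A.Mat r), L r a ≤ 1 ∧ x = scalarOpNorm (mpair φ a - mpair ψ a)}

theorem dmet_nonneg (n : ℕ) (φ ψ : MState A n) : 0 ≤ Dmet A L n φ ψ := by
  refine Real.sSup_nonneg ?_
  rintro _ ⟨r, a, -, rfl⟩
  exact scalarOpNorm_nonneg _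

theorem dmet_le {n : ℕ} {φ ψ : MState A n} {c : ℝ} (hc : 0 ≤ c)
    (h : ∀ r (a : A.Mat r), L r a ≤ 1 → scalarOpNorm (mpair φ a - mpair ψ a) ≤ c) :
    Dmet A L n φ ψ ≤ c := by
  refine Real.sSup_le ?_ hc
  rintro _ ⟨r, a, ha, rfl⟩
  exact h r a ha

theorem dmet_self (n : ℕ) (φ : MState A n) : Dmet A L n φ φ = 0 :=
  le_antisymm (dmet_le le_rfl fun r a _ => by rw [sub_self, scalarOpNorm_zero]) (dmet_nonneg _ _ _)

theorem isOpen_BWtop_eval {n : ℕ} (v : A.carrier) (i k : Fin n) {O : Set ℂ} (hO : IsOpen O) :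
    IsOpen[BWtop A n] {χ | χ.1 v i k ∈ O} := by
  let := lmTop A n
  refine isOpen_induced_iff.2 ⟨{χ | χ v i k ∈ O}, isOpen_induced_iff.2
    ⟨{f | f v i k ∈ O}, ?_, rfl⟩, rfl⟩
  exact hO.preimage ((continuous_apply v).matrix_elem i k)

theorem nonempty_inter_of_isOpen_dtop {n : ℕ} {φ ψ : MState A n} (hφ : φ ∈ CS A n)
    (hψ : ψ ∈ CS A n) (hunb : ¬ BddAbove (dSet A L n φ ψ))
    {U V : Set {φ : MState A n // φ ∈ CS A n}} (hU : IsOpen[Dtop A L n] U)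
    (hV : IsOpen[Dtop A L n] V) (hφU : ⟨φ, hφ⟩ ∈ U) (hψV : ⟨ψ, hψ⟩ ∈ V) : (U ∩ V).Nonempty := by
  let γ : Set.Icc (0 : ℝ) 1 → {φ : MState A n // φ ∈ CS A n} := fun t =>
    ⟨((1 - t : ℝ) : ℂ) • φ + (t : ℂ) • ψ, CS.segment hφ hψ t.2.1 t.2.2⟩
  have hγ : ∀ (s t : Set.Icc (0 : ℝ) 1) r (a : A.Mat r), |(t : ℝ) - s| *
      scalarOpNorm (mpair φ a - mpair ψ a) =
        scalarOpNorm (mpair (γ s).1 a - mpair (γ t).1 a) := by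
    intro s t r a
    have : mpair (γ s).1 a - mpair (γ t).1 a =
        (((t : ℝ) - s : ℝ) : ℂ) • (mpair φ a - mpair ψ a) := by
      ext p q
      simp [mpair, γ]
      ring
    rw [this, scalarOpNorm_smul, Complex.norm_real, Real.norm_eq_abs]
  have hbasic : ∀ (χ : MState A n) (s t : Set.Icc (0 : ℝ) 1), BddAbove (dSet A L n χ (γ s).1) →
      BddAbove (dSet A L n χ (γ t).1) → s = t := by
    rintro χ s t ⟨b, hb⟩ ⟨c, hc⟩
    by_contra hst
    apply hunb
    have hpos : 0 < |(t : ℝ) - s| := abs_pos.2 (sub_ne_zero.2 fun h => hst (Subtype.ext h.symm))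
    refine ⟨(b + c) / |(t : ℝ) - s|, ?_⟩
    rintro _ ⟨r, a, ha, rfl⟩
    rw [le_div_iff₀ hpos, mul_comm, hγ]
    have h1 := hb ⟨r, a, ha, rfl⟩
    have h2 := hc ⟨r, a, ha, rfl⟩
    have : mpair (γ s).1 a - mpair (γ t).1 a = (mpair χ a - mpair (γ t).1 a) -
        (mpair χ a - mpair (γ s).1 a) := by abel
    rw [this]
    refine (scalarOpNorm_sub_le _ _).trans ?_
    linarith
  have hgen : ∀ O, IsOpen[Dtop A L n] O → (∃ t, γ t ∈ O) → ((γ ⁻¹' O)ᶜ).Finite := by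
    intro O hO
    induction hO with
    | basic O hO =>
      obtain ⟨φ₀, ε, hε, rfl⟩ := hO
      intro _
      refine Set.Subsingleton.finite fun s hs t ht => ?_
      have key : ∀ s, s ∈ (γ ⁻¹' {χ | Dmet A L n φ₀.1 χ.1 < ε})ᶜ →
          BddAbove (dSet A L n φ₀.1 (γ s).1) := by
        intro s hs
        by_contra hb
        refine hs (lt_of_eq_of_lt ?_ hε)
        exact Real.sSup_of_not_bddAbove hb
      exact hbasic _ s t (key s hs) (key t ht)
    | univ => simp
    | inter O O' _ _ ih ih' =>
      rintro ⟨t, ht, ht'⟩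
      rw [Set.preimage_inter, Set.compl_inter]
      exact (ih ⟨t, ht⟩).union (ih' ⟨t, ht'⟩)
    | sUnion S _ ih =>
      rintro ⟨t, O, hO, ht⟩
      refine (ih O hO ⟨t, ht⟩).subset (Set.compl_subset_compl.2 ?_)
      exact Set.preimage_mono (Set.subset_sUnion_of_mem hO)
  have h0 : γ ⟨0, by simp⟩ = ⟨φ, hφ⟩ := by
    ext1
    simp [γ]
  have h1 : γ ⟨1, by simp⟩ = ⟨ψ, hψ⟩ := by
    ext1
    simp [γ]
  have hfin := (hgen U hU ⟨_, h0 ▸ hφU⟩).union (hgen V hV ⟨_, h1 ▸ hψV⟩)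
  rw [← Set.compl_inter] at hfin
  have : Infinite (Set.Icc (0 : ℝ) 1) := Set.infinite_coe_iff.2 (Set.Icc_infinite one_pos)
  obtain ⟨t, ht⟩ := hfin.infinite_compl.nonempty
  rw [compl_compl] at ht
  exact ⟨γ t, ht⟩

theorem IsMatrixLipNorm.bddAbove_dSet (hL : IsMatrixLipNorm A L) {n : ℕ} {φ ψ : MState A n}
    (hφ : φ ∈ CS A n) (hψ : ψ ∈ CS A n) : BddAbove (dSet A L n φ ψ) := by
  by_contra hunb
  have hne : φ ≠ ψ := by
    rintro rfl
    refine hunb ⟨0, ?_⟩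
    rintro _ ⟨r, a, -, rfl⟩
    rw [sub_self, scalarOpNorm_zero]
  obtain ⟨v, i, k, hv⟩ : ∃ v i k, φ v i k ≠ ψ v i k := by
    by_contra! h
    exact hne (LinearMap.ext fun v => Matrix.ext fun i k => h v i k)
  obtain ⟨O₁, O₂, h1, h2, h3, h4, hd⟩ := t2_separation hv
  obtain ⟨χ, hχ1, hχ2⟩ := nonempty_inter_of_isOpen_dtop hφ hψ hunb
    (U := {χ | χ.1 v i k ∈ O₁}) (V := {χ | χ.1 v i k ∈ O₂})
    (by rw [hL.top_eq]; exact isOpen_BWtop_eval v i k h1)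
    (by rw [hL.top_eq]; exact isOpen_BWtop_eval v i k h2) h3 h4
  exact Set.disjoint_left.1 hd hχ1 hχ2

theorem IsMatrixLipNorm.le_mul_dmet (hL : IsMatrixLipNorm A L) {n : ℕ} {φ ψ : MState A n}
    (hφ : φ ∈ CS A n) (hψ : ψ ∈ CS A n) {r : ℕ} (a : A.Mat r) :
    scalarOpNorm (mpair φ a - mpair ψ a) ≤ L r a * Dmet A L n φ ψ := by
  have h0 := hL.nonneg r a
  have key : ∀ c, L r a < c → scalarOpNorm (mpair φ a - mpair ψ a) ≤ c * Dmet A L n φ ψ := by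
    intro c hc
    have hc0 : 0 < c := h0.trans_lt hc
    have h1 : L r (((c⁻¹ : ℝ) : ℂ) • a) ≤ 1 := by
      rw [hL.smul_eq, Complex.norm_real, Real.norm_of_nonneg (inv_nonneg.2 hc0.le),
        inv_mul_le_iff₀ hc0]
      linarith
    have h2 := le_csSup (hL.bddAbove_dSet hφ hψ) ⟨r, _, h1, rfl⟩
    rw [mpair_smul, mpair_smul, ← smul_sub, scalarOpNorm_smul, Complex.norm_real,
      Real.norm_of_nonneg (inv_nonneg.2 hc0.le), inv_mul_le_iff₀ hc0] at h2
    exact h2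
  have hd := dmet_nonneg (A := A) (L := L) n φ ψ
  refine le_of_forall_pos_le_add fun ε hε => ?_
  have := key (L r a + ε / (Dmet A L n φ ψ + 1)) (by
    have : 0 < ε / (Dmet A L n φ ψ + 1) := by positivity
    linarith)
  refine this.trans ?_
  rw [add_mul]
  gcongr
  rw [div_mul_eq_mul_div, div_le_iff₀ (by positivity)]
  nlinarith

theorem IsMatrixLipNorm.lfromD_le (hL : IsMatrixLipNorm A L) {r : ℕ} (a : A.Mat r) :
    LfromD A L r a ≤ L r a := by
  refine Real.sSup_le ?_ (hL.nonneg r a)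
  rintro _ ⟨n, φ, ψ, hφ, hψ, -, rfl⟩
  exact div_le_of_le_mul₀ (dmet_nonneg _ _ _) (hL.nonneg r a) (hL.le_mul_dmet hφ hψ a)

theorem IsMatrixLipNorm.le_lfromD_mul (hL : IsMatrixLipNorm A L) {n : ℕ} {φ ψ : MState A n}
    (hφ : φ ∈ CS A n) (hψ : ψ ∈ CS A n) {r : ℕ} (a : A.Mat r) :
    scalarOpNorm (mpair φ a - mpair ψ a) ≤ LfromD A L r a * Dmet A L n φ ψ := by
  have h1 := hL.le_mul_dmet hφ hψ a
  rcases (dmet_nonneg (A := A) (L := L) n φ ψ).eq_or_lt with h0 | h0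
  · rw [← h0, mul_zero] at h1 ⊢
    exact h1
  rw [← div_le_iff₀ h0]
  refine le_csSup ⟨L r a, ?_⟩ ⟨n, φ, ψ, hφ, hψ, ?_, rfl⟩
  · rintro _ ⟨n, φ, ψ, hφ, hψ, -, rfl⟩
    exact div_le_of_le_mul₀ (dmet_nonneg _ _ _) (hL.nonneg r a) (hL.le_mul_dmet hφ hψ a)
  · rintro rfl
    rw [dmet_self] at h0
    exact h0.false

theorem IsMatrixLipNorm.eventually_dmet_lt (hL : IsMatrixLipNorm A L) {n : ℕ} {ι : Type*}
    {l : Filter ι} {f : ι → MState A n} {ψ : MState A n} (hf : ∀ᶠ i in l, f i ∈ CS A n)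
    (hψ : ψ ∈ CS A n)
    (h : ∀ v p q, Tendsto (fun i => f i v p q) l (𝓝 (ψ v p q))) {ε : ℝ} (hε : 0 < ε) :
    ∀ᶠ i in l, Dmet A L n ψ (f i) < ε := by
  classical
  have hO : IsOpen[BWtop A n] {χ | Dmet A L n ψ χ.1 < ε} := by
    rw [← hL.top_eq]
    exact TopologicalSpace.isOpen_generateFrom_of_mem ⟨⟨ψ, hψ⟩, ε, hε, rfl⟩
  let g : ι → {φ : MState A n // φ ∈ CS A n} := fun i =>
    if hi : f i ∈ CS A n then ⟨f i, hi⟩ else ⟨ψ, hψ⟩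
  let := lmTop A n
  obtain ⟨U, hU, hUe⟩ := isOpen_induced_iff.1 hO
  obtain ⟨V, hV, rfl⟩ := isOpen_induced_iff.1 hU
  have hmem : (⟨ψ, hψ⟩ : {φ : MState A n // φ ∈ CS A n}) ∈
      {χ : {φ : MState A n // φ ∈ CS A n} | Dmet A L n ψ χ.1 < ε} :=
    lt_of_eq_of_lt (dmet_self n ψ) hε
  rw [← hUe] at hmem
  have ht : Tendsto (fun i => (f i : A.carrier → Matrix (Fin n) (Fin n) ℂ)) l (𝓝 ψ) :=
    tendsto_pi_nhds.2 fun v => tendsto_pi_nhds.2 fun p => tendsto_pi_nhds.2 fun q => h v p q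
  filter_upwards [hf, ht (hV.mem_nhds hmem)] with i hi hi2
  have : (⟨f i, hi⟩ : {φ : MState A n // φ ∈ CS A n}) ∈
      {χ : {φ : MState A n // φ ∈ CS A n} | Dmet A L n ψ χ.1 < ε} := by
    rw [← hUe]
    exact hi2
  exact this

end Dmetric

theorem Matrix.PosDef.exists_conjTranspose_mul_mul_eq_one {n : Type*} [Fintype n] [DecidableEq n]
    {p : Matrix n n ℂ} (hp : p.PosDef) :
    ∃ R K : Matrix n n ℂ, R.conjTranspose * p * R = 1 ∧ K * R = 1 := by
  open scoped MatrixOrder in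
  obtain ⟨y, hy⟩ := CStarAlgebra.nonneg_iff_eq_star_mul_self.1 hp.posSemidef.nonneg
  rw [Matrix.star_eq_conjTranspose] at hy
  have hu : IsUnit y.det := by
    have := (Matrix.isUnit_iff_isUnit_det _).1 hp.isUnit
    rw [hy, Matrix.det_mul] at this
    exact isUnit_of_mul_isUnit_right this
  refine ⟨y⁻¹, y, ?_, Matrix.mul_nonsing_inv y hu⟩
  rw [hy, Matrix.conjTranspose_nonsing_inv]
  rw [← Matrix.mul_assoc, Matrix.nonsing_inv_mul _ (by
    rw [Matrix.det_conjTranspose]; exact hu.star), one_mul, Matrix.mul_nonsing_inv y hu]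

namespace MOUS

variable {A : MOUS}

theorem mmulMat_conjTranspose_mem_accretive {m n : ℕ} (T : Matrix (Fin n) (Fin m) ℂ) {v : A.Mat n}
    (hv : v ∈ A.accretive n) : mmulMat T.conjTranspose v T ∈ A.accretive m := by
  rw [mem_accretive] at hv ⊢
  rw [conjTranspose_mmulMat, Matrix.conjTranspose_conjTranspose, ← mmulMat_add]
  exact pos_mmulMat T hv

/-- The functional `v ↦ F (Tᴴ v T)`. -/
def conjFun {m n : ℕ} (F : A.Mat n →ₗ[ℝ] ℝ) (T : Matrix (Fin m) (Fin n) ℂ) :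
    A.Mat m →ₗ[ℝ] ℝ where
  toFun v := F (mmulMat T.conjTranspose v T)
  map_add' v w := by rw [mmulMat_add, map_add]
  map_smul' c v := by
    rw [RingHom.id_apply, ← map_smul]
    congr 1
    exact mmulMat_smul _ (c : ℂ) v _

theorem IsPosFun.conjFun {m n : ℕ} {F : A.Mat n →ₗ[ℝ] ℝ} (hF : IsPosFun F)
    (T : Matrix (Fin m) (Fin n) ℂ) : IsPosFun (conjFun F T) := fun _ hv =>
  hF _ (mmulMat_conjTranspose_mem_accretive T hv)

theorem cplx_conjFun {m n : ℕ} (F : A.Mat n →ₗ[ℝ] ℝ) (T : Matrix (Fin m) (Fin n) ℂ)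
    (v : A.Mat m) : cplx (MOUS.conjFun F T) v = cplx F (mmulMat T.conjTranspose v T) := by
  apply Complex.ext
  · rw [re_cplx, re_cplx]; rfl
  · rw [im_cplx, im_cplx, ← mmulMat_smul]; rfl

/-- The matrix representing `Z ↦ F (Z ⊗ 1)`. -/
def density {n : ℕ} (F : A.Mat n →ₗ[ℝ] ℝ) : Matrix (Fin n) (Fin n) ℂ := choi (cplx F) A.one

theorem cplx_scal {n : ℕ} (F : A.Mat n →ₗ[ℝ] ℝ) (Z : Matrix (Fin n) (Fin n) ℂ) :
    cplx F (A.scal n Z) = ∑ i, ∑ j, Z i j * density F i j := by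
  conv_lhs => rw [Matrix.matrix_eq_sum_single (A.scal n Z)]
  simp only [map_sum, density, choi, LinearMap.coe_mk, AddHom.coe_mk, Matrix.of_apply, scal_apply,
    ← Matrix.smul_single, map_smul, smul_eq_mul]

theorem density_conjFun {m n : ℕ} (F : A.Mat n →ₗ[ℝ] ℝ) (T : Matrix (Fin m) (Fin n) ℂ) :
    density (MOUS.conjFun F T) = T.map star * density F * T.transpose := by
  ext i j
  have h1 : (Matrix.single i j A.one : A.Mat m) = A.scal m (Matrix.single i j 1) := by
    ext k l
    simp [scal_apply, Matrix.single_apply, ite_smul]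
  have h2 : density (MOUS.conjFun F T) i j = cplx (MOUS.conjFun F T) (Matrix.single i j A.one) := rfl
  rw [h2, cplx_conjFun, h1, mmulMat_scal, cplx_scal]
  simp only [Matrix.mul_apply, Matrix.conjTranspose_apply, Matrix.single_apply, Matrix.map_apply,
    Matrix.transpose_apply, mul_ite, mul_one, mul_zero, ite_and, Finset.sum_ite_eq,
    Finset.mem_univ, if_true, ite_mul, zero_mul, Finset.sum_mul]
  rw [Finset.sum_comm]
  refine Finset.sum_congr rfl fun k _ => Finset.sum_congr rfl fun l _ => ?_
  ring

theorem IsPosFun.posDef_density {n : ℕ} {F : A.Mat n →ₗ[ℝ] ℝ} (hF : IsPosFun F) {δ : ℝ}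
    (hδ : 0 < δ) (h : ∀ Z : Matrix (Fin n) (Fin n) ℂ, Z.PosSemidef → δ * Z.trace.re ≤
      F (A.scal n Z)) : (density F).PosDef := by
  have herm : (density F).IsHermitian := by
    ext i j
    simp only [Matrix.conjTranspose_apply, density, choi, LinearMap.coe_mk, AddHom.coe_mk,
      Matrix.of_apply]
    rw [← hF.cplx_conjTranspose, Matrix.conjTranspose_single, star_one]
  have hre : ∀ x : Fin n → ℂ, star x ⬝ᵥ (density F).mulVec x =
      cplx F (A.scal n (Matrix.vecMulVec (star x) x)) := by
    intro x
    rw [cplx_scal]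
    simp only [dotProduct, Matrix.mulVec, Finset.mul_sum, Matrix.vecMulVec_apply]
    refine Finset.sum_congr rfl fun k _ => Finset.sum_congr rfl fun l _ => ?_
    ring
  have hb : ∀ x : Fin n → ℂ, δ * vecNormSq x ≤ (star x ⬝ᵥ (density F).mulVec x).re := by
    intro x
    rw [hre, re_cplx]
    refine le_of_eq_of_le ?_ (h _ ?_)
    · rw [Matrix.trace_vecMulVec, star_dotProduct_self]; simp
    · simpa using Matrix.posSemidef_vecMulVec_self_star (star x)
  have hpsd : (density F).PosSemidef := posSemidef_of_re_nonneg herm fun x =>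
    (mul_nonneg hδ.le (vecNormSq_nonneg x)).trans (hb x)
  refine Matrix.PosDef.of_dotProduct_mulVec_pos herm fun x hx => ?_
  refine lt_of_le_of_ne (hpsd.dotProduct_mulVec_nonneg x) fun h0 => hx ?_
  have h1 := hb x
  rw [← h0, Complex.zero_re] at h1
  have h2 : vecNormSq x = 0 := le_antisymm (nonpos_of_mul_nonpos_right h1 hδ) (vecNormSq_nonneg x)
  have h3 : star x ⬝ᵥ x = 0 := by rw [star_dotProduct_self, h2]; simp
  exact dotProduct_star_self_eq_zero.1 h3

end MOUS

namespace MOUS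

variable {A : MOUS} {L : ∀ n : ℕ, A.Mat n → ℝ}

theorem choi_conjFun_mem_CS {n : ℕ} {F : A.Mat n →ₗ[ℝ] ℝ} (hF : IsPosFun F)
    {R : Matrix (Fin n) (Fin n) ℂ} (hR : R.conjTranspose * density F * R = 1) :
    choi (cplx (MOUS.conjFun F R.transpose)) ∈ CS A n :=
  ⟨(density_conjFun F R.transpose).trans hR, fun _ _ hv =>
    (hF.conjFun R.transpose).posSemidef_mpair_choi hv⟩

theorem re_dotProduct_mpair_choi_conjFun {n r : ℕ} (F : A.Mat n →ₗ[ℝ] ℝ)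
    (T : Matrix (Fin n) (Fin n) ℂ) (a : A.Mat r) (x y : Fin r × Fin n → ℂ) :
    (star x ⬝ᵥ (mpair (choi (cplx (MOUS.conjFun F T))) a).mulVec y).re =
      F (mmulMat (unvec x * T).conjTranspose a (unvec y * T)) := by
  rw [dotProduct_mpair_choi, cplx_conjFun, re_cplx, mmulMat_mmulMat, Matrix.conjTranspose_mul]

theorem exists_states_of_dual {n : ℕ} {F₁ F₂ : A.Mat n →ₗ[ℝ] ℝ} (hF₁ : IsPosFun F₁)
    (hF₂ : IsPosFun F₂) (h1 : F₁ (A.unitMat n) = 1)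
    (hs : ∀ Z, F₁ (A.scal n Z) = F₂ (A.scal n Z)) {δ : ℝ} (hδ : 0 < δ)
    (hdef : ∀ Z : Matrix (Fin n) (Fin n) ℂ, Z.PosSemidef → δ * Z.trace.re ≤ F₁ (A.scal n Z))
    {κ : ℝ} (hκ : 0 ≤ κ)
    (hG : ∀ r (v : A.Mat r) (P : Matrix (Fin n) (Fin r) ℂ) (Q : Matrix (Fin r) (Fin n) ℂ),
      L r v ≤ 1 → F₁ (mmulMat P v Q) - F₂ (mmulMat P v Q) ≤
        κ * (F₁ (A.scal n (P * P.conjTranspose + Q.conjTranspose * Q)) / 2)) :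
    ∃ φ₁ ∈ CS A n, ∃ φ₂ ∈ CS A n, Dmet A L n φ₁ φ₂ ≤ κ ∧
      ∀ b, F₁ b - F₂ b ≤ scalarOpNorm (mpair φ₁ b - mpair φ₂ b) := by
  obtain ⟨R, K, hR, hK⟩ := (hF₁.posDef_density hδ hdef).exists_conjTranspose_mul_mul_eq_one
  have hd : density F₂ = density F₁ := by
    have : ∀ i j : Fin n, (Matrix.single i j A.one : A.Mat n) = A.scal n (Matrix.single i j 1) := by
      intro i j
      ext k l
      simp [scal_apply, Matrix.single_apply, ite_smul]
    ext i j
    simp only [density, choi, LinearMap.coe_mk, AddHom.coe_mk, Matrix.of_apply, this]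
    apply Complex.ext
    · rw [re_cplx, re_cplx, hs]
    · rw [im_cplx, im_cplx, ← map_smul, hs]
  set T := R.transpose with hT
  have hCS₁ := choi_conjFun_mem_CS hF₁ hR
  have hCS₂ := choi_conjFun_mem_CS hF₂ (hd ▸ hR)
  rw [← hT] at hCS₁ hCS₂
  set φ₁ := choi (cplx (MOUS.conjFun F₁ T))
  set φ₂ := choi (cplx (MOUS.conjFun F₂ T))
  have hsub : ∀ r (a : A.Mat r) x y,
      (star x ⬝ᵥ (mpair φ₁ a - mpair φ₂ a).mulVec y).re =
        F₁ (mmulMat (unvec x * T).conjTranspose a (unvec y * T)) -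
          F₂ (mmulMat (unvec x * T).conjTranspose a (unvec y * T)) := by
    intro r a x y
    rw [Matrix.sub_mulVec, dotProduct_sub, Complex.sub_re, re_dotProduct_mpair_choi_conjFun,
      re_dotProduct_mpair_choi_conjFun]
  have hnorm : ∀ r (x : Fin r × Fin n → ℂ),
      F₁ (A.scal n ((unvec x * T).conjTranspose * (unvec x * T))) = vecNormSq x := by
    intro r x
    have e : (unvec x * T).conjTranspose * (unvec x * T) =
        (unvec x * T).conjTranspose * (1 : Matrix (Fin r) (Fin r) ℂ) * (unvec x * T) := by
      rw [Matrix.mul_one]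
    rw [e, ← mmulMat_scal, ← re_dotProduct_mpair_choi_conjFun, mpair_scal hCS₁.1, ampl_one,
      Matrix.one_mulVec, star_dotProduct_self, Complex.ofReal_re]
  refine ⟨φ₁, hCS₁, φ₂, hCS₂, dmet_le hκ fun r a ha => scalarOpNorm_le_of_bilin hκ fun x y => ?_,
    fun b => ?_⟩
  · rw [hsub]
    refine (hG r a _ _ ha).trans_eq ?_
    rw [Matrix.conjTranspose_conjTranspose, map_add, map_add, hnorm, hnorm]
  · have hKT : K.transpose * T = 1 := by
      rw [mul_eq_one_comm, hT, ← Matrix.transpose_mul, hK, Matrix.transpose_one]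
    let x : Fin n × Fin n → ℂ := fun p => K.transpose p.1 p.2
    have hx : unvec x = K.transpose := rfl
    have h2 := hsub n b x x
    rw [hx, hKT, Matrix.conjTranspose_one, mmulMat_one] at h2
    have h3 := hnorm n x
    rw [hx, hKT, Matrix.conjTranspose_one, Matrix.one_mul, scal_one, h1] at h3
    rw [← h2]
    refine (re_quadForm_le _ _).trans_eq ?_
    rw [← h3, mul_one]

end MOUS

namespace MOUS

variable {A : MOUS} {L : ∀ n : ℕ, A.Mat n → ℝ}

/-- `w = P v Q` with `L v ≤ 1`, and `X = P Pᴴ + Qᴴ Q` controls the Lipschitz size of `w`. -/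
def LipFactor (L : ∀ n : ℕ, A.Mat n → ℝ) {n : ℕ} (X : Matrix (Fin n) (Fin n) ℂ) (w : A.Mat n) :
    Prop :=
  ∃ (r : ℕ) (v : A.Mat r) (P : Matrix (Fin n) (Fin r) ℂ) (Q : Matrix (Fin r) (Fin n) ℂ),
    L r v ≤ 1 ∧ X = P * P.conjTranspose + Q.conjTranspose * Q ∧ w = mmulMat P v Q

theorem LipFactor.zero (hL : IsMatrixLipschitzSeminorm A L) (n : ℕ) :
    LipFactor L (0 : Matrix (Fin n) (Fin n) ℂ) (0 : A.Mat n) := by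
  refine ⟨0, 0, 0, 0, by rw [hL.map_zero]; exact zero_le_one, by simp, ?_⟩
  ext i j
  simp [mmulMat_apply]

theorem LipFactor.add (hL : IsMatrixLipschitzSeminorm A L) {n : ℕ}
    {X X' : Matrix (Fin n) (Fin n) ℂ} {w w' : A.Mat n} (h : LipFactor L X w)
    (h' : LipFactor L X' w') : LipFactor L (X + X') (w + w') := by
  obtain ⟨r, v, P, Q, hv, rfl, rfl⟩ := h
  obtain ⟨r', v', P', Q', hv', rfl, rfl⟩ := h'
  refine ⟨r + r', dsumMat v v', rowCat P P', colCat Q Q', ?_, ?_, ?_⟩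
  · rw [hL.dsum_eq]
    exact max_le hv hv'
  · rw [conjTranspose_rowCat, conjTranspose_colCat, rowCat_mul_colCat, rowCat_mul_colCat]
    abel
  · rw [mmulMat_rowCat_dsumMat_colCat]

theorem LipFactor.smul {n : ℕ} {X : Matrix (Fin n) (Fin n) ℂ} {w : A.Mat n}
    (h : LipFactor L X w) {t : ℝ} (ht : 0 ≤ t) : LipFactor L (t • X) (t • w) := by
  obtain ⟨r, v, P, Q, hv, rfl, rfl⟩ := h
  have hs : ((√t : ℝ) : ℂ) * ((√t : ℝ) : ℂ) = (t : ℂ) := by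
    rw [← Complex.ofReal_mul, Real.mul_self_sqrt ht]
  refine ⟨r, v, ((√t : ℝ) : ℂ) • P, ((√t : ℝ) : ℂ) • Q, hv, ?_, ?_⟩
  · simp only [Matrix.conjTranspose_smul, Matrix.smul_mul, Matrix.mul_smul, smul_smul,
      Complex.star_def, Complex.conj_ofReal, hs, smul_add]
    rfl
  · rw [smul_mmulMat, hs]
    rfl

theorem LipFactor.posSemidef {n : ℕ} {X : Matrix (Fin n) (Fin n) ℂ} {w : A.Mat n}
    (h : LipFactor L X w) : X.PosSemidef := by
  obtain ⟨r, v, P, Q, hv, rfl, rfl⟩ := h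
  exact (Matrix.posSemidef_self_mul_conjTranspose P).add
    (Matrix.posSemidef_conjTranspose_mul_self Q)

theorem LipFactor.le (hL : IsMatrixLipschitzSeminorm A L) {n : ℕ} {X : Matrix (Fin n) (Fin n) ℂ}
    {w : A.Mat n} (h : LipFactor L X w) {t : ℝ} (ht : 0 ≤ t)
    (hX : ((t : ℂ) • (1 : Matrix (Fin n) (Fin n) ℂ) - X).PosSemidef) :
    L n (w + w.conjTranspose) ≤ t := by
  have hXp := h.posSemidef
  obtain ⟨r, v, P, Q, hv, rfl, rfl⟩ := h
  have key := scalarOpNorm_le_of_posSemidef ht hXp hX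
  rw [conjTranspose_mmulMat, ← mmulMat_rowCat_dsumMat_colCat]
  have h1 : scalarOpNorm (rowCat P Q.conjTranspose) ^ 2 ≤ t := by
    rw [← scalarOpNorm_conjTranspose, sq, ← scalarOpNorm_conjTranspose_mul_self,
      Matrix.conjTranspose_conjTranspose, conjTranspose_rowCat, rowCat_mul_colCat,
      Matrix.conjTranspose_conjTranspose]
    exact key
  have h2 : scalarOpNorm (colCat Q P.conjTranspose) ^ 2 ≤ t := by
    rw [sq, ← scalarOpNorm_conjTranspose_mul_self, conjTranspose_colCat, rowCat_mul_colCat,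
      Matrix.conjTranspose_conjTranspose, add_comm]
    exact key
  refine (hL.mmul_le _ _ _ _ _).trans ?_
  have h3 : L (r + r) (dsumMat v v.conjTranspose) ≤ 1 := by
    rw [hL.dsum_eq, hL.star_eq, max_self]
    exact hv
  have h4 := scalarOpNorm_nonneg (rowCat P Q.conjTranspose)
  have h5 := scalarOpNorm_nonneg (colCat Q P.conjTranspose)
  have h6 := hL.nonneg (r + r) (dsumMat v v.conjTranspose)
  calc _ ≤ scalarOpNorm (rowCat P Q.conjTranspose) * 1 *
        scalarOpNorm (colCat Q P.conjTranspose) := by gcongr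
    _ ≤ t := by nlinarith [sq_nonneg (scalarOpNorm (rowCat P Q.conjTranspose) -
        scalarOpNorm (colCat Q P.conjTranspose))]

/-- The convex cone whose dual encodes pairs of functionals that are close for `Dmet`. -/
def lipCone (hL : IsMatrixLipschitzSeminorm A L) (n : ℕ) (δ κ : ℝ) :
    PointedCone ℝ (A.Mat n × A.Mat n) where
  carrier := {p | ∃ X w Y α, LipFactor L X w ∧ Y.IsHermitian ∧
    (Y + ((δ : ℂ) * Y.trace) • (1 : Matrix (Fin n) (Fin n) ℂ)).PosSemidef ∧
    p.1 - A.scal n α - κ • A.scal n (Y + X) + w ∈ A.accretive n ∧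
    p.2 + A.scal n α - w ∈ A.accretive n}
  add_mem' := by
    rintro p p' ⟨X, w, Y, α, hw, hY, hY', h1, h2⟩ ⟨X', w', Y', α', kw, kY, kY', k1, k2⟩
    refine ⟨X + X', w + w', Y + Y', α + α', hw.add hL kw, hY.add kY, ?_, ?_, ?_⟩
    · convert hY'.add kY' using 1
      rw [Matrix.trace_add, mul_add, add_smul]
      abel
    · convert Submodule.add_mem _ h1 k1 using 1
      simp only [Prod.fst_add, map_add, smul_add]
      abel
    · convert Submodule.add_mem _ h2 k2 using 1
      simp only [Prod.snd_add, map_add]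
      abel
  zero_mem' := ⟨0, 0, 0, 0, LipFactor.zero hL n, Matrix.isHermitian_zero,
    by simpa using Matrix.PosSemidef.zero, by simp, by simp⟩
  smul_mem' := by
    rintro ⟨t, ht⟩ p ⟨X, w, Y, α, hw, hY, hY', h1, h2⟩
    refine ⟨t • X, t • w, t • Y, t • α, hw.smul ht, ?_, ?_, ?_, ?_⟩
    · rw [Matrix.IsHermitian, Matrix.conjTranspose_smul, hY.eq, star_trivial]
    · convert hY'.smul (show (0 : ℂ) ≤ (t : ℂ) by exact_mod_cast ht) using 1
      rw [Matrix.trace_smul, smul_add, smul_smul, Complex.real_smul]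
      congr 1
      congr 1
      ring
    · convert Submodule.smul_mem _ (⟨t, ht⟩ : {c : ℝ // 0 ≤ c}) h1 using 1
      simp only [Nonneg.mk_smul, Prod.smul_fst, ← smul_add, LinearMap.map_smul_of_tower,
        smul_comm κ t, ← smul_sub]
    · convert Submodule.smul_mem _ (⟨t, ht⟩ : {c : ℝ // 0 ≤ c}) h2 using 1
      simp only [Nonneg.mk_smul, Prod.smul_snd, ← smul_add, LinearMap.map_smul_of_tower,
        ← smul_sub]

theorem mem_lipCone {hL : IsMatrixLipschitzSeminorm A L} {n : ℕ} {δ κ : ℝ}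
    {p : A.Mat n × A.Mat n} : p ∈ lipCone hL n δ κ ↔ ∃ X w Y α, LipFactor L X w ∧ Y.IsHermitian ∧
    (Y + ((δ : ℂ) * Y.trace) • (1 : Matrix (Fin n) (Fin n) ℂ)).PosSemidef ∧
    p.1 - A.scal n α - κ • A.scal n (Y + X) + w ∈ A.accretive n ∧
    p.2 + A.scal n α - w ∈ A.accretive n := Iff.rfl

end MOUS

namespace MOUS

variable {A : MOUS} {L : ∀ n : ℕ, A.Mat n → ℝ}

theorem exists_approx_of_mem_lipCone (hL : IsMatrixLipschitzSeminorm A L) (hne : A.one ≠ 0) {n : ℕ}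
    {b : A.Mat n} (hb : b.conjTranspose = b) {t δ κ : ℝ} (ht : 0 ≤ t) (hδ : 0 ≤ δ) (hκ : 0 < κ)
    (h : ((κ * t) • A.unitMat n - b, b) ∈ lipCone hL n δ κ) :
    ∃ b', L n b' ≤ t * (1 + δ * n) / 2 ∧
      ∀ k, ∀ φ ∈ CS A k, scalarOpNorm (mpair φ (b - b')) ≤ κ * (t * (1 + δ * n)) := by
  obtain ⟨X, w, Y, α, hw, hY, hY', h1, h2⟩ := mem_lipCone.1 h
  have hX := hw.posSemidef
  set s := t * (1 + δ * n) with hs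
  have hs0 : 0 ≤ s := by positivity
  set M : Matrix (Fin n) (Fin n) ℂ := (t : ℂ) • 1 - (Y + X) with hM
  set D : A.Mat n := (2 : ℂ) • b + A.scal n (α + α.conjTranspose) - (w + w.conjTranspose) with hD
  have hDpos : D ∈ A.pos n := by
    rw [mem_accretive] at h2
    convert h2 using 1
    simp only [Matrix.conjTranspose_sub, Matrix.conjTranspose_add, hb, conjTranspose_scal, hD,
      map_add, two_smul]
    abel
  have hu : (A.unitMat n).conjTranspose = A.unitMat n := A.pos_star n _ (A.unit_pos n)
  have hMD : A.scal n (((2 * κ : ℝ) : ℂ) • M) - D ∈ A.pos n := by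
    rw [mem_accretive] at h1
    convert h1 using 1
    have e1 : ((κ * t) • A.unitMat n).conjTranspose = (κ * t) • A.unitMat n := by
      rw [Matrix.conjTranspose_smul, hu, star_trivial]
    have e2 : (κ • A.scal n (Y + X)).conjTranspose = κ • A.scal n (Y + X) := by
      rw [Matrix.conjTranspose_smul, conjTranspose_scal, star_trivial,
        (hY.add hX.isHermitian).eq]
    simp only [Matrix.conjTranspose_sub, Matrix.conjTranspose_add, hb, conjTranspose_scal, hD,
      two_smul, e1, e2, hM]
    have e3 : A.scal n (((2 * κ : ℝ) : ℂ) • ((t : ℂ) • (1 : Matrix (Fin n) (Fin n) ℂ) - (Y + X))) =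
        (2 * κ * t) • A.unitMat n - (2 * κ) • A.scal n (Y + X) := by
      rw [map_smul, map_sub, map_smul, scal_one, smul_sub, smul_smul, ← Complex.ofReal_mul]
      rfl
    rw [e3, mul_assoc, two_mul, two_mul, add_smul, add_smul, (A.scal n).map_add α]
    abel
  have hMpsd : M.PosSemidef := by
    have h3 := A.pos_add n _ hMD _ hDpos
    rw [sub_add_cancel] at h3
    have h4 := (posSemidef_of_scal_mem_pos hne h3).smul
      (show (0 : ℂ) ≤ (((2 * κ)⁻¹ : ℝ) : ℂ) by exact_mod_cast (by positivity))
    rwa [smul_smul, ← Complex.ofReal_mul, inv_mul_cancel₀ (by positivity), Complex.ofReal_one,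
      one_smul] at h4
  have hB : (Y + ((δ * (n * t) : ℝ) : ℂ) • (1 : Matrix (Fin n) (Fin n) ℂ)).PosSemidef := by
    have h5 : (0 : ℂ) ≤ (δ : ℂ) * (M.trace + X.trace) :=
      mul_nonneg (by exact_mod_cast hδ) (add_nonneg hMpsd.trace_nonneg hX.trace_nonneg)
    convert hY'.add (Matrix.PosSemidef.one.smul h5) using 1
    rw [add_assoc, ← add_smul, ← mul_add]
    congr 2
    simp only [hM, Matrix.trace_sub, Matrix.trace_add, Matrix.trace_smul, Matrix.trace_one,
      Fintype.card_fin, smul_eq_mul]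
    push_cast
    ring
  have hXs : ((s : ℂ) • (1 : Matrix (Fin n) (Fin n) ℂ) - X).PosSemidef := by
    convert hMpsd.add hB using 1
    rw [hM, hs, show t * (1 + δ * n) = t + δ * (n * t) by ring, Complex.ofReal_add, add_smul]
    abel
  refine ⟨(1 / 2 : ℂ) • (w + w.conjTranspose - A.scal n (α + α.conjTranspose)), ?_,
    fun k φ hφ => ?_⟩
  · have h6 := hw.le hL hs0 hXs
    have h7 : L n (A.scal n (-(α + α.conjTranspose))) = 0 := (hL.null_iff n _).2 ⟨_, rfl⟩
    have h8 := hL.add_le n (w + w.conjTranspose) (A.scal n (-(α + α.conjTranspose)))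
    rw [map_neg, ← sub_eq_add_neg, ← map_neg, h7] at h8
    rw [hL.smul_eq, show ‖(1 / 2 : ℂ)‖ = 1 / 2 by norm_num]
    linarith
  · have e : b - (1 / 2 : ℂ) • (w + w.conjTranspose - A.scal n (α + α.conjTranspose)) =
        (1 / 2 : ℂ) • D := by
      rw [hD]
      module
    rw [e, mpair_smul, scalarOpNorm_smul]
    have h9 : A.scal n (((2 * κ * s : ℝ) : ℂ) • 1) - D ∈ A.pos n := by
      have h10 := (hX.add hB).smul (show (0 : ℂ) ≤ ((2 * κ : ℝ) : ℂ) by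
        exact_mod_cast (by positivity))
      convert A.pos_add n _ hMD _ (scal_mem_pos h10) using 1
      rw [sub_add_eq_add_sub, ← map_add, ← smul_add]
      congr 2
      rw [hM, hs, Complex.ofReal_mul, mul_smul, show t * (1 + δ * n) = t + δ * (n * t) by ring,
        Complex.ofReal_add, add_smul]
      congr 1
      abel
    have h11 := hφ.2 n _ h9
    rw [mpair_sub, map_smul, mpair_smul, mpair_scal hφ.1, ampl_one] at h11
    have h12 := scalarOpNorm_le_of_posSemidef (by positivity) (hφ.2 n _ hDpos) h11
    norm_num
    linarith

theorem exists_states_of_notMem_lipCone (hL : IsMatrixLipschitzSeminorm A L) {n : ℕ}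
    {b : A.Mat n} {t δ κ : ℝ} (hδ : 0 < δ) (hκ : 0 < κ)
    (h : ((κ * t) • A.unitMat n - b, b) ∉ lipCone hL n δ κ) :
    ∃ φ₁ ∈ CS A n, ∃ φ₂ ∈ CS A n, Dmet A L n φ₁ φ₂ ≤ 2 * κ ∧
      κ * t ≤ scalarOpNorm (mpair φ₁ b - mpair φ₂ b) := by
  have hacc₁ : ∀ v ∈ A.accretive n, (v, (0 : A.Mat n)) ∈ lipCone hL n δ κ := fun v hv =>
    mem_lipCone.2 ⟨0, 0, 0, 0, LipFactor.zero hL n, Matrix.isHermitian_zero,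
      by simpa using Matrix.PosSemidef.zero, by simpa using hv, by simp⟩
  have hacc₂ : ∀ v ∈ A.accretive n, ((0 : A.Mat n), v) ∈ lipCone hL n δ κ := fun v hv =>
    mem_lipCone.2 ⟨0, 0, 0, 0, LipFactor.zero hL n, Matrix.isHermitian_zero,
      by simpa using Matrix.PosSemidef.zero, by simp, by simpa using hv⟩
  have hscal : ∀ α, (A.scal n α, -A.scal n α) ∈ lipCone hL n δ κ := fun α =>
    mem_lipCone.2 ⟨0, 0, 0, α, LipFactor.zero hL n, Matrix.isHermitian_zero,
      by simpa using Matrix.PosSemidef.zero, by simp, by simp⟩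
  have hfac : ∀ X w, LipFactor L X w → (κ • A.scal n X - w, w) ∈ lipCone hL n δ κ :=
    fun X w hw => mem_lipCone.2 ⟨X, w, 0, 0, hw, Matrix.isHermitian_zero,
      by simpa using Matrix.PosSemidef.zero, by simp, by simp⟩
  have hY : ∀ Y : Matrix (Fin n) (Fin n) ℂ, Y.IsHermitian →
      (Y + ((δ : ℂ) * Y.trace) • (1 : Matrix (Fin n) (Fin n) ℂ)).PosSemidef →
      (κ • A.scal n Y, (0 : A.Mat n)) ∈ lipCone hL n δ κ :=
    fun Y hY hY' => mem_lipCone.2 ⟨0, 0, Y, 0, LipFactor.zero hL n, hY, hY', by simp, by simp⟩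
  obtain ⟨g, hg, hg1, hgb⟩ := PointedCone.exists_functional_nonpos (lipCone hL n δ κ)
    (hacc₁ _ (unitMat_mem_accretive n)) (fun ⟨y, z⟩ => by
      obtain ⟨t₁, h1⟩ := exists_smul_unitMat_add_mem_accretive y
      obtain ⟨t₂, h2⟩ := exists_smul_unitMat_add_mem_accretive z
      refine ⟨t₁ + t₂, ?_⟩
      convert add_mem (add_mem (hacc₁ _ h1) (hacc₂ _ h2)) (hscal ((t₂ : ℂ) • 1)) using 1
      have e : A.scal n ((t₂ : ℂ) • 1) = t₂ • A.unitMat n := by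
        rw [map_smul, scal_one]
        rfl
      rw [e]
      ext : 1 <;> simp [add_smul]
      abel) h
  let F₁ := g ∘ₗ LinearMap.inl ℝ (A.Mat n) (A.Mat n)
  let F₂ := g ∘ₗ LinearMap.inr ℝ (A.Mat n) (A.Mat n)
  have hgF : ∀ y z, g (y, z) = F₁ y + F₂ z := by
    intro y z
    simp only [F₁, F₂, LinearMap.comp_apply, LinearMap.inl_apply, LinearMap.inr_apply, ← map_add]
    simp
  have hF₁ : IsPosFun F₁ := fun v hv => hg _ (hacc₁ v hv)
  have hF₂ : IsPosFun F₂ := fun v hv => hg _ (hacc₂ v hv)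
  have h1 : F₁ (A.unitMat n) = 1 := hg1
  have hs : ∀ Z, F₁ (A.scal n Z) = F₂ (A.scal n Z) := by
    intro Z
    have h2 := hg _ (hscal Z)
    have h3 := hg _ (hscal (-Z))
    rw [hgF, map_neg] at h2 h3
    rw [map_neg, map_neg, map_neg, neg_neg] at h3
    linarith
  have hdef : ∀ Z : Matrix (Fin n) (Fin n) ℂ, Z.PosSemidef →
      δ / (1 + n * δ) * Z.trace.re ≤ F₁ (A.scal n Z) := by
    intro Z hZ
    have hnδ : (0 : ℝ) < 1 + n * δ := by positivity
    have htr : Z.trace = (Z.trace.re : ℂ) :=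
      (Complex.eq_re_of_ofReal_le (r := 0) (by simpa using hZ.trace_nonneg))
    set τ := Z.trace.re
    set e := δ / (1 + n * δ) with he
    have h2 := hg _ (hY (Z - ((e * τ : ℝ) : ℂ) • 1) (hZ.isHermitian.sub (by
      rw [Matrix.IsHermitian, Matrix.conjTranspose_smul, Matrix.conjTranspose_one,
        Complex.star_def, Complex.conj_ofReal])) (by
      convert hZ using 1
      rw [Matrix.trace_sub, Matrix.trace_smul, Matrix.trace_one, htr, sub_add_eq_add_sub,
        sub_eq_iff_eq_add]
      congr 2
      simp only [Fintype.card_fin, smul_eq_mul]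
      norm_cast
      rw [he]
      field_simp
      ring))
    rw [hgF, map_smul, map_sub, map_sub, map_zero, add_zero, map_smul, scal_one] at h2
    have h3 : F₁ (((e * τ : ℝ) : ℂ) • A.unitMat n) = e * τ := by
      have : ((e * τ : ℝ) : ℂ) • A.unitMat n = (e * τ) • A.unitMat n := rfl
      rw [this, map_smul, h1, smul_eq_mul, mul_one]
    rw [h3, smul_eq_mul] at h2
    have := nonneg_of_mul_nonneg_right h2 hκ
    linarith
  have hG : ∀ r (v : A.Mat r) (P : Matrix (Fin n) (Fin r) ℂ) (Q : Matrix (Fin r) (Fin n) ℂ),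
      L r v ≤ 1 → F₁ (mmulMat P v Q) - F₂ (mmulMat P v Q) ≤
        2 * κ * (F₁ (A.scal n (P * P.conjTranspose + Q.conjTranspose * Q)) / 2) := by
    intro r v P Q hv
    have h2 := hg _ (hfac _ _ ⟨r, v, P, Q, hv, rfl, rfl⟩)
    rw [hgF, map_sub, map_smul, smul_eq_mul] at h2
    linarith
  obtain ⟨φ₁, hφ₁, φ₂, hφ₂, hd, hle⟩ := exists_states_of_dual hF₁ hF₂ h1 hs
    (by positivity) hdef (by positivity) hG
  refine ⟨φ₁, hφ₁, φ₂, hφ₂, hd, le_trans ?_ (hle b)⟩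
  rw [hgF, map_sub, map_smul, h1, smul_eq_mul, mul_one] at hgb
  linarith

/-- A hermitian element which is `c`-Lipschitz for the matrix metric is a limit of elements with
Lipschitz seminorm close to `c`. -/
theorem exists_approx_of_isHermitian (hL : IsMatrixLipschitzSeminorm A L) (hne : A.one ≠ 0) {n : ℕ}
    {b : A.Mat n} (hb : b.conjTranspose = b) {c : ℝ} (hc : 0 ≤ c)
    (hlip : ∀ φ ∈ CS A n, ∀ ψ ∈ CS A n,
      scalarOpNorm (mpair φ b - mpair ψ b) ≤ c * Dmet A L n φ ψ) {η : ℝ} (hη : 0 < η) :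
    ∃ b', L n b' ≤ c + η ∧ ∀ k, ∀ φ ∈ CS A k, scalarOpNorm (mpair φ (b - b')) ≤ η := by
  set t := 2 * c + η with ht
  have ht0 : 0 < t := by positivity
  set δ := η / (t * n + 1) with hδ
  have hδ0 : 0 < δ := by positivity
  set κ := η / (2 * (c + η)) with hκ
  have hκ0 : 0 < κ := by positivity
  have hbound : t * (1 + δ * n) / 2 ≤ c + η := by
    have : t * δ * n ≤ η := by
      rw [hδ, mul_div_assoc', div_mul_eq_mul_div, div_le_iff₀ (by positivity)]
      nlinarith
    nlinarith
  by_cases h : ((κ * t) • A.unitMat n - b, b) ∈ lipCone hL n δ κ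
  · obtain ⟨b', h1, h2⟩ := exists_approx_of_mem_lipCone hL hne hb ht0.le hδ0.le hκ0 h
    refine ⟨b', h1.trans hbound, fun k φ hφ => (h2 k φ hφ).trans ?_⟩
    calc κ * (t * (1 + δ * n)) ≤ κ * (2 * (c + η)) :=
          mul_le_mul_of_nonneg_left (by linarith) hκ0.le
      _ = η := by rw [hκ]; field_simp
  · obtain ⟨φ₁, hφ₁, φ₂, hφ₂, hd, hle⟩ := exists_states_of_notMem_lipCone hL hδ0 hκ0 h
    have h1 := hle.trans (hlip φ₁ hφ₁ φ₂ hφ₂)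
    have h2 : c * Dmet A L n φ₁ φ₂ ≤ c * (2 * κ) := by gcongr
    nlinarith [mul_pos hκ0 hη]

end MOUS

section Corner

variable (n : ℕ)

/-- The isometry onto the first `n` coordinates. -/
def inlMat : Matrix (Fin (n + n)) (Fin n) ℂ := colCat 1 0

/-- The isometry onto the last `n` coordinates. -/
def inrMat : Matrix (Fin (n + n)) (Fin n) ℂ := colCat 0 1

theorem conjTranspose_inlMat : (inlMat n).conjTranspose = rowCat 1 0 := by
  simp [inlMat, conjTranspose_colCat]

theorem conjTranspose_inrMat : (inrMat n).conjTranspose = rowCat 0 1 := by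
  simp [inrMat, conjTranspose_colCat]

theorem inlMat_mul_add_inrMat_mul :
    inlMat n * (inlMat n).conjTranspose + inrMat n * (inrMat n).conjTranspose = 1 := by
  ext i j
  obtain ⟨i, rfl⟩ := finSumFinEquiv.surjective i
  obtain ⟨j, rfl⟩ := finSumFinEquiv.surjective j
  rw [conjTranspose_inlMat, conjTranspose_inrMat]
  rcases i with i | i <;> rcases j with j | j <;>
    simp [Matrix.mul_apply, inlMat, inrMat, rowCat, colCat, Matrix.one_apply,
      -finSumFinEquiv_apply_left, -finSumFinEquiv_apply_right]

theorem scalarOpNorm_le_one_of_conjTranspose_mul {m k : ℕ} {γ : Matrix (Fin m) (Fin k) ℂ}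
    (h : γ.conjTranspose * γ = 1) : scalarOpNorm γ ≤ 1 := by
  have h1 := scalarOpNorm_conjTranspose_mul_self γ
  rw [h] at h1
  have h2 := scalarOpNorm_one_le (m := Fin k)
  nlinarith [scalarOpNorm_nonneg γ]

end Corner

/-- An element of a quantized metric space is a limit of elements whose Lipschitz seminorm is close
to the Lipschitz constant for the matrix metric. -/
theorem IsClosureOf.exists_approx {A W : MOUS} {L : ∀ n : ℕ, A.Mat n → ℝ}
    {Lc : ∀ n : ℕ, W.Mat n → ℝ} {j : A.carrier →ₗ[ℂ] W.carrier} (hW : IsClosureOf A L W Lc j)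
    (hL : IsMatrixLipNorm A L) (hne : A.one ≠ 0) {n : ℕ} (b : A.Mat n) {η : ℝ} (hη : 0 < η) :
    ∃ b', L n b' ≤ LfromD A L n b + η ∧
      ∀ k, ∀ φ ∈ CS A k, scalarOpNorm (mpair φ (b - b')) ≤ η := by
  set e₁ := inlMat n with he₁
  set e₂ := inrMat n with he₂
  have h11 : e₁.conjTranspose * e₁ = 1 := by
    rw [he₁, conjTranspose_inlMat, inlMat, rowCat_mul_colCat]; simp
  have h12 : e₁.conjTranspose * e₂ = 0 := by
    rw [he₁, he₂, conjTranspose_inlMat, inrMat, rowCat_mul_colCat]; simp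
  have h22 : e₂.conjTranspose * e₂ = 1 := by
    rw [he₂, conjTranspose_inrMat, inrMat, rowCat_mul_colCat]; simp
  have hsum : e₁ * e₁.conjTranspose + e₂ * e₂.conjTranspose = 1 := inlMat_mul_add_inrMat_mul n
  have n1 : scalarOpNorm e₁.conjTranspose ≤ 1 := by
    rw [scalarOpNorm_conjTranspose]
    exact scalarOpNorm_le_one_of_conjTranspose_mul h11
  have n2 : scalarOpNorm e₂ ≤ 1 := scalarOpNorm_le_one_of_conjTranspose_mul h22
  have n3 : scalarOpNorm (rowCat e₁ e₂) ≤ 1 := by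
    rw [← scalarOpNorm_conjTranspose]
    refine scalarOpNorm_le_one_of_conjTranspose_mul ?_
    rw [Matrix.conjTranspose_conjTranspose, conjTranspose_rowCat, rowCat_mul_colCat, hsum]
  have n4 : scalarOpNorm (colCat e₂.conjTranspose e₁.conjTranspose) ≤ 1 := by
    refine scalarOpNorm_le_one_of_conjTranspose_mul ?_
    rw [conjTranspose_colCat, Matrix.conjTranspose_conjTranspose,
      Matrix.conjTranspose_conjTranspose, rowCat_mul_colCat]
    exact (add_comm _ _).trans hsum
  set b₂ : A.Mat (n + n) := mmulMat e₁ b e₂.conjTranspose +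
    mmulMat e₂ b.conjTranspose e₁.conjTranspose with hb₂
  have hb : b₂.conjTranspose = b₂ := by
    rw [hb₂, Matrix.conjTranspose_add, conjTranspose_mmulMat, conjTranspose_mmulMat]
    simp only [Matrix.conjTranspose_conjTranspose]
    exact add_comm _ _
  have hc : LfromD A L (n + n) b₂ ≤ LfromD A L n b := by
    rw [← hW.extends_eq, ← hW.extends_eq, hb₂, ← mmulMat_rowCat_dsumMat_colCat, mapMat_mmulMat,
      mapMat_dsumMat, hW.ucp.mapMat_conjTranspose]
    refine (hW.lip.mmul_le _ _ _ _ _).trans ?_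
    rw [hW.lip.dsum_eq, hW.lip.star_eq, max_self]
    have h0 := hW.lip.nonneg n (mapMat j b)
    calc _ ≤ 1 * Lc n (mapMat j b) * 1 := by
          gcongr
          exact scalarOpNorm_nonneg _
      _ = _ := by ring
  have hc0 : 0 ≤ LfromD A L n b := by
    rw [← hW.extends_eq]
    exact hW.lip.nonneg _ _
  obtain ⟨b', h1, h2⟩ := MOUS.exists_approx_of_isHermitian hL.toIsMatrixLipschitzSeminorm hne hb hc0
    (fun φ hφ ψ hψ => (hL.le_lfromD_mul hφ hψ b₂).trans
      (mul_le_mul_of_nonneg_right hc (dmet_nonneg _ _ _))) hη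
  refine ⟨mmulMat e₁.conjTranspose b' e₂, ?_, fun k φ hφ => ?_⟩
  · refine ((hL.mmul_le _ _ _ _ _).trans ?_).trans h1
    have h0 := hL.nonneg _ b'
    calc _ ≤ 1 * L (n + n) b' * 1 := by
          gcongr
          exact scalarOpNorm_nonneg _
      _ = _ := by ring
  · have e : b - mmulMat e₁.conjTranspose b' e₂ = mmulMat e₁.conjTranspose (b₂ - b') e₂ := by
      have : mmulMat e₁.conjTranspose b₂ e₂ = b := by
        have h21 : e₂.conjTranspose * e₁ = 0 := by
          rw [← Matrix.conjTranspose_conjTranspose e₁, ← Matrix.conjTranspose_mul, h12,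
            Matrix.conjTranspose_zero]
        rw [hb₂, mmulMat_add, mmulMat_mmulMat, mmulMat_mmulMat, h11, h22, h12, mmulMat_one]
        ext; simp [mmulMat_apply]
      rw [sub_eq_add_neg b₂, mmulMat_add, this, ← neg_one_smul ℂ b', mmulMat_smul, neg_one_smul,
        sub_eq_add_neg]
    rw [e, mpair_mmulMat]
    refine (scalarOpNorm_mul_le _ _).trans ?_
    have h3 := scalarOpNorm_mul_le (ampl k e₁.conjTranspose) (mpair φ (b₂ - b'))
    have h4 := (scalarOpNorm_ampl_le (n := k) e₁.conjTranspose).trans n1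
    have h5 := (scalarOpNorm_ampl_le (n := k) e₂).trans n2
    have h6 := h2 k φ hφ
    have h7 := scalarOpNorm_nonneg (mpair φ (b₂ - b'))
    calc _ ≤ 1 * scalarOpNorm (mpair φ (b₂ - b')) * 1 := by
          gcongr
          · exact scalarOpNorm_nonneg _
          · exact h3.trans (mul_le_mul_of_nonneg_right h4 h7)
      _ ≤ η := by linarith

theorem mapMat_sub {V W : Type} [AddCommGroup V] [AddCommGroup W] [Module ℂ V] [Module ℂ W]
    (φ : V →ₗ[ℂ] W) {n : ℕ} (a b : Matrix (Fin n) (Fin n) V) :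
    mapMat φ (a - b) = mapMat φ a - mapMat φ b := by
  ext i j
  simp [mapMat_apply]

theorem IsCompleteOrderIso.isUCP {A B : MOUS} {Φ : A.carrier →ₗ[ℂ] B.carrier}
    (hΦ : IsCompleteOrderIso A B Φ) : IsUCP A B Φ :=
  ⟨hΦ.unital, fun n v hv => (hΦ.ordIso n v).2 hv⟩

theorem IsUCP.mapMat_normBlock {A B : MOUS} {f : A.carrier →ₗ[ℂ] B.carrier} (hf : IsUCP A B f)
    {n : ℕ} (t : ℝ) (v : A.Mat n) :
    mapMat f (MOUS.normBlock t v) = MOUS.normBlock t (mapMat f v) := by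
  have hu : ∀ i j, f (A.unitMat n i j) = B.unitMat n i j := by
    intro i j
    by_cases h : i = j <;> simp [MOUS.unitMat, h, hf.unital]
  ext i j
  simp only [mapMat_apply, MOUS.normBlock, Matrix.reindex_apply, Matrix.submatrix_apply]
  rcases finSumFinEquiv.symm i with i | i <;> rcases finSumFinEquiv.symm j with j | j <;>
    simp [mapMat_apply, hu, hf.map_star]

theorem IsCompleteOrderIso.matNorm_mapMat {A B : MOUS} {Φ : A.carrier →ₗ[ℂ] B.carrier}
    (hΦ : IsCompleteOrderIso A B Φ) {n : ℕ} (v : A.Mat n) :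
    B.matNorm (mapMat Φ v) = A.matNorm v := by
  change sInf {t : ℝ | MOUS.normBlock t (mapMat Φ v) ∈ B.pos (n + n)} =
    sInf {t : ℝ | MOUS.normBlock t v ∈ A.pos (n + n)}
  simp only [← hΦ.isUCP.mapMat_normBlock, hΦ.ordIso]

/-- A closed quantized metric space may be replaced by a completely isometric one. -/
theorem IsClosureOf.comp_iso {A W W' : MOUS} {L : ∀ n : ℕ, A.Mat n → ℝ}
    {Lc : ∀ n : ℕ, W.Mat n → ℝ} {Lc' : ∀ n : ℕ, W'.Mat n → ℝ} {j : A.carrier →ₗ[ℂ] W.carrier}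
    {Φ : W.carrier →ₗ[ℂ] W'.carrier} (h : IsClosureOf A L W Lc j) (hΦ : IsCompleteOrderIso W W' Φ)
    (hiso : ∀ n (a : W.Mat n), Lc n a = Lc' n (mapMat Φ a)) (hlip : IsMatrixLipNorm W' Lc')
    (hclosed : IsClosedLip W' Lc') : IsClosureOf A L W' Lc' (Φ ∘ₗ j) where
  ucp := ⟨by rw [LinearMap.comp_apply, h.ucp.unital, hΦ.unital],
    fun n v hv => (hΦ.ordIso n _).2 (h.ucp.cp n v hv)⟩
  inj := hΦ.bij.1.comp h.inj
  ordEmb n a := (hΦ.ordIso n (mapMat j a)).trans (h.ordEmb n a)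
  lip := hlip
  closed := hclosed
  extends_eq n a := (hiso n (mapMat j a)).symm.trans (h.extends_eq n a)
  dense n w ε hε := by
    choose g hg using hΦ.bij.2
    obtain ⟨a, h1, h2⟩ := h.dense n (Matrix.of fun i k => g (w i k)) ε hε
    have hw : mapMat Φ (Matrix.of fun i k => g (w i k)) = w := by
      ext i k
      simp [mapMat_apply, hg]
    refine ⟨a, ?_, ?_⟩
    · rw [hiso, hiso, hw] at h1
      exact h1
    · rw [← hΦ.matNorm_mapMat, mapMat_sub, hw] at h2
      exact h2

/-- Two quantized metric spaces with a common closure contain approximately the same elements. -/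
theorem IsClosureOf.exists_close {A₁ A₂ W : MOUS} {L₁ : ∀ n : ℕ, A₁.Mat n → ℝ}
    {L₂ : ∀ n : ℕ, A₂.Mat n → ℝ} {Lc : ∀ n : ℕ, W.Mat n → ℝ} {i₁ : A₁.carrier →ₗ[ℂ] W.carrier}
    {i₂ : A₂.carrier →ₗ[ℂ] W.carrier} (h₁ : IsClosureOf A₁ L₁ W Lc i₁)
    (h₂ : IsClosureOf A₂ L₂ W Lc i₂) (hL₁ : IsMatrixLipNorm A₁ L₁) (hL₂ : IsMatrixLipNorm A₂ L₂)
    (hne : A₂.one ≠ 0) {n : ℕ} (a : A₁.Mat n) {η : ℝ} (hη : 0 < η) :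
    ∃ b, L₂ n b ≤ L₁ n a + η ∧
      ∀ k, ∀ φ ∈ CS W k, scalarOpNorm (mpair φ (mapMat i₁ a - mapMat i₂ b)) ≤ η := by
  obtain ⟨b', h3, h4⟩ := h₂.dense n (mapMat i₁ a) (η / 2) (half_pos hη)
  rw [h₂.extends_eq, h₁.extends_eq] at h3
  obtain ⟨b, h5, h6⟩ := h₂.exists_approx hL₂ hne b' (half_pos hη)
  refine ⟨b, by linarith [hL₁.lfromD_le a], fun k φ hφ => ?_⟩
  have h7 := (CS.scalarOpNorm_mpair_lt hφ (half_pos hη) h4).le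
  have h8 := h6 k _ (CS.comp h₂.ucp hφ)
  rw [mpair_comp, mapMat_sub] at h8
  have e : mapMat i₁ a - mapMat i₂ b =
      (mapMat i₁ a - mapMat i₂ b') + (mapMat i₂ b' - mapMat i₂ b) := by abel
  rw [e, mpair_add]
  refine (scalarOpNorm_add_le _ _).trans ?_
  linarith

theorem norm_apply_le_scalarOpNorm {m n : Type*} [Fintype m] [Fintype n] [DecidableEq m]
    [DecidableEq n] (M : Matrix m n ℂ) (i : m) (j : n) : ‖M i j‖ ≤ scalarOpNorm M := by
  have h := norm_bilin_le M (Pi.single i 1) (Pi.single j 1)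
  have h2 : vecNormSq (Pi.single i (1 : ℂ)) = 1 := by
    simp [vecNormSq, Pi.single_apply, apply_ite]
  have h3 : vecNormSq (Pi.single j (1 : ℂ)) = 1 := by
    simp [vecNormSq, Pi.single_apply, apply_ite]
  rw [h2, h3, ← Pi.single_star] at h
  simpa using h

theorem CS.exists_bound_apply {A : MOUS} (v : A.carrier) :
    ∃ t : ℝ, 0 ≤ t ∧ ∀ n, ∀ φ ∈ CS A n, ∀ p q, ‖φ v p q‖ ≤ t := by
  obtain ⟨t, ht, h⟩ := CS.exists_bound (MOUS.mat1 v)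
  exact ⟨t, ht, fun n φ hφ p q =>
    (norm_apply_le_scalarOpNorm (mpair φ (MOUS.mat1 v)) (0, p) (0, q)).trans (h n φ hφ)⟩

/-- The matrix metric is bounded. -/
theorem IsMatrixLipNorm.exists_dmet_le {A : MOUS} {L : ∀ n : ℕ, A.Mat n → ℝ}
    (hL : IsMatrixLipNorm A L) (n : ℕ) :
    ∃ R, 0 ≤ R ∧ ∀ σ ∈ CS A n, ∀ τ ∈ CS A n, Dmet A L n σ τ ≤ R := by
  by_cases hne : (CS A n).Nonempty
  swap
  · exact ⟨0, le_rfl, fun σ hσ => absurd ⟨σ, hσ⟩ hne⟩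
  obtain ⟨σ₀, h₀⟩ := hne
  have key : ∃ R, 0 ≤ R ∧ ∀ τ ∈ CS A n, ∀ r (a : A.Mat r), L r a ≤ 1 →
      scalarOpNorm (mpair σ₀ a - mpair τ a) ≤ R := by
    by_contra! hcon
    choose τ hτ r a ha hlt using fun k : ℕ => hcon (k + 1) (by positivity)
    have ht : Filter.Tendsto (fun k : ℕ => 1 / ((k : ℝ) + 1)) Filter.atTop (nhds 0) :=
      tendsto_one_div_add_atTop_nhds_zero_nat
    have h1 : ∀ k : ℕ, 1 / ((k : ℝ) + 1) ≤ 1 := fun k => by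
      rw [div_le_one (by positivity)]
      linarith [(Nat.cast_nonneg k : (0 : ℝ) ≤ k)]
    let f : ℕ → MState A n := fun k =>
      ((1 - 1 / ((k : ℝ) + 1) : ℝ) : ℂ) • σ₀ + ((1 / ((k : ℝ) + 1) : ℝ) : ℂ) • τ k
    have hf : ∀ k, f k ∈ CS A n := fun k => CS.segment h₀ (hτ k) (by positivity) (h1 k)
    have hdiff : ∀ k s (v : A.Mat s), mpair σ₀ v - mpair (f k) v =
        ((1 / ((k : ℝ) + 1) : ℝ) : ℂ) • (mpair σ₀ v - mpair (τ k) v) := by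
      intro k s v
      ext p q
      simp [mpair, f]
      ring
    have hlim : ∀ v p q, Filter.Tendsto (fun k => f k v p q) Filter.atTop (nhds (σ₀ v p q)) := by
      intro v p q
      obtain ⟨t, ht0, hb⟩ := CS.exists_bound_apply v
      rw [tendsto_iff_norm_sub_tendsto_zero]
      have ht' := ht.mul_const (t + t)
      rw [zero_mul] at ht'
      refine squeeze_zero (fun _ => norm_nonneg _) (fun k => ?_) ht'
      have e : f k v p q - σ₀ v p q = ((1 / ((k : ℝ) + 1) : ℝ) : ℂ) * (τ k v p q - σ₀ v p q) := by
        simp [f]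
        ring
      rw [e, norm_mul, Complex.norm_real, Real.norm_of_nonneg (by positivity)]
      gcongr
      exact (norm_sub_le _ _).trans (add_le_add (hb n _ (hτ k) p q) (hb n _ h₀ p q))
    obtain ⟨k, hk⟩ := (hL.eventually_dmet_lt (Filter.Eventually.of_forall hf) h₀ hlim one_pos).exists
    have h2 := (hL.le_mul_dmet h₀ (hf k) (a k)).trans
      (mul_le_of_le_one_left (dmet_nonneg _ _ _) (ha k))
    rw [hdiff, scalarOpNorm_smul, Complex.norm_real, Real.norm_of_nonneg (by positivity),
      one_div, inv_mul_le_iff₀ (by positivity)] at h2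
    have := hlt k
    nlinarith [(Nat.cast_nonneg k : (0 : ℝ) ≤ k)]
  obtain ⟨R, hR, h⟩ := key
  refine ⟨R + R, add_nonneg hR hR, fun σ hσ τ hτ => dmet_le (add_nonneg hR hR) fun r a ha => ?_⟩
  have e : mpair σ a - mpair τ a = (mpair σ₀ a - mpair τ a) - (mpair σ₀ a - mpair σ a) := by abel
  rw [e]
  exact (scalarOpNorm_sub_le _ _).trans (add_le_add (h τ hτ r a ha) (h σ hσ r a ha))

/-- A `*`-invariant matrix seminorm. -/
structure IsStarSeminorm (A : MOUS) (N : ∀ n : ℕ, A.Mat n → ℝ) : Prop where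
  nonneg : ∀ n v, 0 ≤ N n v
  add_le : ∀ n v w, N n (v + w) ≤ N n v + N n w
  smul_eq : ∀ n (c : ℂ) v, N n (c • v) = ‖c‖ * N n v
  dsum_eq : ∀ m n v w, N (m + n) (dsumMat v w) = max (N m v) (N n w)
  mmul_le : ∀ m n (α : Matrix (Fin n) (Fin m) ℂ) v (β : Matrix (Fin m) (Fin n) ℂ),
    N n (mmulMat α v β) ≤ scalarOpNorm α * N m v * scalarOpNorm β
  star_eq : ∀ n v, N n (Matrix.conjTranspose v) = N n v

theorem IsMatrixLipschitzSeminorm.isStarSeminorm {A : MOUS} {L : ∀ n : ℕ, A.Mat n → ℝ}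
    (hL : IsMatrixLipschitzSeminorm A L) : IsStarSeminorm A L :=
  ⟨hL.nonneg, hL.add_le, hL.smul_eq, hL.dsum_eq, hL.mmul_le, hL.star_eq⟩

namespace IsStarSeminorm

variable {A B : MOUS} {M N : ∀ n : ℕ, A.Mat n → ℝ}

theorem sup (hM : IsStarSeminorm A M) (hN : IsStarSeminorm A N) :
    IsStarSeminorm A fun n v => max (M n v) (N n v) where
  nonneg n v := le_max_of_le_left (hM.nonneg n v)
  add_le n v w := max_le ((hM.add_le n v w).trans (add_le_add (le_max_left _ _) (le_max_left _ _)))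
    ((hN.add_le n v w).trans (add_le_add (le_max_right _ _) (le_max_right _ _)))
  smul_eq n c v := by rw [hM.smul_eq, hN.smul_eq, mul_max_of_nonneg _ _ (norm_nonneg c)]
  dsum_eq m n v w := by rw [hM.dsum_eq, hN.dsum_eq, max_max_max_comm]
  mmul_le m n α v β := by
    have h1 := scalarOpNorm_nonneg α
    have h2 := scalarOpNorm_nonneg β
    refine max_le ((hM.mmul_le m n α v β).trans ?_) ((hN.mmul_le m n α v β).trans ?_)
    · gcongr
      exact le_max_left _ _
    · gcongr
      exact le_max_right _ _
  star_eq n v := by rw [hM.star_eq, hN.star_eq]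

theorem const_mul (hM : IsStarSeminorm A M) {c : ℝ} (hc : 0 ≤ c) :
    IsStarSeminorm A fun n v => c * M n v where
  nonneg n v := mul_nonneg hc (hM.nonneg n v)
  add_le n v w := by
    rw [← mul_add]
    exact mul_le_mul_of_nonneg_left (hM.add_le n v w) hc
  smul_eq n d v := by rw [hM.smul_eq, mul_left_comm]
  dsum_eq m n v w := by rw [hM.dsum_eq, mul_max_of_nonneg _ _ hc]
  mmul_le m n α v β := by
    refine (mul_le_mul_of_nonneg_left (hM.mmul_le m n α v β) hc).trans_eq ?_
    ring
  star_eq n v := by rw [hM.star_eq]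

theorem comap (hM : IsStarSeminorm A M) {f : B.carrier →ₗ[ℂ] A.carrier}
    (hf : ∀ v, f (star v) = star (f v)) : IsStarSeminorm B fun n v => M n (mapMat f v) where
  nonneg n v := hM.nonneg n _
  add_le n v w := by
    convert hM.add_le n (mapMat f v) (mapMat f w) using 2
    ext
    simp [mapMat_apply]
  smul_eq n d v := by
    rw [← hM.smul_eq]
    congr 1
    ext
    simp [mapMat_apply]
  dsum_eq m n v w := by rw [mapMat_dsumMat, hM.dsum_eq]
  mmul_le m n α v β := by
    rw [mapMat_mmulMat]
    exact hM.mmul_le m n α _ β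
  star_eq n v := by
    rw [← hM.star_eq]
    congr 1
    ext
    simp [mapMat_apply, hf]

end IsStarSeminorm

/-- The matrix norm as a supremum over matrix states. -/
def csNorm (W : MOUS) (n : ℕ) (v : W.Mat n) : ℝ :=
  sSup {x | ∃ (k : ℕ) (φ : MState W k), φ ∈ CS W k ∧ x = scalarOpNorm (mpair φ v)}

section CsNorm

variable {W : MOUS}

theorem le_csNorm {n k : ℕ} {φ : MState W k} (hφ : φ ∈ CS W k) (v : W.Mat n) :
    scalarOpNorm (mpair φ v) ≤ csNorm W n v := by
  obtain ⟨t, -, h⟩ := CS.exists_bound v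
  refine le_csSup ⟨t, ?_⟩ ⟨k, φ, hφ, rfl⟩
  rintro _ ⟨k, φ, hφ, rfl⟩
  exact h k φ hφ

theorem csNorm_le {n : ℕ} {v : W.Mat n} {c : ℝ} (hc : 0 ≤ c)
    (h : ∀ k, ∀ φ ∈ CS W k, scalarOpNorm (mpair φ v) ≤ c) : csNorm W n v ≤ c := by
  refine Real.sSup_le ?_ hc
  rintro _ ⟨k, φ, hφ, rfl⟩
  exact h k φ hφ

theorem csNorm_nonneg (n : ℕ) (v : W.Mat n) : 0 ≤ csNorm W n v := by
  refine Real.sSup_nonneg ?_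
  rintro _ ⟨k, φ, hφ, rfl⟩
  exact scalarOpNorm_nonneg _

theorem csNorm_mmulMat_le {m n : ℕ} (α : Matrix (Fin n) (Fin m) ℂ) (v : W.Mat m)
    (β : Matrix (Fin m) (Fin n) ℂ) :
    csNorm W n (mmulMat α v β) ≤ scalarOpNorm α * csNorm W m v * scalarOpNorm β := by
  have h1 := scalarOpNorm_nonneg α
  have h2 := scalarOpNorm_nonneg β
  have h3 := csNorm_nonneg m v
  refine csNorm_le (by positivity) fun k φ hφ => ?_
  rw [mpair_mmulMat]
  have h4 := scalarOpNorm_nonneg (mpair φ v)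
  have h5 := (scalarOpNorm_mul_le (ampl k α) (mpair φ v)).trans
    (mul_le_mul (scalarOpNorm_ampl_le α) (le_csNorm hφ v) h4 h1)
  exact (scalarOpNorm_mul_le _ _).trans
    (mul_le_mul h5 (scalarOpNorm_ampl_le β) (scalarOpNorm_nonneg _) (by positivity))

theorem scalarOpNorm_mpair_dsumMat_le {m n k : ℕ} (φ : MState W k) (v : W.Mat m) (w : W.Mat n) :
    scalarOpNorm (mpair φ (dsumMat v w)) ≤
      max (scalarOpNorm (mpair φ v)) (scalarOpNorm (mpair φ w)) := by
  refine scalarOpNorm_le_of_bilin (le_max_of_le_left (scalarOpNorm_nonneg _)) fun x y => ?_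
  let x₁ : Fin m × Fin k → ℂ := fun p => x (finSumFinEquiv (Sum.inl p.1), p.2)
  let x₂ : Fin n × Fin k → ℂ := fun p => x (finSumFinEquiv (Sum.inr p.1), p.2)
  let y₁ : Fin m × Fin k → ℂ := fun p => y (finSumFinEquiv (Sum.inl p.1), p.2)
  let y₂ : Fin n × Fin k → ℂ := fun p => y (finSumFinEquiv (Sum.inr p.1), p.2)
  have hx : vecNormSq x = vecNormSq x₁ + vecNormSq x₂ := by
    simp only [vecNormSq, Fintype.sum_prod_type, sum_finSum, x₁, x₂]
  have hy : vecNormSq y = vecNormSq y₁ + vecNormSq y₂ := by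
    simp only [vecNormSq, Fintype.sum_prod_type, sum_finSum, y₁, y₂]
  have hM : star x ⬝ᵥ (mpair φ (dsumMat v w)).mulVec y =
      star x₁ ⬝ᵥ (mpair φ v).mulVec y₁ + star x₂ ⬝ᵥ (mpair φ w).mulVec y₂ := by
    simp [dotProduct, Matrix.mulVec, Fintype.sum_prod_type, sum_finSum, mpair, dsumMat, x₁, x₂, y₁,
      y₂, -finSumFinEquiv_apply_left, -finSumFinEquiv_apply_right]
  rw [hM, hx, hy, Complex.add_re]
  have h1 := re_bilin_le (mpair φ v) x₁ y₁
  have h2 := re_bilin_le (mpair φ w) x₂ y₂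
  have h3 := mul_le_mul_of_nonneg_right (le_max_left (scalarOpNorm (mpair φ v))
    (scalarOpNorm (mpair φ w))) (show 0 ≤ (vecNormSq x₁ + vecNormSq y₁) / 2 by
      linarith [vecNormSq_nonneg x₁, vecNormSq_nonneg y₁])
  have h4 := mul_le_mul_of_nonneg_right (le_max_right (scalarOpNorm (mpair φ v))
    (scalarOpNorm (mpair φ w))) (show 0 ≤ (vecNormSq x₂ + vecNormSq y₂) / 2 by
      linarith [vecNormSq_nonneg x₂, vecNormSq_nonneg y₂])
  linarith

theorem scalarOpNorm_colCat_one_zero_le {m n : ℕ} :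
    scalarOpNorm (colCat (1 : Matrix (Fin m) (Fin m) ℂ) (0 : Matrix (Fin n) (Fin m) ℂ)) ≤ 1 := by
  refine scalarOpNorm_le_one_of_conjTranspose_mul ?_
  rw [conjTranspose_colCat, rowCat_mul_colCat]
  simp

theorem scalarOpNorm_colCat_zero_one_le {m n : ℕ} :
    scalarOpNorm (colCat (0 : Matrix (Fin m) (Fin n) ℂ) (1 : Matrix (Fin n) (Fin n) ℂ)) ≤ 1 := by
  refine scalarOpNorm_le_one_of_conjTranspose_mul ?_
  rw [conjTranspose_colCat, rowCat_mul_colCat]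
  simp

theorem mmulMat_zero {m n : ℕ} (w : W.Mat m) (α : Matrix (Fin n) (Fin m) ℂ) :
    mmulMat α w 0 = 0 := by
  ext i j
  simp [mmulMat_apply]

theorem csNorm_mmulMat_conjTranspose_le {m n : ℕ} {γ : Matrix (Fin m) (Fin n) ℂ}
    (h : scalarOpNorm γ ≤ 1) (v : W.Mat m) :
    csNorm W n (mmulMat γ.conjTranspose v γ) ≤ csNorm W m v := by
  have h1 := csNorm_mmulMat_le γ.conjTranspose v γ
  rw [scalarOpNorm_conjTranspose] at h1
  have h2 := csNorm_nonneg m v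
  have h3 := scalarOpNorm_nonneg γ
  calc _ ≤ scalarOpNorm γ * csNorm W m v * scalarOpNorm γ := h1
    _ ≤ 1 * csNorm W m v * 1 :=
      mul_le_mul (mul_le_mul_of_nonneg_right h h2) h h3 (by positivity)
    _ = csNorm W m v := by ring

theorem csNorm_isStarSeminorm (W : MOUS) : IsStarSeminorm W (csNorm W) where
  nonneg := csNorm_nonneg
  add_le n v w := by
    refine csNorm_le (add_nonneg (csNorm_nonneg _ _) (csNorm_nonneg _ _)) fun k φ hφ => ?_
    rw [mpair_add]
    exact (scalarOpNorm_add_le _ _).trans (add_le_add (le_csNorm hφ v) (le_csNorm hφ w))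
  smul_eq n c v := by
    have h : ∀ (c : ℂ) (v : W.Mat n), csNorm W n (c • v) ≤ ‖c‖ * csNorm W n v := fun c v => by
      refine csNorm_le (mul_nonneg (norm_nonneg c) (csNorm_nonneg _ _)) fun k φ hφ => ?_
      rw [mpair_smul, scalarOpNorm_smul]
      exact mul_le_mul_of_nonneg_left (le_csNorm hφ v) (norm_nonneg c)
    refine le_antisymm (h c v) ?_
    rcases eq_or_ne c 0 with rfl | hc
    · simpa using csNorm_nonneg _ _
    · have h1 := h c⁻¹ (c • v)
      rw [smul_smul, inv_mul_cancel₀ hc, one_smul, norm_inv, ← div_eq_inv_mul,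
        le_div_iff₀ (norm_pos_iff.2 hc)] at h1
      rwa [mul_comm]
  dsum_eq m n v w := by
    refine le_antisymm (csNorm_le (le_max_of_le_left (csNorm_nonneg _ _)) fun k φ hφ =>
      (scalarOpNorm_mpair_dsumMat_le φ v w).trans
        (max_le_max (le_csNorm hφ v) (le_csNorm hφ w))) (max_le ?_ ?_)
    · have h := csNorm_mmulMat_conjTranspose_le (W := W) scalarOpNorm_colCat_one_zero_le
        (dsumMat v w)
      rw [conjTranspose_colCat, mmulMat_rowCat_dsumMat_colCat, Matrix.conjTranspose_one,
        mmulMat_one, Matrix.conjTranspose_zero, mmulMat_zero, add_zero] at h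
      exact h
    · have h := csNorm_mmulMat_conjTranspose_le (W := W) scalarOpNorm_colCat_zero_one_le
        (dsumMat v w)
      rw [conjTranspose_colCat, mmulMat_rowCat_dsumMat_colCat, Matrix.conjTranspose_one,
        mmulMat_one, Matrix.conjTranspose_zero, mmulMat_zero, zero_add] at h
      exact h
  mmul_le m n α v β := csNorm_mmulMat_le α v β
  star_eq n v := by
    have h : ∀ v : W.Mat n, csNorm W n v.conjTranspose ≤ csNorm W n v := fun v => by
      refine csNorm_le (csNorm_nonneg _ _) fun k φ hφ => ?_
      rw [CS.mpair_conjTranspose hφ, scalarOpNorm_conjTranspose]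
      exact le_csNorm hφ v
    refine le_antisymm (h v) ?_
    simpa using h v.conjTranspose

end CsNorm

/-- The difference of two linear maps on the summands of a direct sum. -/
def diffL {A₁ A₂ W : MOUS} (i₁ : A₁.carrier →ₗ[ℂ] W.carrier) (i₂ : A₂.carrier →ₗ[ℂ] W.carrier) :
    (A₁.prod A₂).carrier →ₗ[ℂ] W.carrier :=
  i₁ ∘ₗ fstL A₁ A₂ - i₂ ∘ₗ sndL A₁ A₂

/-- The matrix Lip-norm on `A₁ ⊕ A₂` which bridges `L₁` and `L₂` through a common closure `W`. -/
def prodLip {A₁ A₂ W : MOUS} (L₁ : ∀ n : ℕ, A₁.Mat n → ℝ) (L₂ : ∀ n : ℕ, A₂.Mat n → ℝ)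
    (i₁ : A₁.carrier →ₗ[ℂ] W.carrier) (i₂ : A₂.carrier →ₗ[ℂ] W.carrier) (ε : ℝ) (n : ℕ)
    (v : (A₁.prod A₂).Mat n) : ℝ :=
  max (max (L₁ n (mapMat (fstL A₁ A₂) v)) (L₂ n (mapMat (sndL A₁ A₂) v)))
    (ε⁻¹ * csNorm W n (mapMat (diffL i₁ i₂) v))

theorem mapMat_of_smul_one {A B : MOUS} {f : A.carrier →ₗ[ℂ] B.carrier} {n : ℕ}
    (X : Matrix (Fin n) (Fin n) ℂ) :
    mapMat f (A.scal n X) = Matrix.of fun i j => X i j • f A.one := by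
  ext i j
  simp [mapMat_apply, MOUS.scal_apply]

section ProdLip

variable {A₁ A₂ W : MOUS} {L₁ : ∀ n : ℕ, A₁.Mat n → ℝ} {L₂ : ∀ n : ℕ, A₂.Mat n → ℝ}
  {i₁ : A₁.carrier →ₗ[ℂ] W.carrier} {i₂ : A₂.carrier →ₗ[ℂ] W.carrier} {ε : ℝ}

theorem fst_le_prodLip (n : ℕ) (v : (A₁.prod A₂).Mat n) :
    L₁ n (mapMat (fstL A₁ A₂) v) ≤ prodLip L₁ L₂ i₁ i₂ ε n v :=
  (le_max_left _ _).trans (le_max_left _ _)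

theorem snd_le_prodLip (n : ℕ) (v : (A₁.prod A₂).Mat n) :
    L₂ n (mapMat (sndL A₁ A₂) v) ≤ prodLip L₁ L₂ i₁ i₂ ε n v :=
  (le_max_right _ _).trans (le_max_left _ _)

theorem csNorm_le_prodLip (hε : 0 < ε) (n : ℕ) (v : (A₁.prod A₂).Mat n) :
    csNorm W n (mapMat (diffL i₁ i₂) v) ≤ ε * prodLip L₁ L₂ i₁ i₂ ε n v := by
  rw [← inv_mul_le_iff₀ hε]
  exact le_max_right _ _

theorem scalarOpNorm_diff_le (hε : 0 < ε) {n k : ℕ} {φ : MState W k} (hφ : φ ∈ CS W k)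
    (v : (A₁.prod A₂).Mat n) :
    scalarOpNorm (mpair ((φ.comp i₁).comp (fstL A₁ A₂)) v -
      mpair ((φ.comp i₂).comp (sndL A₁ A₂)) v) ≤ ε * prodLip L₁ L₂ i₁ i₂ ε n v := by
  refine le_trans (le_of_eq_of_le ?_ (le_csNorm hφ _)) (csNorm_le_prodLip hε n v)
  congr 1
  ext p q
  simp [mpair, mapMat_apply, diffL]

theorem prodLip_isMatrixLipschitzSeminorm (hL₁ : IsMatrixLipschitzSeminorm A₁ L₁)
    (hL₂ : IsMatrixLipschitzSeminorm A₂ L₂) (h₁ : IsUCP A₁ W i₁) (h₂ : IsUCP A₂ W i₂)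
    (hne : W.one ≠ 0) (hε : 0 < ε) :
    IsMatrixLipschitzSeminorm (A₁.prod A₂) (prodLip L₁ L₂ i₁ i₂ ε) := by
  have hs : IsStarSeminorm (A₁.prod A₂) (prodLip L₁ L₂ i₁ i₂ ε) :=
    ((hL₁.isStarSeminorm.comap (f := fstL A₁ A₂) fun _ => rfl).sup
      (hL₂.isStarSeminorm.comap (f := sndL A₁ A₂) fun _ => rfl)).sup
      (((csNorm_isStarSeminorm W).comap (f := diffL i₁ i₂) fun v => by
        simp only [diffL, LinearMap.sub_apply, LinearMap.comp_apply, star_sub]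
        rw [← h₁.map_star, ← h₂.map_star]
        rfl).const_mul (inv_nonneg.2 hε.le))
  refine ⟨hs.nonneg, hs.add_le, hs.smul_eq, fun n v => ⟨fun h => ?_, ?_⟩, hs.dsum_eq, hs.mmul_le,
    hs.star_eq⟩
  · obtain ⟨lam, hlam⟩ := (hL₁.null_iff n _).1
      (le_antisymm ((fst_le_prodLip (i₁ := i₁) (i₂ := i₂) (ε := ε) n v).trans h.le)
        (hL₁.nonneg n _))
    obtain ⟨mu, hmu⟩ := (hL₂.null_iff n _).1
      (le_antisymm ((snd_le_prodLip (i₁ := i₁) (i₂ := i₂) (ε := ε) n v).trans h.le)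
        (hL₂.nonneg n _))
    have h1 : ∀ i j, (v i j).1 = lam i j • A₁.one := fun i j => congrFun (congrFun hlam i) j
    have h2 : ∀ i j, (v i j).2 = mu i j • A₂.one := fun i j => congrFun (congrFun hmu i) j
    obtain ⟨ω, hω⟩ := W.exists_state hne
    have h3 := scalarOpNorm_diff_le (L₁ := L₁) (L₂ := L₂) (i₁ := i₁) (i₂ := i₂) hε hω v
    rw [h, mul_zero] at h3
    have h4 := (scalarOpNorm_eq_zero_iff _).1 (h3.antisymm (scalarOpNorm_nonneg _))
    have h5 : lam = mu := by
      ext i j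
      have h6 := congrFun (congrFun h4 (i, 0)) (j, 0)
      simp only [mpair, Matrix.sub_apply, Matrix.of_apply, LinearMap.comp_apply, Matrix.zero_apply]
        at h6
      change ω (i₁ (v i j).1) 0 0 - ω (i₂ (v i j).2) 0 0 = 0 at h6
      rw [h1, h2, map_smul, map_smul, map_smul, map_smul, h₁.unital, h₂.unital, hω.1] at h6
      simpa [sub_eq_zero] using h6
    refine ⟨lam, ?_⟩
    ext i j
    exact Prod.ext (h1 i j) ((h2 i j).trans (by rw [h5]; rfl))
  · rintro ⟨lam, rfl⟩
    have h1 : L₁ n (mapMat (fstL A₁ A₂) ((A₁.prod A₂).scal n lam)) = 0 :=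
      (hL₁.null_iff n _).2 ⟨lam, mapMat_of_smul_one lam⟩
    have h2 : L₂ n (mapMat (sndL A₁ A₂) ((A₁.prod A₂).scal n lam)) = 0 :=
      (hL₂.null_iff n _).2 ⟨lam, mapMat_of_smul_one lam⟩
    have h3 : mapMat (diffL i₁ i₂) ((A₁.prod A₂).scal n lam) = 0 := by
      rw [mapMat_of_smul_one]
      have : diffL i₁ i₂ (A₁.prod A₂).one = 0 := by
        change i₁ A₁.one - i₂ A₂.one = 0
        rw [h₁.unital, h₂.unital, sub_self]
      ext
      simp [this]
    have h4 : csNorm W n 0 = 0 := by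
      simpa using (csNorm_isStarSeminorm W).smul_eq n 0 0
    change prodLip L₁ L₂ i₁ i₂ ε n ((A₁.prod A₂).scal n lam) = 0
    rw [prodLip, h1, h2, h3, h4]
    simp

end ProdLip

theorem induces_of_exists_le {A B : MOUS} {φ : A.carrier →ₗ[ℂ] B.carrier}
    {L : ∀ n : ℕ, A.Mat n → ℝ} {LB : ∀ n : ℕ, B.Mat n → ℝ}
    (hle : ∀ n (a : A.Mat n), LB n (mapMat φ a) ≤ L n a)
    (hex : ∀ n (b : B.Mat n) (η : ℝ), 0 < η → ∃ a, mapMat φ a = b ∧ L n a ≤ LB n b + η) :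
    Induces A B φ L LB := by
  intro n b
  have hlb : LB n b ∈ lowerBounds {x | ∃ a, mapMat φ a = b ∧ x = L n a} := by
    rintro _ ⟨a, rfl, rfl⟩
    exact hle n a
  refine le_antisymm ?_ (le_of_forall_pos_le_add fun η hη => ?_)
  · obtain ⟨a, ha, -⟩ := hex n b 1 one_pos
    exact le_csInf ⟨_, a, ha, rfl⟩ hlb
  · obtain ⟨a, ha, h⟩ := hex n b η hη
    exact (csInf_le ⟨_, hlb⟩ ⟨a, ha, rfl⟩).trans h

/-- The matrix over a direct sum with given coordinates. -/
def pairMat {A₁ A₂ : MOUS} {n : ℕ} (a : A₁.Mat n) (b : A₂.Mat n) : (A₁.prod A₂).Mat n :=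
  Matrix.of fun i j => ((a i j, b i j) : A₁.carrier × A₂.carrier)

section Induces

variable {A₁ A₂ W : MOUS} {L₁ : ∀ n : ℕ, A₁.Mat n → ℝ} {L₂ : ∀ n : ℕ, A₂.Mat n → ℝ}
  {Lc : ∀ n : ℕ, W.Mat n → ℝ}
  {i₁ : A₁.carrier →ₗ[ℂ] W.carrier} {i₂ : A₂.carrier →ₗ[ℂ] W.carrier} {ε : ℝ}

theorem mapMat_diffL {n : ℕ} (a : A₁.Mat n) (b : A₂.Mat n) :
    mapMat (diffL i₁ i₂) (pairMat a b) = mapMat i₁ a - mapMat i₂ b :=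
  rfl

theorem prodLip_pairMat_le (hε : 0 < ε) {n : ℕ} {a : A₁.Mat n} {b : A₂.Mat n} {t : ℝ} (ht : 0 ≤ t)
    (ha : L₁ n a ≤ t) (hb : L₂ n b ≤ t)
    (h : ∀ k, ∀ φ ∈ CS W k, scalarOpNorm (mpair φ (mapMat i₁ a - mapMat i₂ b)) ≤ ε * t) :
    prodLip L₁ L₂ i₁ i₂ ε n (pairMat a b) ≤ t := by
  refine max_le (max_le ha hb) ?_
  rw [inv_mul_le_iff₀ hε, mapMat_diffL]
  exact csNorm_le (mul_nonneg hε.le ht) h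

theorem prodLip_induces_fst (h₁ : IsClosureOf A₁ L₁ W Lc i₁) (h₂ : IsClosureOf A₂ L₂ W Lc i₂)
    (hL₁ : IsMatrixLipNorm A₁ L₁) (hL₂ : IsMatrixLipNorm A₂ L₂) (hne : A₂.one ≠ 0) (hε : 0 < ε) :
    Induces (A₁.prod A₂) A₁ (fstL A₁ A₂) (prodLip L₁ L₂ i₁ i₂ ε) L₁ := by
  refine induces_of_exists_le fst_le_prodLip fun n a η hη => ?_
  have hm : 0 < min η (ε * η) := lt_min hη (mul_pos hε hη)
  obtain ⟨b, h3, h4⟩ := h₁.exists_close h₂ hL₁ hL₂ hne a hm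
  have h0 := hL₁.nonneg n a
  have h5 := min_le_left η (ε * η)
  have h6 := min_le_right η (ε * η)
  refine ⟨pairMat a b, rfl, prodLip_pairMat_le hε (by linarith) (by linarith) (by linarith)
    fun k φ hφ => (h4 k φ hφ).trans (h6.trans ?_)⟩
  exact mul_le_mul_of_nonneg_left (by linarith) hε.le

theorem prodLip_induces_snd (h₁ : IsClosureOf A₁ L₁ W Lc i₁) (h₂ : IsClosureOf A₂ L₂ W Lc i₂)
    (hL₁ : IsMatrixLipNorm A₁ L₁) (hL₂ : IsMatrixLipNorm A₂ L₂) (hne : A₁.one ≠ 0) (hε : 0 < ε) :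
    Induces (A₁.prod A₂) A₂ (sndL A₁ A₂) (prodLip L₁ L₂ i₁ i₂ ε) L₂ := by
  refine induces_of_exists_le snd_le_prodLip fun n b η hη => ?_
  have hm : 0 < min η (ε * η) := lt_min hη (mul_pos hε hη)
  obtain ⟨a, h3, h4⟩ := h₂.exists_close h₁ hL₂ hL₁ hne b hm
  have h0 := hL₂.nonneg n b
  have h5 := min_le_left η (ε * η)
  have h6 := min_le_right η (ε * η)
  refine ⟨pairMat a b, rfl, prodLip_pairMat_le hε (by linarith) (by linarith) (by linarith)
    fun k φ hφ => ?_⟩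
  have e : mapMat i₁ a - mapMat i₂ b = (-1 : ℂ) • (mapMat i₂ b - mapMat i₁ a) := by simp
  rw [e, mpair_smul, scalarOpNorm_smul, norm_neg, norm_one, one_mul]
  exact (h4 k φ hφ).trans (h6.trans (mul_le_mul_of_nonneg_left (by linarith) hε.le))

/-- Restricting an extended matrix state moves it by at most `ε` for the bridge metric. -/
theorem dmet_prodLip_le (hε : 0 < ε) {k : ℕ} {φ : MState W k} (hφ : φ ∈ CS W k) :
    Dmet (A₁.prod A₂) (prodLip L₁ L₂ i₁ i₂ ε) k ((φ.comp i₁).comp (fstL A₁ A₂))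
      ((φ.comp i₂).comp (sndL A₁ A₂)) ≤ ε :=
  dmet_le hε.le fun _ v hv => (scalarOpNorm_diff_le hε hφ v).trans
    ((mul_le_mul_of_nonneg_left hv hε.le).trans_eq (mul_one ε))

end Induces

theorem hDist_nonneg {X : Type} {d : X → X → ℝ} (hd : ∀ x y, 0 ≤ d x y) (s t : Set X) :
    0 ≤ hDist d s t := by
  refine le_max_of_le_left (Real.sSup_nonneg ?_)
  rintro _ ⟨x, -, rfl⟩
  refine Real.sInf_nonneg ?_
  rintro _ ⟨y, -, rfl⟩
  exact hd x y

theorem hDist_le {X : Type} {d : X → X → ℝ} (hd : ∀ x y, 0 ≤ d x y) {s t : Set X} {ε : ℝ}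
    (hε : 0 ≤ ε) (hs : ∀ x ∈ s, ∃ y ∈ t, d x y ≤ ε) (ht : ∀ y ∈ t, ∃ x ∈ s, d x y ≤ ε) :
    hDist d s t ≤ ε := by
  refine max_le (Real.sSup_le ?_ hε) (Real.sSup_le ?_ hε)
  · rintro _ ⟨x, hx, rfl⟩
    obtain ⟨y, hy, h⟩ := hs x hx
    refine le_trans (csInf_le ⟨0, ?_⟩ ⟨y, hy, rfl⟩) h
    rintro _ ⟨z, -, rfl⟩
    exact hd x z
  · rintro _ ⟨y, hy, rfl⟩
    obtain ⟨x, hx, h⟩ := ht y hy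
    refine le_trans (csInf_le ⟨0, ?_⟩ ⟨x, hx, rfl⟩) h
    rintro _ ⟨z, -, rfl⟩
    exact hd z y

section DistNC

variable {A₁ A₂ : MOUS} {L₁ : ∀ n : ℕ, A₁.Mat n → ℝ} {L₂ : ∀ n : ℕ, A₂.Mat n → ℝ}

theorem distNC_nonneg : 0 ≤ distNC A₁ L₁ A₂ L₂ := by
  refine Real.sInf_nonneg ?_
  rintro _ ⟨L, -, rfl⟩
  exact Real.iSup_nonneg fun n =>
    mul_nonneg (by positivity) (hDist_nonneg (fun _ _ => dmet_nonneg n _ _) _ _)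

theorem distNC_le {L : ∀ n : ℕ, (A₁.prod A₂).Mat n → ℝ} (hL : L ∈ MSet A₁ L₁ A₂ L₂) {ε : ℝ}
    (hε : 0 ≤ ε) (h : ∀ n, hDist (Dmet (A₁.prod A₂) L n)
      ((fun φ : MState A₁ n => φ.comp (fstL A₁ A₂)) '' CS A₁ n)
      ((fun φ : MState A₂ n => φ.comp (sndL A₁ A₂)) '' CS A₂ n) ≤ ε) :
    distNC A₁ L₁ A₂ L₂ ≤ ε := by
  unfold distNC
  refine le_trans (csInf_le ⟨0, ?_⟩ ⟨L, hL, rfl⟩) (Real.iSup_le (fun n => ?_) hε)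
  · rintro _ ⟨L, -, rfl⟩
    exact Real.iSup_nonneg fun n =>
      mul_nonneg (by positivity) (hDist_nonneg (fun _ _ => dmet_nonneg n _ _) _ _)
  · rcases Nat.eq_zero_or_pos n with rfl | hn
    · simpa using hε
    · have h1 : ((n : ℝ) ^ 2)⁻¹ ≤ 1 := inv_le_one_of_one_le₀ (one_le_pow₀ (by exact_mod_cast hn))
      calc _ ≤ 1 * ε := mul_le_mul h1 (h n) (hDist_nonneg (fun _ _ => dmet_nonneg n _ _) _ _)
            zero_le_one
        _ = ε := one_mul ε

end DistNC

theorem IsClosureOf.exists_extension {A W : MOUS} {L : ∀ n : ℕ, A.Mat n → ℝ}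
    {Lc : ∀ n : ℕ, W.Mat n → ℝ} {j : A.carrier →ₗ[ℂ] W.carrier} (h : IsClosureOf A L W Lc j)
    {n : ℕ} {φ : MState A n} (hφ : φ ∈ CS A n) : ∃ ψ ∈ CS W n, ψ.comp j = φ :=
  CS.exists_extension h.ucp h.inj (fun n a => (h.ordEmb n a).1) hφ

theorem hDist_prodLip_le {A₁ A₂ W : MOUS} {L₁ : ∀ n : ℕ, A₁.Mat n → ℝ}
    {L₂ : ∀ n : ℕ, A₂.Mat n → ℝ} {Lc : ∀ n : ℕ, W.Mat n → ℝ} {i₁ : A₁.carrier →ₗ[ℂ] W.carrier}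
    {i₂ : A₂.carrier →ₗ[ℂ] W.carrier} (h₁ : IsClosureOf A₁ L₁ W Lc i₁)
    (h₂ : IsClosureOf A₂ L₂ W Lc i₂) {ε : ℝ} (hε : 0 < ε) (n : ℕ) :
    hDist (Dmet (A₁.prod A₂) (prodLip L₁ L₂ i₁ i₂ ε) n)
      ((fun φ : MState A₁ n => φ.comp (fstL A₁ A₂)) '' CS A₁ n)
      ((fun φ : MState A₂ n => φ.comp (sndL A₁ A₂)) '' CS A₂ n) ≤ ε := by
  refine hDist_le (fun _ _ => dmet_nonneg n _ _) hε.le ?_ ?_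
  · rintro _ ⟨φ, hφ, rfl⟩
    obtain ⟨χ, hχ, rfl⟩ := h₁.exists_extension hφ
    exact ⟨_, ⟨_, CS.comp h₂.ucp hχ, rfl⟩, dmet_prodLip_le hε hχ⟩
  · rintro _ ⟨φ, hφ, rfl⟩
    obtain ⟨χ, hχ, rfl⟩ := h₂.exists_extension hφ
    exact ⟨_, ⟨_, CS.comp h₁.ucp hχ, rfl⟩, dmet_prodLip_le hε hχ⟩

section PositiveFunctional

open Filter Topology

variable {A : MOUS}

/-- Complete positivity of a linear map into `M_n`. -/
def IsCPMap {n : ℕ} (θ : MState A n) : Prop :=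
  ∀ r, ∀ v ∈ A.pos r, (mpair θ v).PosSemidef

theorem IsCPMap.one_nonneg {θ : MState A 1} (hθ : IsCPMap θ) : 0 ≤ θ A.one 0 0 := by
  have h := (hθ 1 _ (A.unit_pos 1)).diag_nonneg (i := (0, 0))
  simpa [mpair] using h

theorem IsCPMap.ofReal_re {θ : MState A 1} (hθ : IsCPMap θ) :
    (((θ A.one 0 0).re : ℝ) : ℂ) = θ A.one 0 0 :=
  (Complex.eq_re_of_ofReal_le (r := 0) (by exact_mod_cast hθ.one_nonneg)).symm

theorem IsCPMap.eq_zero {θ : MState A 1} (hθ : IsCPMap θ) (h0 : θ A.one 0 0 = 0) : θ = 0 := by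
  have key : ∀ h : A.carrier, star h = h → θ h 0 0 ≤ 0 := by
    intro h hh
    obtain ⟨t, -, hp⟩ := A.orderUnit h hh
    have h1 := (hθ 1 _ hp).diag_nonneg (i := (0, 0))
    simpa [mpair, h0] using h1
  have key2 : ∀ h : A.carrier, star h = h → θ h 0 0 = 0 := by
    intro h hh
    refine le_antisymm (key h hh) ?_
    have h1 := key (-h) (by rw [star_neg, hh])
    simpa using h1
  ext v i k
  obtain ⟨x, y, hx, hy, rfl⟩ := A.exists_re_im v
  rw [Subsingleton.elim i 0, Subsingleton.elim k 0]
  simp [key2 x hx, key2 y hy]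

theorem IsCPMap.inv_smul_mem_CS {θ : MState A 1} (hθ : IsCPMap θ) (h0 : 0 < (θ A.one 0 0).re) :
    (((θ A.one 0 0).re⁻¹ : ℝ) : ℂ) • θ ∈ CS A 1 := by
  refine ⟨?_, fun r v hv => ?_⟩
  · ext i k
    rw [Subsingleton.elim i 0, Subsingleton.elim k 0, LinearMap.smul_apply, Matrix.smul_apply,
      ← hθ.ofReal_re, smul_eq_mul, ← Complex.ofReal_mul, Complex.ofReal_re, inv_mul_cancel₀ h0.ne']
    simp
  · rw [smul_mpair]
    exact (hθ r v hv).smul (by exact_mod_cast (inv_pos.2 h0).le)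

theorem IsCPMap.norm_apply_le {θ : MState A 1} (hθ : IsCPMap θ) {a : A.carrier} {R : ℝ}
    (h : ∀ τ ∈ CS A 1, ‖τ a 0 0‖ ≤ R) : ‖θ a 0 0‖ ≤ (θ A.one 0 0).re * R := by
  have h1 : 0 ≤ (θ A.one 0 0).re := (Complex.le_def.1 hθ.one_nonneg).1
  rcases h1.eq_or_lt with h0 | h0
  · have : θ = 0 := hθ.eq_zero (by rw [← hθ.ofReal_re, ← h0]; rfl)
    simp [this]
  · have h2 := h _ (hθ.inv_smul_mem_CS h0)
    rwa [LinearMap.smul_apply, Matrix.smul_apply, norm_smul, Complex.norm_real,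
      Real.norm_of_nonneg (inv_nonneg.2 h1), inv_mul_le_iff₀ h0] at h2

theorem IsMatrixLipNorm.eventually_norm_sub_le {L : ∀ n : ℕ, A.Mat n → ℝ}
    (hL : IsMatrixLipNorm A L) {ι : Type*} {l : Filter ι} {θ : ι → MState A 1} {θ₀ : MState A 1}
    (hθ : ∀ᶠ i in l, IsCPMap (θ i)) (hθ₀ : IsCPMap θ₀)
    (hlim : ∀ v, Tendsto (fun i => θ i v 0 0) l (𝓝 (θ₀ v 0 0))) {R δ : ℝ}
    (hδ : 0 < δ) : ∀ᶠ i in l, ∀ a : A.carrier, L 1 (MOUS.mat1 a) ≤ 1 →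
      (∀ τ ∈ CS A 1, ‖τ a 0 0‖ ≤ R) → ‖θ₀ a 0 0 - θ i a 0 0‖ ≤ δ := by
  have hc : Tendsto (fun i => (θ i A.one 0 0).re) l (𝓝 (θ₀ A.one 0 0).re) :=
    (Complex.continuous_re.tendsto _).comp (hlim A.one)
  have h1 : 0 ≤ (θ₀ A.one 0 0).re := (Complex.le_def.1 hθ₀.one_nonneg).1
  rcases h1.eq_or_lt with h0 | h0
  · have hz : θ₀ = 0 := hθ₀.eq_zero (by rw [← hθ₀.ofReal_re, ← h0]; rfl)
    have h2 : Tendsto (fun i => (θ i A.one 0 0).re * R) l (𝓝 0) := by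
      simpa [← h0] using hc.mul_const R
    filter_upwards [hθ, h2.eventually_lt_const hδ] with i hi hi2 a _ ha
    have h3 := hi.norm_apply_le ha
    simpa [hz] using h3.trans hi2.le
  · set c₀ := (θ₀ A.one 0 0).re with hc₀
    let τ : ι → MState A 1 := fun i => (((θ i A.one 0 0).re⁻¹ : ℝ) : ℂ) • θ i
    have hτ : ∀ᶠ i in l, τ i ∈ CS A 1 := by
      filter_upwards [hθ, hc.eventually_const_lt h0] with i hi hi2
      exact hi.inv_smul_mem_CS hi2
    have h2 : ∀ᶠ i in l, Dmet A L 1 ((c₀⁻¹ : ℝ) • θ₀) (τ i) < δ / 2 / c₀ := by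
      refine hL.eventually_dmet_lt hτ (hθ₀.inv_smul_mem_CS h0) (fun v p q => ?_)
        (div_pos (half_pos hδ) h0)
      rw [Subsingleton.elim p 0, Subsingleton.elim q 0]
      exact ((Complex.continuous_ofReal.tendsto _).comp (hc.inv₀ h0.ne')).mul (hlim v)
    have h3 : Tendsto (fun i => |(θ i A.one 0 0).re - c₀| * R) l (𝓝 0) := by
      have := ((hc.sub_const c₀).abs).mul_const R
      simpa [← hc₀] using this
    filter_upwards [hτ, h2, h3.eventually_lt_const (half_pos hδ), hc.eventually_const_lt h0]
      with i hi hi2 hi3 hi4 a hLa ha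
    set c := (θ i A.one 0 0).re with hcdef
    have hi' : (((c₀⁻¹ : ℝ) : ℂ) • θ₀) ∈ CS A 1 := hθ₀.inv_smul_mem_CS h0
    have e1 : θ i a 0 0 = (c : ℂ) * τ i a 0 0 := by
      change _ = (c : ℂ) * (((c⁻¹ : ℝ) : ℂ) * θ i a 0 0)
      rw [← mul_assoc, ← Complex.ofReal_mul, mul_inv_cancel₀ hi4.ne']
      simp
    have e0 : θ₀ a 0 0 = (c₀ : ℂ) * (((c₀⁻¹ : ℝ) : ℂ) • θ₀) a 0 0 := by
      change _ = (c₀ : ℂ) * (((c₀⁻¹ : ℝ) : ℂ) * θ₀ a 0 0)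
      rw [← mul_assoc, ← Complex.ofReal_mul, mul_inv_cancel₀ h0.ne']
      simp
    have h5 : ‖(((c₀⁻¹ : ℝ) : ℂ) • θ₀) a 0 0 - τ i a 0 0‖ ≤ δ / 2 / c₀ := by
      refine (norm_apply_le_scalarOpNorm (mpair (((c₀⁻¹ : ℝ) : ℂ) • θ₀) (MOUS.mat1 a) -
        mpair (τ i) (MOUS.mat1 a)) (0, 0) (0, 0)).trans ?_
      refine (hL.le_mul_dmet hi' hi _).trans ?_
      refine (mul_le_mul_of_nonneg_right hLa (dmet_nonneg _ _ _)).trans ?_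
      rw [one_mul]
      exact hi2.le
    have e2 : θ₀ a 0 0 - θ i a 0 0 = (c₀ : ℂ) * ((((c₀⁻¹ : ℝ) : ℂ) • θ₀) a 0 0 - τ i a 0 0) -
        ((c - c₀ : ℝ) : ℂ) * τ i a 0 0 := by
      rw [e1, e0]
      push_cast
      ring
    rw [e2]
    refine (norm_sub_le _ _).trans ?_
    rw [norm_mul, norm_mul, Complex.norm_real, Complex.norm_real, Real.norm_of_nonneg h0.le,
      Real.norm_eq_abs]
    have h6 := mul_le_mul_of_nonneg_left h5 h0.le
    have h7 := mul_le_mul_of_nonneg_left (ha _ hi) (abs_nonneg (c - c₀))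
    rw [mul_div_cancel₀ _ h0.ne'] at h6
    linarith

end PositiveFunctional

section QuadraticFunctional

open Filter Topology

variable {A : MOUS}

/-- The vector functional `v ↦ ⟨ψ(v) ξ, ξ⟩`. -/
def quadFun {n : ℕ} (ψ : MState A n) (ξ : Fin n → ℂ) : MState A 1 where
  toFun v := Matrix.of fun _ _ => star ξ ⬝ᵥ (ψ v).mulVec ξ
  map_add' v w := by
    ext
    simp [Matrix.add_mulVec, dotProduct_add]
  map_smul' c v := by
    ext
    simp [Matrix.smul_mulVec, dotProduct_smul]

theorem quadFun_apply {n : ℕ} (ψ : MState A n) (ξ : Fin n → ℂ) (v : A.carrier) :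
    quadFun ψ ξ v 0 0 = star ξ ⬝ᵥ (ψ v).mulVec ξ :=
  rfl

theorem IsCPMap.quadFun {n : ℕ} {ψ : MState A n} (hψ : IsCPMap ψ) (ξ : Fin n → ℂ) :
    IsCPMap (quadFun ψ ξ) := by
  intro r v hv
  let B : Matrix (Fin r × Fin n) (Fin r × Fin 1) ℂ :=
    Matrix.of fun p q => if p.1 = q.1 then ξ p.2 else 0
  have e : mpair (_root_.quadFun ψ ξ) v = B.conjTranspose * mpair ψ v * B := by
    ext p q
    simp only [mpair, Matrix.of_apply, Matrix.mul_apply, Matrix.conjTranspose_apply, B,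
      Fintype.sum_prod_type, apply_ite star, star_zero, ite_mul, zero_mul, mul_ite, mul_zero]
    rw [Subsingleton.elim p.2 0, Subsingleton.elim q.2 0, quadFun_apply]
    simp only [dotProduct, Matrix.mulVec, Pi.star_apply, Finset.sum_const_zero,
      Finset.mul_sum, Finset.sum_mul, Finset.sum_ite_irrel,
      Finset.mem_univ, if_true, Finset.sum_ite_eq']
    rw [Finset.sum_comm]
    simp only [mul_assoc]
  rw [e]
  exact (hψ r v hv).conjTranspose_mul_mul_same B

theorem polarization {n : ℕ} (M : Matrix (Fin n) (Fin n) ℂ) (p q : Fin n) :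
    4 * M p q = ∑ k : Fin 4, star (Complex.I ^ (k : ℕ)) *
      (star (Pi.single p 1 + Pi.single q (Complex.I ^ (k : ℕ)) : Fin n → ℂ) ⬝ᵥ
        M.mulVec (Pi.single p 1 + Pi.single q (Complex.I ^ (k : ℕ)))) := by
  have h : ∀ c : ℂ, star (Pi.single p 1 + Pi.single q c : Fin n → ℂ) ⬝ᵥ
      M.mulVec (Pi.single p 1 + Pi.single q c) =
        M p p + M p q * c + star c * M q p + star c * M q q * c := by
    intro c
    rw [star_add, ← Pi.single_star, ← Pi.single_star]
    simp [Matrix.mulVec_add, add_dotProduct, dotProduct_add, single_dotProduct, mul_comm]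
    ring
  simp only [h, Fin.sum_univ_four]
  simp [pow_succ]
  ring_nf
  simp [Complex.I_sq]
  ring

theorem norm_apply_le_of_quadForm {n : ℕ} {M : Matrix (Fin n) (Fin n) ℂ} {p q : Fin n} {δ : ℝ}
    (h : ∀ k : Fin 4, ‖star (Pi.single p 1 + Pi.single q (Complex.I ^ (k : ℕ)) : Fin n → ℂ) ⬝ᵥ
      M.mulVec (Pi.single p 1 + Pi.single q (Complex.I ^ (k : ℕ)))‖ ≤ δ) : ‖M p q‖ ≤ δ := by
  have h1 : ‖4 * M p q‖ ≤ ∑ _k : Fin 4, δ := by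
    rw [polarization]
    refine (norm_sum_le _ _).trans (Finset.sum_le_sum fun k _ => ?_)
    rw [norm_mul, norm_star, norm_pow, Complex.norm_I, one_pow, one_mul]
    exact h k
  rw [norm_mul] at h1
  norm_num at h1
  exact h1

theorem scalarOpNorm_rowVec_le {n : ℕ} (x : Fin n → ℂ) :
    scalarOpNorm (MOUS.rowVec x) ≤ Real.sqrt (vecNormSq x) := by
  rw [← scalarOpNorm_conjTranspose]
  refine scalarOpNorm_le_of_vecNormSq (Real.sqrt_nonneg _) fun y => ?_
  rw [Real.sq_sqrt (vecNormSq_nonneg x)]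
  refine le_of_eq ?_
  simp [vecNormSq, Matrix.mulVec, dotProduct, MOUS.rowVec, mul_pow, Finset.sum_mul]

/-- Matrix pairings are controlled by entries over the first-level Lipschitz ball. -/
theorem IsMatrixLipschitzSeminorm.scalarOpNorm_sub_le {L : ∀ n : ℕ, A.Mat n → ℝ}
    (hL : IsMatrixLipschitzSeminorm A L) {n : ℕ} {φ ψ : MState A n} {δ : ℝ}
    (h : ∀ v : A.carrier, L 1 (MOUS.mat1 v) ≤ 1 → ∀ p q, ‖φ v p q - ψ v p q‖ ≤ δ)
    {r : ℕ} (a : A.Mat r) (ha : L r a ≤ 1) :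
    scalarOpNorm (mpair φ a - mpair ψ a) ≤ n * δ := by
  have hscale : ∀ (v : A.carrier) (t : ℝ), 0 < t → L 1 (MOUS.mat1 v) ≤ t →
      ∀ p q, ‖φ v p q - ψ v p q‖ ≤ t * δ := by
    intro v t ht hv p q
    have e : MOUS.mat1 (((t⁻¹ : ℝ) : ℂ) • v) = ((t⁻¹ : ℝ) : ℂ) • MOUS.mat1 v := rfl
    have h1 := h (((t⁻¹ : ℝ) : ℂ) • v) (by
      rw [e, hL.smul_eq, Complex.norm_real, Real.norm_of_nonneg (inv_nonneg.2 ht.le),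
        inv_mul_le_iff₀ ht]
      linarith) p q
    rw [map_smul, map_smul, Matrix.smul_apply, Matrix.smul_apply, ← smul_sub, norm_smul,
      Complex.norm_real, Real.norm_of_nonneg (inv_nonneg.2 ht.le), inv_mul_le_iff₀ ht] at h1
    exact h1
  rcases Nat.eq_zero_or_pos n with rfl | hn
  · refine scalarOpNorm_le_of_bilin (by simp) fun x y => ?_
    simp [dotProduct]
  have hδ : 0 ≤ δ := (norm_nonneg _).trans (h 0 (by
    have e : MOUS.mat1 (0 : A.carrier) = 0 := rfl
    rw [e, hL.map_zero]
    exact zero_le_one) ⟨0, hn⟩ ⟨0, hn⟩)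
  refine scalarOpNorm_le_of_bilin (by positivity) fun x y => ?_
  have hsum : star x ⬝ᵥ (mpair φ a - mpair ψ a).mulVec y = ∑ p, ∑ q,
      ((φ (∑ k, ∑ l, (star (x (k, p)) * y (l, q)) • a k l)) p q -
        (ψ (∑ k, ∑ l, (star (x (k, p)) * y (l, q)) • a k l)) p q) := by
    have e : ∀ (χ : MState A n) (p q : Fin n),
        χ (∑ k, ∑ l, (star (x (k, p)) * y (l, q)) • a k l) p q =
          ∑ k, ∑ l, star (x (k, p)) * (χ (a k l) p q * y (l, q)) := by
      intro χ p q
      simp only [map_sum, map_smul, Matrix.sum_apply, Matrix.smul_apply, smul_eq_mul]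
      exact Finset.sum_congr rfl fun k _ => Finset.sum_congr rfl fun l _ => by ring
    simp only [e, ← Finset.sum_sub_distrib]
    simp only [dotProduct, Matrix.mulVec, Fintype.sum_prod_type, mpair, Matrix.sub_apply,
      Matrix.of_apply, Pi.star_apply, Finset.mul_sum]
    rw [Finset.sum_comm]
    refine Finset.sum_congr rfl fun p _ => ?_
    rw [Finset.sum_comm]
    rw [Finset.sum_congr rfl fun k _ => Finset.sum_comm, Finset.sum_comm,
      Finset.sum_congr rfl fun q _ => Finset.sum_comm]
    exact Finset.sum_congr rfl fun q _ => Finset.sum_congr rfl fun k _ =>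
      Finset.sum_congr rfl fun l _ => by ring
  have hterm : ∀ p q : Fin n, ‖φ (∑ k, ∑ l, (star (x (k, p)) * y (l, q)) • a k l) p q -
      ψ (∑ k, ∑ l, (star (x (k, p)) * y (l, q)) • a k l) p q‖ ≤
        (vecNormSq (fun k => x (k, p)) + vecNormSq fun l => y (l, q)) / 2 * δ := by
    intro p q
    set s := Real.sqrt (vecNormSq fun k => x (k, p)) with hs
    set t := Real.sqrt (vecNormSq fun l => y (l, q)) with ht
    have hs0 : 0 ≤ s := Real.sqrt_nonneg _
    have ht0 : 0 ≤ t := Real.sqrt_nonneg _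
    have hs2 : s ^ 2 = vecNormSq fun k => x (k, p) := Real.sq_sqrt (vecNormSq_nonneg _)
    have ht2 : t ^ 2 = vecNormSq fun l => y (l, q) := Real.sq_sqrt (vecNormSq_nonneg _)
    have hLu : L 1 (MOUS.mat1 (∑ k, ∑ l, (star (x (k, p)) * y (l, q)) • a k l)) ≤
        (s ^ 2 + t ^ 2) / 2 := by
      have h1 := hL.mmul_le r 1 (MOUS.rowVec fun k => star (x (k, p))) a
        (MOUS.rowVec fun l => star (y (l, q))).conjTranspose
      have e : mmulMat (MOUS.rowVec fun k => star (x (k, p))) a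
          (MOUS.rowVec fun l => star (y (l, q))).conjTranspose =
            MOUS.mat1 (∑ k, ∑ l, (star (x (k, p)) * y (l, q)) • a k l) := by
        ext
        simp [mmulMat_apply, MOUS.rowVec, MOUS.mat1]
      rw [e, scalarOpNorm_conjTranspose] at h1
      have e3 : ∀ z : Fin r → ℂ, vecNormSq (fun k => star (z k)) = vecNormSq z := fun z => by
        simp [vecNormSq]
      have h2 := scalarOpNorm_rowVec_le fun k => star (x (k, p))
      have h3 := scalarOpNorm_rowVec_le fun l => star (y (l, q))
      rw [e3 fun k => x (k, p)] at h2
      rw [e3 fun l => y (l, q)] at h3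
      calc _ ≤ s * 1 * t := h1.trans (mul_le_mul (mul_le_mul h2 ha (hL.nonneg _ _) hs0) h3
            (scalarOpNorm_nonneg _) (by positivity))
        _ ≤ (s ^ 2 + t ^ 2) / 2 := by nlinarith [sq_nonneg (s - t)]
    rw [← hs2, ← ht2]
    refine le_of_forall_pos_le_add fun η hη => ?_
    have h1 := hscale _ ((s ^ 2 + t ^ 2) / 2 + η / (δ + 1)) (by positivity)
      (hLu.trans (le_add_of_nonneg_right (by positivity))) p q
    refine h1.trans ?_
    rw [add_mul]
    gcongr
    rw [div_mul_eq_mul_div, div_le_iff₀ (by positivity)]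
    nlinarith
  rw [hsum]
  refine (Complex.re_le_norm _).trans ?_
  refine (norm_sum_le _ _).trans ?_
  refine (Finset.sum_le_sum fun p _ => (norm_sum_le _ _).trans
    (Finset.sum_le_sum fun q _ => hterm p q)).trans_eq ?_
  rw [vecNormSq_prod x, vecNormSq_prod y]
  simp only [add_div, add_mul, Finset.sum_add_distrib, Finset.sum_const, Finset.card_univ,
    Fintype.card_fin, ← Finset.sum_div, ← Finset.sum_mul, nsmul_eq_mul, ← Finset.mul_sum]
  ring

end QuadraticFunctional

section Topologies

open Filter Topology

/-- A matrix Lipschitz seminorm is a matrix Lip-norm as soon as pointwise convergence of matrix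
states is uniform on Lipschitz balls. -/
theorem IsMatrixLipschitzSeminorm.isMatrixLipNorm {A : MOUS} {L : ∀ n : ℕ, A.Mat n → ℝ}
    (hL : IsMatrixLipschitzSeminorm A L)
    (h : ∀ (n : ℕ) (ι : Type) (l : Filter ι) (f : ι → MState A n) (ψ : MState A n),
      (∀ᶠ i in l, f i ∈ CS A n) → ψ ∈ CS A n →
      (∀ v p q, Tendsto (fun i => f i v p q) l (𝓝 (ψ v p q))) → ∀ δ : ℝ, 0 < δ →
        ∀ᶠ i in l, ∀ r (a : A.Mat r), L r a ≤ 1 → scalarOpNorm (mpair ψ a - mpair (f i) a) ≤ δ) :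
    IsMatrixLipNorm A L := by
  have hbdd : ∀ n, ∀ φ ∈ CS A n, ∀ ψ ∈ CS A n, ∃ R : ℝ, ∀ r (a : A.Mat r), L r a ≤ 1 →
      scalarOpNorm (mpair φ a - mpair ψ a) ≤ R := by
    intro n φ hφ ψ hψ
    have hmem : ∀ᶠ t : ℝ in 𝓝[>] 0, 0 < t ∧ t < 1 := Ioo_mem_nhdsGT one_pos
    have hev := h n ℝ (𝓝[>] 0) (fun t => ((1 - t : ℝ) : ℂ) • φ + (t : ℂ) • ψ) φ
      (hmem.mono fun t ht => CS.segment hφ hψ ht.1.le ht.2.le) hφ (fun v p q => ?_) 1 one_pos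
    · obtain ⟨t, ht, ht2⟩ := (hev.and hmem).exists
      refine ⟨1 / t, fun r a ha => ?_⟩
      have h1 := ht r a ha
      have e : mpair φ a - mpair (((1 - t : ℝ) : ℂ) • φ + (t : ℂ) • ψ) a =
          (t : ℂ) • (mpair φ a - mpair ψ a) := by
        ext p q
        simp [mpair]
        ring
      rw [e, scalarOpNorm_smul, Complex.norm_real, Real.norm_of_nonneg ht2.1.le] at h1
      rw [le_div_iff₀ ht2.1]
      linarith
    · have hc : Continuous fun t : ℝ => (((1 - t : ℝ) : ℂ) • φ + (t : ℂ) • ψ) v p q := by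
        simp only [LinearMap.add_apply, LinearMap.smul_apply, Matrix.add_apply, Matrix.smul_apply,
          smul_eq_mul]
        fun_prop
      have := (hc.tendsto 0).mono_left (nhdsWithin_le_nhds (s := Set.Ioi 0))
      simpa using this
  have hle : ∀ n, ∀ φ ∈ CS A n, ∀ ψ ∈ CS A n, ∀ r (a : A.Mat r), L r a ≤ 1 →
      scalarOpNorm (mpair φ a - mpair ψ a) ≤ Dmet A L n φ ψ := by
    intro n φ hφ ψ hψ r a ha
    obtain ⟨R, hR⟩ := hbdd n φ hφ ψ hψ
    refine le_csSup ⟨R, ?_⟩ ⟨r, a, ha, rfl⟩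
    rintro _ ⟨r, a, ha, rfl⟩
    exact hR r a ha
  refine ⟨hL, fun n => le_antisymm ?_ ?_⟩
  · rw [BWtop, lmTop, induced_compose, ← continuous_iff_le_induced]
    let := Dtop A L n
    refine continuous_pi fun v => continuous_pi fun p => continuous_pi fun q => ?_
    rw [Metric.continuous_iff']
    intro φ ε hε
    set c := L 1 (MOUS.mat1 v) + 1 with hc
    have hc0 : 0 < c := by
      have := hL.nonneg 1 (MOUS.mat1 v)
      linarith
    have hopen : IsOpen[Dtop A L n] {ψ | Dmet A L n φ.1 ψ.1 < ε / c} :=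
      TopologicalSpace.isOpen_generateFrom_of_mem ⟨φ, _, div_pos hε hc0, rfl⟩
    filter_upwards [hopen.mem_nhds (lt_of_eq_of_lt (dmet_self n φ.1) (div_pos hε hc0))] with ψ hψ
    have h1 := hle n _ φ.2 _ ψ.2 1 (((c⁻¹ : ℝ) : ℂ) • MOUS.mat1 v) (by
      rw [hL.smul_eq, Complex.norm_real, Real.norm_of_nonneg (inv_nonneg.2 hc0.le),
        inv_mul_le_iff₀ hc0]
      linarith)
    rw [mpair_smul, mpair_smul, ← smul_sub, scalarOpNorm_smul, Complex.norm_real,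
      Real.norm_of_nonneg (inv_nonneg.2 hc0.le), inv_mul_le_iff₀ hc0] at h1
    have h2 := norm_apply_le_scalarOpNorm (mpair φ.1 (MOUS.mat1 v) - mpair ψ.1 (MOUS.mat1 v))
      (0, p) (0, q)
    have h3 : c * Dmet A L n φ.1 ψ.1 < ε := by
      have := (lt_div_iff₀ hc0).1 hψ
      linarith
    rw [dist_comm, dist_eq_norm]
    exact (h2.trans h1).trans_lt h3
  · refine le_generateFrom ?_
    rintro _ ⟨φ, ε, hε, rfl⟩
    let := BWtop A n
    rw [isOpen_iff_mem_nhds]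
    intro ψ hψ
    have hlim : ∀ v p q, Tendsto (fun χ : {φ : MState A n // φ ∈ CS A n} => χ.1 v p q) (𝓝 ψ)
        (𝓝 (ψ.1 v p q)) := by
      intro v p q O hO
      obtain ⟨U, hU, hUo, hmem⟩ := mem_nhds_iff.1 hO
      exact mem_of_superset ((isOpen_BWtop_eval v p q hUo).mem_nhds hmem) fun χ hχ => hU hχ
    have hδ : 0 < (ε - Dmet A L n φ.1 ψ.1) / 2 := half_pos (sub_pos.2 hψ)
    filter_upwards [h n _ (𝓝 ψ) (fun χ => χ.1) ψ.1 (Eventually.of_forall fun χ => χ.2) ψ.2 hlim _ hδ]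
      with χ hχ
    refine (dmet_le (c := Dmet A L n φ.1 ψ.1 + (ε - Dmet A L n φ.1 ψ.1) / 2)
      (add_nonneg (dmet_nonneg _ _ _) hδ.le) fun r a ha => ?_).trans_lt (by linarith)
    rw [← sub_add_sub_cancel _ (mpair ψ.1 a)]
    exact (scalarOpNorm_add_le _ _).trans (add_le_add (hle n _ φ.2 _ ψ.2 r a ha) (hχ r a ha))

end Topologies

section Bridge

open Filter Topology

variable {A₁ A₂ W : MOUS} {L₁ : ∀ n : ℕ, A₁.Mat n → ℝ} {L₂ : ∀ n : ℕ, A₂.Mat n → ℝ}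
  {i₁ : A₁.carrier →ₗ[ℂ] W.carrier} {i₂ : A₂.carrier →ₗ[ℂ] W.carrier} {ε : ℝ}

theorem CS.isCPMap {A : MOUS} {n : ℕ} {φ : MState A n} (hφ : φ ∈ CS A n) : IsCPMap φ :=
  hφ.2

/-- The restriction of a matrix functional to the first summand. -/
def restrL {n : ℕ} (φ : MState (A₁.prod A₂) n) : MState A₁ n :=
  φ.comp (LinearMap.inl ℂ A₁.carrier A₂.carrier)

/-- The restriction of a matrix functional to the second summand. -/
def restrR {n : ℕ} (φ : MState (A₁.prod A₂) n) : MState A₂ n :=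
  φ.comp (LinearMap.inr ℂ A₁.carrier A₂.carrier)

theorem IsCPMap.restrL {n : ℕ} {φ : MState (A₁.prod A₂) n} (hφ : IsCPMap φ) :
    IsCPMap (restrL φ) :=
  fun r v hv => hφ r (pairMat v 0) ⟨hv, A₂.zero_mem_pos r⟩

theorem IsCPMap.restrR {n : ℕ} {φ : MState (A₁.prod A₂) n} (hφ : IsCPMap φ) :
    IsCPMap (restrR φ) :=
  fun r v hv => hφ r (pairMat 0 v) ⟨A₁.zero_mem_pos r, hv⟩

theorem apply_eq_restrL_add_restrR {n : ℕ} (φ : MState (A₁.prod A₂) n)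
    (v : (A₁.prod A₂).carrier) : φ v = restrL φ v.1 + restrR φ v.2 := by
  have e : v = ((v.1, 0) : (A₁.prod A₂).carrier) + ((0, v.2) : (A₁.prod A₂).carrier) :=
    Prod.ext (add_zero v.1).symm (zero_add v.2).symm
  exact (congrArg φ e).trans (map_add φ _ _)

theorem mat1_sub_smul_one_le {A : MOUS} {L : ∀ n : ℕ, A.Mat n → ℝ}
    (hL : IsMatrixLipschitzSeminorm A L) {a : A.carrier} (ha : L 1 (MOUS.mat1 a) ≤ 1) (c : ℂ) :
    L 1 (MOUS.mat1 (a - c • A.one)) ≤ 1 := by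
  have h1 : L 1 (MOUS.mat1 ((-c) • A.one)) = 0 :=
    (hL.null_iff 1 _).2 ⟨Matrix.of fun _ _ => -c, rfl⟩
  have h2 : MOUS.mat1 (a - c • A.one) = MOUS.mat1 a + MOUS.mat1 ((-c) • A.one) := by
    ext
    simp [MOUS.mat1, sub_eq_add_neg]
  rw [h2]
  refine (hL.add_le 1 _ _).trans ?_
  rwa [h1, add_zero]

theorem norm_state_sub_le {A : MOUS} {L : ∀ n : ℕ, A.Mat n → ℝ} (hL : IsMatrixLipNorm A L)
    {σ τ : MState A 1} (hσ : σ ∈ CS A 1) (hτ : τ ∈ CS A 1) {a : A.carrier}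
    (ha : L 1 (MOUS.mat1 a) ≤ 1) : ‖σ a 0 0 - τ a 0 0‖ ≤ Dmet A L 1 σ τ := by
  refine (norm_apply_le_scalarOpNorm (mpair σ (MOUS.mat1 a) - mpair τ (MOUS.mat1 a))
    (0, 0) (0, 0)).trans ((hL.le_mul_dmet hσ hτ _).trans ?_)
  exact (mul_le_mul_of_nonneg_right ha (dmet_nonneg _ _ _)).trans_eq (one_mul _)

/-- The bridge seminorm is a matrix Lip-norm. -/
theorem prodLip_isMatrixLipNorm (hL₁ : IsMatrixLipNorm A₁ L₁) (hL₂ : IsMatrixLipNorm A₂ L₂)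
    (h₁ : IsUCP A₁ W i₁) (h₂ : IsUCP A₂ W i₂) (hne : W.one ≠ 0) (hε : 0 < ε) :
    IsMatrixLipNorm (A₁.prod A₂) (prodLip L₁ L₂ i₁ i₂ ε) := by
  have hL := prodLip_isMatrixLipschitzSeminorm hL₁.toIsMatrixLipschitzSeminorm
    hL₂.toIsMatrixLipschitzSeminorm h₁ h₂ hne hε
  refine hL.isMatrixLipNorm fun n ι l f ψ hf hψ hlim δ hδ => ?_
  obtain ⟨ω, hω⟩ := W.exists_state hne
  obtain ⟨R₁, -, hR₁⟩ := hL₁.exists_dmet_le 1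
  obtain ⟨R₂, -, hR₂⟩ := hL₂.exists_dmet_le 1
  set δ' := δ / (n + 1) / 2 with hδ'
  have hδ'0 : 0 < δ' := by positivity
  have hlim1 : ∀ ξ v, Tendsto (fun i => quadFun (restrL (f i)) ξ v 0 0) l
      (𝓝 (quadFun (restrL ψ) ξ v 0 0)) := by
    intro ξ v
    simp only [quadFun_apply, dotProduct, Matrix.mulVec]
    exact tendsto_finsetSum _ fun p _ => (tendsto_finsetSum _ fun q _ =>
      (hlim _ p q).mul_const _).const_mul _
  have hlim2 : ∀ ξ v, Tendsto (fun i => quadFun (restrR (f i)) ξ v 0 0) l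
      (𝓝 (quadFun (restrR ψ) ξ v 0 0)) := by
    intro ξ v
    simp only [quadFun_apply, dotProduct, Matrix.mulVec]
    exact tendsto_finsetSum _ fun p _ => (tendsto_finsetSum _ fun q _ =>
      (hlim _ p q).mul_const _).const_mul _
  have hev : ∀ ξ : Fin n → ℂ, ∀ᶠ i in l, ∀ v : (A₁.prod A₂).carrier,
      prodLip L₁ L₂ i₁ i₂ ε 1 (MOUS.mat1 v) ≤ 1 →
        ‖star ξ ⬝ᵥ (ψ v - f i v).mulVec ξ‖ ≤ δ / (n + 1) := by
    intro ξ
    filter_upwards [hf,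
      hL₁.eventually_norm_sub_le (hf.mono fun i hi => ((CS.isCPMap hi).restrL.quadFun ξ))
        ((CS.isCPMap hψ).restrL.quadFun ξ) (hlim1 ξ) (R := R₁) hδ'0,
      hL₂.eventually_norm_sub_le (hf.mono fun i hi => ((CS.isCPMap hi).restrR.quadFun ξ))
        ((CS.isCPMap hψ).restrR.quadFun ξ) (hlim2 ξ) (R := R₂ + ε) hδ'0] with i hi hi1 hi2 v hv
    have hv1 : L₁ 1 (MOUS.mat1 v.1) ≤ 1 := (fst_le_prodLip 1 (MOUS.mat1 v)).trans hv
    have hv2 : L₂ 1 (MOUS.mat1 v.2) ≤ 1 := (snd_le_prodLip 1 (MOUS.mat1 v)).trans hv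
    have hv3 : ‖ω (i₁ v.1) 0 0 - ω (i₂ v.2) 0 0‖ ≤ ε := by
      refine (norm_apply_le_scalarOpNorm _ (0, 0) (0, 0)).trans
        ((scalarOpNorm_diff_le (L₁ := L₁) (L₂ := L₂) (i₁ := i₁) (i₂ := i₂) hε hω
          (MOUS.mat1 v)).trans ?_)
      exact (mul_le_mul_of_nonneg_left hv hε.le).trans_eq (mul_one ε)
    set c := ω (i₁ v.1) 0 0 with hc
    have hb1 : ∀ τ ∈ CS A₁ 1, ‖τ (v.1 - c • A₁.one) 0 0‖ ≤ R₁ := by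
      intro τ hτ
      have h := (norm_state_sub_le hL₁ hτ (CS.comp h₁ hω) hv1).trans (hR₁ τ hτ _ (CS.comp h₁ hω))
      simpa [hτ.1, hc] using h
    have hb2 : ∀ τ ∈ CS A₂ 1, ‖τ (v.2 - c • A₂.one) 0 0‖ ≤ R₂ + ε := by
      intro τ hτ
      have h := (norm_state_sub_le hL₂ hτ (CS.comp h₂ hω) hv2).trans (hR₂ τ hτ _ (CS.comp h₂ hω))
      have e : τ (v.2 - c • A₂.one) 0 0 = (τ v.2 0 0 - ω (i₂ v.2) 0 0) - (c - ω (i₂ v.2) 0 0) := by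
        simp [hτ.1]
      rw [e]
      exact (norm_sub_le _ _).trans (add_le_add h hv3)
    have k1 := hi1 _ (mat1_sub_smul_one_le hL₁.toIsMatrixLipschitzSeminorm hv1 c) hb1
    have k2 := hi2 _ (mat1_sub_smul_one_le hL₂.toIsMatrixLipschitzSeminorm hv2 c) hb2
    have e1 : ψ v - f i v = ψ (v - c • (A₁.prod A₂).one) - f i (v - c • (A₁.prod A₂).one) := by
      rw [map_sub, map_sub, map_smul, map_smul, hψ.1, hi.1]
      abel
    have e2 : star ξ ⬝ᵥ (ψ v - f i v).mulVec ξ =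
        (quadFun (restrL ψ) ξ (v.1 - c • A₁.one) 0 0 -
          quadFun (restrL (f i)) ξ (v.1 - c • A₁.one) 0 0) +
        (quadFun (restrR ψ) ξ (v.2 - c • A₂.one) 0 0 -
          quadFun (restrR (f i)) ξ (v.2 - c • A₂.one) 0 0) := by
      rw [e1, apply_eq_restrL_add_restrR ψ, apply_eq_restrL_add_restrR (f i)]
      simp only [quadFun_apply, Matrix.sub_mulVec, Matrix.add_mulVec, dotProduct_sub,
        dotProduct_add]
      exact add_sub_add_comm _ _ _ _
    rw [e2]
    refine (norm_add_le _ _).trans ((add_le_add k1 k2).trans_eq ?_)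
    rw [hδ']
    ring
  have hall : ∀ᶠ i in l, ∀ (p q : Fin n) (k : Fin 4), ∀ v : (A₁.prod A₂).carrier,
      prodLip L₁ L₂ i₁ i₂ ε 1 (MOUS.mat1 v) ≤ 1 →
        ‖star (Pi.single p 1 + Pi.single q (Complex.I ^ (k : ℕ)) : Fin n → ℂ) ⬝ᵥ
          (ψ v - f i v).mulVec (Pi.single p 1 + Pi.single q (Complex.I ^ (k : ℕ)))‖ ≤
            δ / (n + 1) :=
    eventually_all.2 fun p => eventually_all.2 fun q => eventually_all.2 fun k => hev _
  filter_upwards [hall] with i hi r a ha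
  refine (hL.scalarOpNorm_sub_le (fun v hv p q => ?_) a ha).trans
    (show (n : ℝ) * (δ / (n + 1)) ≤ δ from ?_)
  · exact norm_apply_le_of_quadForm (M := ψ v - f i v) fun k => hi p q k v hv
  · rw [mul_div_assoc', div_le_iff₀ (by positivity)]
    nlinarith

end Bridge

/-- A matrix order unit space whose unit vanishes is trivial. -/
theorem MOUS.subsingleton {A : MOUS} (h : A.one = 0) : Subsingleton A.carrier := by
  have key : ∀ x : A.carrier, star x = x → x = 0 := by
    intro x hx
    obtain ⟨t, -, h1⟩ := A.orderUnit x hx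
    obtain ⟨s, -, h2⟩ := A.orderUnit (-x) (by rw [star_neg, hx])
    simp only [h, smul_zero, zero_sub, neg_neg] at h1 h2
    have h3 := A.proper _ h2 h1
    exact congrFun (congrFun h3 0) 0
  refine ⟨fun u v => ?_⟩
  obtain ⟨x, y, hx, hy, rfl⟩ := A.exists_re_im u
  obtain ⟨x', y', hx', hy', rfl⟩ := A.exists_re_im v
  rw [key x hx, key y hy, key x' hx', key y' hy']

theorem distNC_of_subsingleton {A₁ A₂ : MOUS} (L₁ : ∀ n : ℕ, A₁.Mat n → ℝ)
    (L₂ : ∀ n : ℕ, A₂.Mat n → ℝ) (h₁ : Subsingleton A₁.carrier) (h₂ : Subsingleton A₂.carrier) :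
    distNC A₁ L₁ A₂ L₂ = 0 := by
  have hs : Subsingleton (A₁.prod A₂).carrier :=
    inferInstanceAs (Subsingleton (A₁.carrier × A₂.carrier))
  refine le_antisymm (Real.sInf_nonpos ?_) distNC_nonneg
  rintro _ ⟨L, -, rfl⟩
  refine Real.iSup_nonpos fun n => mul_nonpos_of_nonneg_of_nonpos (by positivity) ?_
  have hd : ∀ φ ψ, Dmet (A₁.prod A₂) L n φ ψ = 0 := fun φ ψ => by
    have : φ = ψ := LinearMap.ext fun v => by rw [Subsingleton.elim v 0, map_zero, map_zero]
    rw [this, dmet_self]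
  refine max_le (Real.sSup_nonpos ?_) (Real.sSup_nonpos ?_)
  · rintro _ ⟨x, -, rfl⟩
    refine Real.sInf_nonpos ?_
    rintro _ ⟨y, -, rfl⟩
    exact (hd x y).le
  · rintro _ ⟨y, -, rfl⟩
    refine Real.sInf_nonpos ?_
    rintro _ ⟨x, -, rfl⟩
    exact (hd x y).le

theorem distNC_eq_zero_of_common_closure {A₁ A₂ W : MOUS} {L₁ : ∀ n : ℕ, A₁.Mat n → ℝ}
    {L₂ : ∀ n : ℕ, A₂.Mat n → ℝ} {Lc : ∀ n : ℕ, W.Mat n → ℝ}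
    {i₁ : A₁.carrier →ₗ[ℂ] W.carrier} {i₂ : A₂.carrier →ₗ[ℂ] W.carrier}
    (hL₁ : IsMatrixLipNorm A₁ L₁) (hL₂ : IsMatrixLipNorm A₂ L₂)
    (h₁ : IsClosureOf A₁ L₁ W Lc i₁) (h₂ : IsClosureOf A₂ L₂ W Lc i₂) :
    distNC A₁ L₁ A₂ L₂ = 0 := by
  by_cases hne : W.one = 0
  · have hW := MOUS.subsingleton hne
    exact distNC_of_subsingleton L₁ L₂ h₁.inj.subsingleton h₂.inj.subsingleton
  have hne₁ : A₁.one ≠ 0 := fun h => hne (by rw [← h₁.ucp.unital, h, map_zero])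
  have hne₂ : A₂.one ≠ 0 := fun h => hne (by rw [← h₂.ucp.unital, h, map_zero])
  refine le_antisymm (le_of_forall_pos_le_add fun ε hε => ?_) distNC_nonneg
  rw [zero_add]
  exact distNC_le ⟨prodLip_isMatrixLipNorm hL₁ hL₂ h₁.ucp h₂.ucp hne hε,
    prodLip_induces_fst h₁ h₂ hL₁ hL₂ hne₂ hε, prodLip_induces_snd h₁ h₂ hL₁ hL₂ hne₁ hε⟩ hε.le
    (hDist_prodLip_le h₁ h₂ hε)

/-- Theorem 5.4 of the paper.  Suppose `(V₁, L₁)` and `(V₂, L₂)` are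
quantized metric spaces.  If there exists a complete isometry from `(V₁, L₁)` onto
`(V₂, L₂)` — that is, a unital complete order isomorphism `Φ : V₁ᶜ → V₂ᶜ` with
`L₁ᶜ = L₂ᶜ ∘ Φ` — then `dist_NC(V₁, V₂) = 0`. -/
theorem distNC_eq_zero_of_complete_isometry (A₁ A₂ : MOUS)
    (L₁ : ∀ n : ℕ, Matrix (Fin n) (Fin n) A₁.carrier → ℝ)
    (L₂ : ∀ n : ℕ, Matrix (Fin n) (Fin n) A₂.carrier → ℝ)
    (h₁ : IsMatrixLipNorm A₁ L₁) (h₂ : IsMatrixLipNorm A₂ L₂)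
    (W₁ : MOUS) (Lc₁ : ∀ n : ℕ, Matrix (Fin n) (Fin n) W₁.carrier → ℝ)
    (j₁ : A₁.carrier →ₗ[ℂ] W₁.carrier) (hc₁ : IsClosureOf A₁ L₁ W₁ Lc₁ j₁)
    (W₂ : MOUS) (Lc₂ : ∀ n : ℕ, Matrix (Fin n) (Fin n) W₂.carrier → ℝ)
    (j₂ : A₂.carrier →ₗ[ℂ] W₂.carrier) (hc₂ : IsClosureOf A₂ L₂ W₂ Lc₂ j₂)
    (Φ : W₁.carrier →ₗ[ℂ] W₂.carrier) (hΦ : IsCompleteOrderIso W₁ W₂ Φ)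
    (hiso : ∀ (n : ℕ) (a : Matrix (Fin n) (Fin n) W₁.carrier),
      Lc₁ n a = Lc₂ n (mapMat Φ a)) :
    distNC A₁ L₁ A₂ L₂ = 0 := by
  exact distNC_eq_zero_of_common_closure h₁ h₂ (hc₁.comp_iso hΦ hiso hc₂.lip hc₂.closed) hc₂

end
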